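/- For every ε > 0 there exist constants g = g(ε) and Δ₀ = Δ₀(ε) such that every finite simple graph G with maximum degree Δ ≥ Δ₀ and girth at least g satisfies a'(G) ≤ (1+ε)Δ, i.e. G admits an acyclic edge colouring with at most ⌊(1+ε)Δ⌋ colours. -/

import Mathlib

open SimpleGraph

/-- `c` is an acyclic edge colouring of `G` using colours from `{0, …, n-1}`:
every edge gets a colour `< n`, the colouring is proper (distinct edges sharing an
endpoint get different colours) and every cycle of `G` receives at least three colours. -/
def IsAcyclicEdgeColoring {V : Type} (G : SimpleGraph V) (n : ℕ) (c : Sym2 V → ℕ) : Prop :=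
  (∀ e ∈ G.edgeSet, c e < n) ∧
  (∀ e₁ ∈ G.edgeSet, ∀ e₂ ∈ G.edgeSet, e₁ ≠ e₂ → (∃ x, x ∈ e₁ ∧ x ∈ e₂) → c e₁ ≠ c e₂) ∧
  (∀ (v : V) (w : G.Walk v v), w.IsCycle → 3 ≤ (w.edges.map c).toFinset.card)

namespace ProductWeight
open Finset
open scoped Classical

variable {ι S : Type} [Fintype ι] [Fintype S]

/-- Expectation of `f` over the finite product space `ι → S` with coordinate weights `μ`. -/
noncomputable def Ex (μ : ι → S → ℝ) (f : (ι → S) → ℝ) : ℝ :=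
  ∑ ω, (∏ x, μ x (ω x)) * f ω

/-- Probability of an event in the finite product space `ι → S`. -/
noncomputable def Pr (μ : ι → S → ℝ) (A : (ι → S) → Prop) : ℝ :=
  Ex μ fun ω => if A ω then 1 else 0

/-- Each coordinate weight is a probability vector. -/
structure IsProb (μ : ι → S → ℝ) : Prop where
  nonneg : ∀ x s, 0 ≤ μ x s
  sum_eq_one : ∀ x, ∑ s, μ x s = 1

variable {μ : ι → S → ℝ}

theorem Ex_prod (φ : ι → S → ℝ) :
    Ex μ (fun ω => ∏ x, φ x (ω x)) = ∏ x, ∑ s, μ x s * φ x s := by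
  rw [Finset.prod_univ_sum, Ex, Fintype.piFinset_univ]
  exact sum_congr rfl fun ω _ => prod_mul_distrib.symm

theorem Ex_mul_left (a : ℝ) (f : (ι → S) → ℝ) : Ex μ (fun ω => a * f ω) = a * Ex μ f := by
  simp only [Ex, mul_sum]
  exact sum_congr rfl fun ω _ => by ring

theorem Ex_mul_right (a : ℝ) (f : (ι → S) → ℝ) : Ex μ (fun ω => f ω * a) = Ex μ f * a := by
  simp only [Ex, sum_mul]
  exact sum_congr rfl fun ω _ => by ring

theorem Ex_sum {κ : Type*} (s : Finset κ) (f : κ → (ι → S) → ℝ) :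
    Ex μ (fun ω => ∑ k ∈ s, f k ω) = ∑ k ∈ s, Ex μ (f k) := by
  simp only [Ex, mul_sum]
  exact sum_comm

theorem Ex_add (f g : (ι → S) → ℝ) : Ex μ (fun ω => f ω + g ω) = Ex μ f + Ex μ g := by
  simp only [Ex, mul_add, sum_add_distrib]

theorem Ex_sub (f g : (ι → S) → ℝ) : Ex μ (fun ω => f ω - g ω) = Ex μ f - Ex μ g := by
  simp only [Ex, mul_sub, sum_sub_distrib]

theorem weight_nonneg (hμ : IsProb μ) (ω : ι → S) : 0 ≤ ∏ x, μ x (ω x) :=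
  prod_nonneg fun x _ => hμ.nonneg x _

theorem Ex_mono (hμ : IsProb μ) {f g : (ι → S) → ℝ} (h : ∀ ω, f ω ≤ g ω) : Ex μ f ≤ Ex μ g :=
  sum_le_sum fun ω _ => mul_le_mul_of_nonneg_left (h ω) (weight_nonneg hμ ω)

theorem Ex_const (hμ : IsProb μ) (a : ℝ) : Ex μ (fun _ => a) = a := by
  have h := Ex_prod (μ := μ) (fun _ _ => 1)
  simp only [prod_const_one, mul_one, hμ.sum_eq_one] at h
  have := Ex_mul_left (μ := μ) a (fun _ => 1)
  rw [h] at this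
  simpa using this

theorem Ex_nonneg (hμ : IsProb μ) {f : (ι → S) → ℝ} (h : ∀ ω, 0 ≤ f ω) : 0 ≤ Ex μ f :=
  (Ex_const hμ 0).symm.le.trans (Ex_mono hμ h)

theorem Pr_nonneg (hμ : IsProb μ) (A : (ι → S) → Prop) : 0 ≤ Pr μ A :=
  Ex_nonneg hμ fun ω => by split_ifs <;> norm_num

theorem Pr_mono (hμ : IsProb μ) {A B : (ι → S) → Prop} (h : ∀ ω, A ω → B ω) :
    Pr μ A ≤ Pr μ B :=
  Ex_mono hμ fun ω => by
    by_cases hA : A ω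
    · simp [hA, h ω hA]
    · rw [if_neg hA]; split_ifs <;> norm_num

theorem Pr_le_sum (hμ : IsProb μ) {κ : Type*} (s : Finset κ) {A : (ι → S) → Prop}
    {B : κ → (ι → S) → Prop} (h : ∀ ω, A ω → ∃ k ∈ s, B k ω) :
    Pr μ A ≤ ∑ k ∈ s, Pr μ (B k) := by
  unfold Pr
  rw [← Ex_sum]
  refine Ex_mono hμ fun ω => ?_
  have h0 : ∀ k ∈ s, (0 : ℝ) ≤ if B k ω then 1 else 0 := fun k _ => by split_ifs <;> norm_num
  split_ifs with hA
  · obtain ⟨k, hk, hB⟩ := h ω hA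
    calc (1 : ℝ) = if B k ω then 1 else 0 := by simp [hB]
      _ ≤ _ := single_le_sum h0 hk
  · exact sum_nonneg h0

theorem Pr_or_le (hμ : IsProb μ) {A B C : (ι → S) → Prop} (h : ∀ ω, A ω → B ω ∨ C ω) :
    Pr μ A ≤ Pr μ B + Pr μ C := by
  unfold Pr
  rw [← Ex_add]
  refine Ex_mono hμ fun ω => ?_
  have := h ω
  split_ifs <;> simp_all

theorem Pr_eq_zero {A : (ι → S) → Prop} (h : ∀ ω, ¬ A ω) : Pr μ A = 0 := by
  simp [Pr, h, Ex]

theorem Pr_not (hμ : IsProb μ) (A : (ι → S) → Prop) : Pr μ (fun ω => ¬ A ω) = 1 - Pr μ A := by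
  have h := Ex_sub (μ := μ) (fun _ => 1) (fun ω => if A ω then 1 else 0)
  rw [Ex_const hμ] at h
  rw [Pr, Pr, ← h]
  congr 1
  ext ω
  by_cases h : A ω <;> simp [h]

theorem exists_of_Pr_pos {A : (ι → S) → Prop} (h : 0 < Pr μ A) : ∃ ω, A ω := by
  by_contra! hA
  exact h.ne' (Pr_eq_zero hA)

/-- Swapping the coordinates in `s` between two samples preserves the joint weight. -/
theorem sum_swap (s : Set ι) (F : (ι → S) → (ι → S) → ℝ) :
    ∑ ω, ∑ ω', (∏ x, μ x (ω x)) * (∏ x, μ x (ω' x)) * F (s.piecewise ω ω') (s.piecewise ω' ω) =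
      ∑ ω, ∑ ω', (∏ x, μ x (ω x)) * (∏ x, μ x (ω' x)) * F ω ω' := by
  rw [← Fintype.sum_prod_type', ← Fintype.sum_prod_type']
  let φ : (ι → S) × (ι → S) → (ι → S) × (ι → S) :=
    fun q => (s.piecewise q.1 q.2, s.piecewise q.2 q.1)
  have hφ : Function.Involutive φ := by
    rintro ⟨a, b⟩
    ext x <;> by_cases hx : x ∈ s <;> simp [φ, hx]
  refine Fintype.sum_equiv hφ.toPerm _ _ ?_
  rintro ⟨a, b⟩
  simp only [Function.Involutive.coe_toPerm, φ]
  congr 1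
  rw [← prod_mul_distrib, ← prod_mul_distrib]
  refine prod_congr rfl fun x _ => ?_
  by_cases hx : x ∈ s <;> simp [hx, mul_comm]

/-- Resampling the coordinates in `s` does not change expectations. -/
theorem Ex_resample (hμ : IsProb μ) (s : Set ι) (f : (ι → S) → ℝ) :
    Ex μ (fun ω => Ex μ fun ω' => f (s.piecewise ω' ω)) = Ex μ f := by
  have h := sum_swap (μ := μ) s (fun _ ω' => f ω')
  have h1 : Ex μ (fun ω => Ex μ fun ω' => f (s.piecewise ω' ω)) =
      ∑ ω, ∑ ω', (∏ x, μ x (ω x)) * (∏ x, μ x (ω' x)) * f (s.piecewise ω' ω) := by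
    simp only [Ex, mul_sum]
    exact sum_congr rfl fun ω _ => sum_congr rfl fun ω' _ => by ring
  have h2 : Ex μ (fun _ : ι → S => Ex μ f) =
      ∑ ω : ι → S, ∑ ω', (∏ x, μ x (ω x)) * (∏ x, μ x (ω' x)) * f ω' := by
    simp only [Ex, mul_sum]
    exact sum_congr rfl fun ω _ => sum_congr rfl fun ω' _ => by ring
  rw [h1, h, ← h2, Ex_const hμ (Ex μ f)]

theorem Ex_mul_of_dependsOn (hμ : IsProb μ) {f g : (ι → S) → ℝ} {s t : Set ι}
    (hf : DependsOn f s) (hg : DependsOn g t) (hst : Disjoint s t) :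
    Ex μ (fun ω => f ω * g ω) = Ex μ f * Ex μ g := by
  rw [← Ex_resample hμ s, ← Ex_mul_left]
  congr 1
  ext ω
  rw [← Ex_mul_right]
  congr 1
  ext ω'
  congr 1
  · exact hf fun x hx => by simp [hx]
  · exact hg fun x hx => by simp [Set.disjoint_right.1 hst hx]

theorem Pr_and_of_dependsOn (hμ : IsProb μ) {A B : (ι → S) → Prop} {s t : Set ι}
    (hA : DependsOn A s) (hB : DependsOn B t) (hst : Disjoint s t) :
    Pr μ (fun ω => A ω ∧ B ω) = Pr μ A * Pr μ B := by
  unfold Pr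
  rw [← Ex_mul_of_dependsOn hμ (s := s) (t := t) (fun ω ω' h => by simp only [hA h])
    (fun ω ω' h => by simp only [hB h]) hst]
  congr 1
  ext ω
  by_cases h1 : A ω <;> by_cases h2 : B ω <;> simp [h1, h2]

theorem Ex_prod_of_dependsOn (hμ : IsProb μ) {κ : Type*} (C : Finset κ)
    {f : κ → (ι → S) → ℝ} {s : κ → Set ι} (hf : ∀ c ∈ C, DependsOn (f c) (s c))
    (hs : ∀ c ∈ C, ∀ c' ∈ C, c ≠ c' → Disjoint (s c) (s c')) :
    Ex μ (fun ω => ∏ c ∈ C, f c ω) = ∏ c ∈ C, Ex μ (f c) := by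
  induction C using Finset.induction_on with
  | empty => simpa using Ex_const hμ 1
  | insert a C ha ih =>
    simp only [prod_insert ha]
    rw [← ih (fun c hc => hf c (mem_insert_of_mem hc))
      (fun c hc c' hc' => hs c (mem_insert_of_mem hc) c' (mem_insert_of_mem hc'))]
    refine Ex_mul_of_dependsOn hμ (hf a (mem_insert_self _ _)) (t := ⋃ c ∈ C, s c) ?_ ?_
    · intro ω ω' h
      refine prod_congr rfl fun c hc => hf c (mem_insert_of_mem hc) fun x hx => h x ?_
      exact Set.mem_biUnion hc hx
    · simp only [Set.disjoint_iUnion_right]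
      intro c hc
      exact hs a (mem_insert_self _ _) c (mem_insert_of_mem hc) fun h => ha (h ▸ hc)

theorem Ex_coord (hμ : IsProb μ) (x : ι) (φ : S → ℝ) :
    Ex μ (fun ω => φ (ω x)) = ∑ s, μ x s * φ s := by
  have h := Ex_prod (μ := μ) (fun x' s => if x' = x then φ s else 1)
  have h' : ∀ ω : ι → S, ∏ x', (if x' = x then φ (ω x') else 1) = φ (ω x) := fun ω => by
    rw [Fintype.prod_ite_eq']
  simp only [h'] at h
  rw [h, prod_eq_single x]
  · simp
  · intro y _ hy
    simp [hy, hμ.sum_eq_one]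
  · simp

theorem Ex_comp (hμ : IsProb μ) {κ : Type} [Fintype κ] {j : κ → ι}
    (hj : Function.Injective j) (f : (κ → S) → ℝ) :
    Ex μ (fun ω => f (fun k => ω (j k))) = Ex (fun k => μ (j k)) f := by
  have key : ∀ (ν : κ → S), Ex μ (fun ω => ∏ k, if ω (j k) = ν k then (1 : ℝ) else 0) =
      ∏ k, μ (j k) (ν k) := by
    intro ν
    have h := Ex_prod_of_dependsOn hμ univ
      (f := fun k ω => if ω (j k) = ν k then (1 : ℝ) else 0) (s := fun k => {j k})
      (fun k _ ω ω' h => by simp [h (j k) rfl])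
      (fun k _ k' _ h => by simpa using fun h' => h (hj h'))
    rw [h]
    refine prod_congr rfl fun k _ => ?_
    rw [Ex_coord hμ (j k) fun s => if s = ν k then (1 : ℝ) else 0]
    simp
  have h2 : (fun ω : ι → S => f (fun k => ω (j k))) =
      fun ω => ∑ ν : κ → S, (∏ k, if ω (j k) = ν k then (1 : ℝ) else 0) * f ν := by
    ext ω
    rw [sum_eq_single (fun k => ω (j k))]
    · simp
    · intro ν _ hν
      obtain ⟨k, hk⟩ := Function.ne_iff.1 hν
      rw [prod_eq_zero (mem_univ k) (if_neg (Ne.symm hk)), zero_mul]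
    · simp
  rw [h2, Ex_sum]
  exact sum_congr rfl fun ν _ => by rw [Ex_mul_right, key]

/-- The symmetric local lemma for events on a finite product space. -/
theorem exists_avoiding (hμ : IsProb μ) {V : Type} [Fintype V] {B : V → (ι → S) → Prop}
    {s : V → Set ι} (hB : ∀ v, DependsOn (B v) (s v)) {d : ℝ} (hd : 1 ≤ d)
    (hdeg : ∀ v, ((univ.filter fun w => ¬ Disjoint (s w) (s v)).card : ℝ) ≤ d)
    (hp : ∀ v, Pr μ (B v) ≤ 1 / (4 * d)) : ∃ ω, ∀ v, ¬ B v ω := by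
  let Q : Finset V → ℝ := fun T => Pr μ fun ω => ∀ w ∈ T, ¬ B w ω
  have hQ0 : ∀ T, 0 ≤ Q T := fun T => Pr_nonneg hμ _
  have d0 : 0 < d := by linarith
  have hins : ∀ (T U : Finset V),
      Q U - ∑ w ∈ T, Pr μ (fun ω => B w ω ∧ ∀ u ∈ U, ¬ B u ω) ≤ Q (U ∪ T) := by
    intro T U
    have h1 : Q U ≤ Q (U ∪ T) + Pr μ (fun ω => ∃ w ∈ T, B w ω ∧ ∀ u ∈ U, ¬ B u ω) := by
      refine Pr_or_le hμ fun ω hω => ?_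
      by_cases h : ∃ w ∈ T, B w ω
      · obtain ⟨w, hw, hb⟩ := h
        exact Or.inr ⟨w, hw, hb, hω⟩
      · push Not at h
        refine Or.inl fun w hw => ?_
        rcases mem_union.1 hw with hw | hw
        exacts [hω w hw, h w hw]
    have h2 := Pr_le_sum hμ T (A := fun ω => ∃ w ∈ T, B w ω ∧ ∀ u ∈ U, ¬ B u ω)
      (B := fun w ω => B w ω ∧ ∀ u ∈ U, ¬ B u ω) fun ω h => h
    linarith
  have main : ∀ n, ∀ T : Finset V, T.card ≤ n → ∀ v,
      Pr μ (fun ω => B v ω ∧ ∀ u ∈ T, ¬ B u ω) ≤ 1 / (2 * d) * Q T := by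
    intro n
    induction n with
    | zero =>
      intro T hT v
      rw [Nat.le_zero, card_eq_zero] at hT
      subst hT
      have : Q ∅ = 1 := by simpa [Q, Pr] using Ex_const hμ 1
      rw [this, mul_one]
      refine (Pr_mono hμ fun ω h => h.1).trans ((hp v).trans ?_)
      exact one_div_le_one_div_of_le (by positivity) (by linarith)
    | succ n ih =>
      intro T hT v
      let T1 := T.filter fun w => ¬ Disjoint (s w) (s v)
      let T2 := T.filter fun w => Disjoint (s w) (s v)
      have hT12 : T2 ∪ T1 = T := filter_union_filter_not_eq _ _
      have hind : Pr μ (fun ω => B v ω ∧ ∀ u ∈ T2, ¬ B u ω) = Pr μ (B v) * Q T2 := by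
        refine Pr_and_of_dependsOn hμ (hB v) (t := ⋃ w ∈ T2, s w) (fun ω ω' h => ?_) ?_
        · exact propext (forall₂_congr fun u hu => by
            rw [hB u fun x hx => h x (Set.mem_biUnion hu hx)])
        · simp only [Set.disjoint_iUnion_right]
          intro w hw
          exact (mem_filter.1 hw).2.symm
      have hle : Pr μ (fun ω => B v ω ∧ ∀ u ∈ T, ¬ B u ω) ≤ Pr μ (B v) * Q T2 := by
        rw [← hind]
        exact Pr_mono hμ fun ω h => ⟨h.1, fun u hu => h.2 u (mem_filter.1 hu).1⟩
      have hhalf : Q T2 / 2 ≤ Q T := by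
        by_cases hT1 : T1 = ∅
        · rw [hT1, union_empty] at hT12
          rw [hT12]
          linarith [hQ0 T]
        · have hc : T2.card ≤ n := by
            have : T2.card + T1.card = T.card := card_filter_add_card_filter_not _
            have := card_pos.2 (nonempty_iff_ne_empty.2 hT1)
            omega
          have h1 := hins T1 T2
          rw [hT12] at h1
          have h2 : ∑ w ∈ T1, Pr μ (fun ω => B w ω ∧ ∀ u ∈ T2, ¬ B u ω) ≤
              d * (1 / (2 * d) * Q T2) := by
            refine (sum_le_sum fun w _ => ih T2 hc w).trans ?_
            rw [sum_const, nsmul_eq_mul]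
            refine mul_le_mul_of_nonneg_right ?_ (mul_nonneg (by positivity) (hQ0 _))
            refine le_trans ?_ (hdeg v)
            exact_mod_cast card_le_card (filter_subset_filter _ (subset_univ _))
          have h3 : d * (1 / (2 * d) * Q T2) = Q T2 / 2 := by field_simp
          linarith
      have h4 := mul_le_mul_of_nonneg_right (hp v) (hQ0 T2)
      have h5 : 1 / (4 * d) * Q T2 = 1 / (2 * d) * (Q T2 / 2) := by field_simp; ring
      have h6 := mul_le_mul_of_nonneg_left hhalf (show (0 : ℝ) ≤ 1 / (2 * d) by positivity)
      linarith
  have hpos : ∀ T : Finset V, 0 < Q T := by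
    intro T
    induction T using Finset.induction_on with
    | empty =>
      have : Q ∅ = 1 := by simpa [Q, Pr] using Ex_const hμ 1
      rw [this]; exact one_pos
    | insert a T ha ih =>
      have h1 := hins {a} T
      rw [sum_singleton, union_comm, ← insert_eq] at h1
      have h2 := main _ T le_rfl a
      have h3 : 1 / (2 * d) ≤ 1 / 2 := one_div_le_one_div_of_le (by norm_num) (by linarith)
      nlinarith
  obtain ⟨ω, hω⟩ := exists_of_Pr_pos (hpos univ)
  exact ⟨ω, fun v => hω v (mem_univ v)⟩

/-- A tail bound for sums of adapted indicator variables with bounded conditional means. -/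
theorem Pr_sum_ge_le (hμ : IsProb μ) (B : ℕ → Set ι) (Y : ℕ → (ι → S) → ℝ)
    (hY : ∀ a ω, Y a ω = 0 ∨ Y a ω = 1)
    (hdep : ∀ a k, a < k → DependsOn (Y a) (B k)ᶜ) {π η : ℝ} (hπ0 : 0 ≤ π) (hπ : π ≤ 1)
    (hη0 : 0 < η) (hη : η ≤ 1)
    (hmean : ∀ a ω, Ex μ (fun ω' => Y a ((B a).piecewise ω' ω)) ≤ π) (t : ℕ) :
    Pr μ (fun ω => (π + η) * t ≤ ∑ a ∈ range t, Y a ω) ≤ Real.exp (-(t * η ^ 2 / 4)) := by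
  set h : ℝ := η / 2 with hh
  have hE : ∀ k, Ex μ (fun ω => ∏ a ∈ range k, Real.exp (h * Y a ω)) ≤
      (1 + π * (Real.exp h - 1)) ^ k := by
    intro k
    induction k with
    | zero => simpa using (Ex_const hμ 1).le
    | succ k ih =>
      rw [← Ex_resample hμ (B k), pow_succ]
      have h0 : 0 ≤ Real.exp h - 1 := by
        have := Real.add_one_le_exp h
        have : 0 < h := by positivity
        linarith
      refine le_trans ?_ (mul_le_mul_of_nonneg_right ih (by positivity))
      rw [← Ex_mul_right]
      refine Ex_mono hμ fun ω => ?_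
      have h1 : ∀ ω', ∏ a ∈ range (k + 1), Real.exp (h * Y a ((B k).piecewise ω' ω)) =
          (∏ a ∈ range k, Real.exp (h * Y a ω)) *
            (1 + Y k ((B k).piecewise ω' ω) * (Real.exp h - 1)) := by
        intro ω'
        rw [prod_range_succ]
        congr 1
        · refine prod_congr rfl fun a ha => ?_
          rw [hdep a k (mem_range.1 ha) (y := ω) fun x hx => by
            simp [Set.piecewise_eq_of_notMem _ _ _ hx]]
        · rcases hY k ((B k).piecewise ω' ω) with h | h <;> simp [h]
      simp only [h1]
      rw [Ex_mul_left, Ex_add, Ex_const hμ, Ex_mul_right]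
      have := mul_le_mul_of_nonneg_right (hmean k ω) h0
      exact mul_le_mul_of_nonneg_left (by linarith) (prod_nonneg fun _ _ => (Real.exp_pos _).le)
  have hmarkov : Pr μ (fun ω => (π + η) * t ≤ ∑ a ∈ range t, Y a ω) ≤
      Ex μ (fun ω => Real.exp (-(h * ((π + η) * t))) * ∏ a ∈ range t, Real.exp (h * Y a ω)) := by
    refine Ex_mono hμ fun ω => ?_
    rw [← Real.exp_sum, ← mul_sum, ← Real.exp_add]
    split_ifs with hω
    · refine Real.one_le_exp ?_
      have := mul_le_mul_of_nonneg_left hω (show 0 ≤ h by positivity)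
      linarith
    · exact (Real.exp_pos _).le
  refine hmarkov.trans ?_
  rw [Ex_mul_left]
  have h2 : 1 + π * (Real.exp h - 1) ≤ Real.exp (π * (h + h ^ 2)) := by
    have h3 : Real.exp h ≤ 1 + h + h ^ 2 := by
      have := Real.abs_exp_sub_one_sub_id_le (x := h)
        (by rw [abs_of_nonneg (by positivity)]; linarith)
      linarith [(abs_le.1 this).2]
    have := Real.add_one_le_exp (π * (h + h ^ 2))
    nlinarith
  have h4 : 0 ≤ 1 + π * (Real.exp h - 1) := by
    have := Real.add_one_le_exp h
    have : 0 ≤ h := by positivity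
    nlinarith
  have h5 := (hE t).trans (pow_le_pow_left₀ h4 h2 t)
  rw [← Real.exp_nat_mul] at h5
  refine (mul_le_mul_of_nonneg_left h5 (Real.exp_pos _).le).trans ?_
  rw [← Real.exp_add, Real.exp_le_exp]
  have t0 : (0 : ℝ) ≤ t := Nat.cast_nonneg t
  have h6 : π * h ^ 2 ≤ h ^ 2 := by nlinarith [sq_nonneg h]
  have h7 := mul_le_mul_of_nonneg_left h6 t0
  rw [hh] at h7 ⊢
  linarith
end ProductWeight

namespace ProductWeight
open Finset
open scoped Classical

variable {ι S : Type} [Fintype ι] [Fintype S] {μ : ι → S → ℝ}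

theorem Pr_forall_of_dependsOn (hμ : IsProb μ) {κ : Type*} (C : Finset κ)
    {A : κ → (ι → S) → Prop} {s : κ → Set ι} (hA : ∀ c ∈ C, DependsOn (A c) (s c))
    (hs : ∀ c ∈ C, ∀ c' ∈ C, c ≠ c' → Disjoint (s c) (s c')) :
    Pr μ (fun ω => ∀ c ∈ C, A c ω) = ∏ c ∈ C, Pr μ (A c) := by
  unfold Pr
  rw [← Ex_prod_of_dependsOn hμ C (f := fun c ω => if A c ω then 1 else 0) (s := s) ?_ hs]
  · refine congrArg _ (funext fun ω => ?_)
    rw [prod_ite_zero, prod_const_one]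
    congr
  · intro c hc x y hxy
    simp only [hA c hc hxy]

theorem Pr_exists_eq_sum {κ : Type*} (C : Finset κ) {A : (ι → S) → Prop} {B : κ → (ι → S) → Prop}
    (h : ∀ ω, A ω ↔ ∃ k ∈ C, B k ω) (hB : ∀ ω k k', k ∈ C → k' ∈ C → B k ω → B k' ω → k = k') :
    Pr μ A = ∑ k ∈ C, Pr μ (B k) := by
  unfold Pr
  rw [← Ex_sum]
  refine congrArg _ (funext fun ω => ?_)
  by_cases hA : A ω
  · obtain ⟨k, hk, hkω⟩ := (h ω).1 hA
    rw [if_pos hA, sum_eq_single_of_mem k hk, if_pos hkω]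
    exact fun k' hk' hne => if_neg fun h' => hne (hB ω k' k hk' hk h' hkω)
  · rw [if_neg hA, sum_eq_zero]
    exact fun k hk => if_neg fun h' => hA ((h ω).2 ⟨k, hk, h'⟩)

theorem Pr_coord (hμ : IsProb μ) (x : ι) (P : S → Prop) [DecidablePred P] :
    Pr μ (fun ω => P (ω x)) = ∑ s, if P s then μ x s else 0 := by
  unfold Pr
  refine (Ex_coord hμ x fun s => @ite ℝ (P s) (Classical.propDecidable _) 1 0).trans
    (sum_congr rfl fun s _ => ?_)
  by_cases h : P s <;> simp [h]

theorem Pr_le_one (hμ : IsProb μ) (A : (ι → S) → Prop) : Pr μ A ≤ 1 := by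
  have h := Pr_not hμ A
  have h' := Pr_nonneg hμ fun ω => ¬ A ω
  linarith

theorem Pr_le_Ex_of_resample (hμ : IsProb μ) (s : Set ι) {A : (ι → S) → Prop}
    {F : (ι → S) → ℝ} (h : ∀ ω, Pr μ (fun ω' => A (s.piecewise ω' ω)) ≤ F ω) :
    Pr μ A ≤ Ex μ F := by
  unfold Pr
  rw [← Ex_resample hμ s]
  exact Ex_mono hμ h

end ProductWeight

/-- `p` runs periodically around a cycle of length `2 * l` with edges in `E` whose colours
under `c` alternate. -/
structure AltCycle {V : Type} (E : Set (Sym2 V)) (c : Sym2 V → ℕ) (l : ℕ) (p : ℕ → V) : Prop where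
  inj : ∀ i j, p i = p j ↔ i ≡ j [MOD 2 * l]
  mem : ∀ i, s(p i, p (i + 1)) ∈ E
  alt : ∀ i, c s(p (i + 2), p (i + 3)) = c s(p i, p (i + 1))

/-- `c` is proper on the edge set `E` and admits no alternating cycle of length at least `g`. -/
structure GoodColoring {V : Type} (g : ℕ) (E : Set (Sym2 V)) (c : Sym2 V → ℕ) : Prop where
  proper : ∀ x y z, s(x, y) ∈ E → s(x, z) ∈ E → c s(x, y) = c s(x, z) → y = z
  noAlt : ∀ l p, g ≤ 2 * l → ¬ AltCycle E c l p

namespace AltCycle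

variable {V : Type} {E : Set (Sym2 V)} {c : Sym2 V → ℕ} {l : ℕ} {p : ℕ → V}

theorem periodic (h : AltCycle E c l p) (i : ℕ) : p (i + 2 * l) = p i :=
  (h.inj _ _).2 (by simp [Nat.ModEq])

theorem alt_add (h : AltCycle E c l p) (i k : ℕ) :
    c s(p (i + 2 * k), p (i + 2 * k + 1)) = c s(p i, p (i + 1)) := by
  induction k with
  | zero => rfl
  | succ k ih => rw [← ih, ← h.alt (i + 2 * k)]; rfl

theorem mono (h : AltCycle E c l p) {E' : Set (Sym2 V)} {c' : Sym2 V → ℕ}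
    (hE : ∀ i, s(p i, p (i + 1)) ∈ E') (hc : ∀ i, c' s(p i, p (i + 1)) = c s(p i, p (i + 1))) :
    AltCycle E' c' l p :=
  ⟨h.inj, hE, fun i => ((hc (i + 2)).trans (h.alt i)).trans (hc i).symm⟩

theorem shift (h : AltCycle E c l p) (k : ℕ) : AltCycle E c l fun i => p (i + k) where
  inj i j := by
    rw [h.inj]
    exact ⟨fun h => Nat.ModEq.add_right_cancel' k h, fun h => Nat.ModEq.add_right k h⟩
  mem i := by
    have := h.mem (i + k)
    rwa [add_right_comm] at this
  alt i := by
    have := h.alt (i + k)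
    simpa only [add_right_comm] using this

/-- Traversing an alternating cycle backwards. -/
theorem mirror {k : ℕ} (h : AltCycle E c (k + 1) p) :
    AltCycle E c (k + 1) fun i => p (1 + (2 * k + 1) * i) := by
  have hq : ∀ i, s(p (1 + (2 * k + 1) * i), p (1 + (2 * k + 1) * (i + 1))) =
      s(p (1 + (2 * k + 1) * (i + 1)), p (1 + (2 * k + 1) * (i + 1) + 1)) := fun i => by
    rw [Sym2.eq_swap, ← h.periodic (1 + (2 * k + 1) * i),
      show 1 + (2 * k + 1) * i + 2 * (k + 1) = 1 + (2 * k + 1) * (i + 1) + 1 by ring]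
  refine ⟨fun i j => ?_, fun i => ?_, fun i => ?_⟩
  · rw [h.inj]
    have hcop : Nat.Coprime (2 * (k + 1)) (2 * k + 1) := by
      rw [show 2 * (k + 1) = 2 * k + 1 + 1 by ring]
      simp
    exact ⟨fun h => Nat.ModEq.cancel_left_of_coprime hcop (Nat.ModEq.add_left_cancel' 1 h),
      fun h => Nat.ModEq.add_left 1 (Nat.ModEq.mul_left _ h)⟩
  · rw [hq]
    exact h.mem _
  · rw [hq, hq i, ← h.alt_add (1 + (2 * k + 1) * (i + 1)) (2 * k + 1),
      show 1 + (2 * k + 1) * (i + 2 + 1) = 1 + (2 * k + 1) * (i + 1) + 2 * (2 * k + 1) by ring]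

end AltCycle

theorem GoodColoring.mono {V : Type} {g : ℕ} {E E' : Set (Sym2 V)} {c c' : Sym2 V → ℕ}
    (h : GoodColoring g E c) (hE : E' ⊆ E) (hc : ∀ e ∈ E', c' e = c e) :
    GoodColoring g E' c' where
  proper x y z hy hz hyz := h.proper x y z (hE hy) (hE hz) (by rwa [← hc _ hy, ← hc _ hz])
  noAlt l p hl hp := h.noAlt l p hl <| hp.mono (fun i => hE (hp.mem i)) fun i => (hc _ (hp.mem i)).symm

theorem GoodColoring.isAcyclicEdgeColoring {V : Type} {G : SimpleGraph V} {g n : ℕ}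
    {c : Sym2 V → ℕ} (h : GoodColoring g G.edgeSet c) (hn : ∀ e ∈ G.edgeSet, c e < n)
    (hg : ∀ (v : V) (w : G.Walk v v), w.IsCycle → g ≤ w.length) :
    IsAcyclicEdgeColoring G n c := by
  refine ⟨hn, ?_, ?_⟩
  · rintro e he e' he' hne ⟨x, hx, hx'⟩ hc
    obtain ⟨y, rfl⟩ := hx
    obtain ⟨z, rfl⟩ := hx'
    exact hne (by rw [h.proper x y z he he' hc])
  · intro v w hw
    by_contra! hcard
    have hm := hw.three_le_length
    set m := w.length with hmdef
    let p : ℕ → V := fun i => w.getVert (i % m)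
    have hm0 : 0 < m := by omega
    have hinj : ∀ i j, p i = p j ↔ i ≡ j [MOD m] := by
      intro i j
      refine ⟨fun hij => ?_, fun hij => by simp only [p]; rw [hij]⟩
      refine hw.getVert_injOn' ?_ ?_ hij <;> simp <;> have := Nat.mod_lt i hm0 <;>
        have := Nat.mod_lt j hm0 <;> omega
    have hsucc : ∀ i, p (i + 1) = w.getVert (i % m + 1) := by
      intro i
      simp only [p]
      rw [Nat.add_mod, Nat.mod_eq_of_lt (show 1 < m by omega)]
      rcases Nat.lt_or_ge (i % m + 1) m with h' | h'
      · rw [Nat.mod_eq_of_lt h']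
      · have hi : i % m + 1 = m := by have := Nat.mod_lt i hm0; omega
        rw [hi, Nat.mod_self, SimpleGraph.Walk.getVert_zero, hmdef, SimpleGraph.Walk.getVert_length]
    have hmem : ∀ i, s(p i, p (i + 1)) ∈ w.edges := by
      intro i
      rw [hsucc]
      exact w.mk_mem_edges_iff_exists.2 ⟨_, Nat.mod_lt i hm0, rfl⟩
    have hE : ∀ i, s(p i, p (i + 1)) ∈ G.edgeSet := fun i => w.edges_subset_edgeSet (hmem i)
    have hF : ∀ i, c s(p i, p (i + 1)) ∈ (w.edges.map c).toFinset := fun i => by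
      rw [List.mem_toFinset]; exact List.mem_map_of_mem (hmem i)
    have hne : ∀ i, c s(p (i + 1), p (i + 2)) ≠ c s(p i, p (i + 1)) := by
      intro i hi
      have h1 := h.proper (p (i + 1)) (p (i + 2)) (p i) (hE (i + 1))
        (by rw [Sym2.eq_swap]; exact hE i) (by rw [hi, Sym2.eq_swap])
      rw [hinj] at h1
      have := (Nat.modEq_iff_dvd' (show i ≤ i + 2 by omega)).1 h1.symm
      have := Nat.le_of_dvd (by omega) this
      omega
    have halt : ∀ i, c s(p (i + 2), p (i + 3)) = c s(p i, p (i + 1)) := by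
      intro i
      by_contra hi
      refine absurd hcard (not_lt.2 ?_)
      have hsub : ({c s(p i, p (i + 1)), c s(p (i + 1), p (i + 2)), c s(p (i + 2), p (i + 3))} :
          Finset ℕ) ⊆ (w.edges.map c).toFinset := by
        intro x hx
        simp only [Finset.mem_insert, Finset.mem_singleton] at hx
        rcases hx with rfl | rfl | rfl
        exacts [hF i, hF (i + 1), hF (i + 2)]
      refine le_trans ?_ (Finset.card_le_card hsub)
      rw [Finset.card_eq_three.2 ⟨_, _, _, (hne i).symm, fun h => hi h.symm, (hne (i + 1)).symm, rfl⟩]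
    have halt' : ∀ k, c s(p (2 * k), p (2 * k + 1)) = c s(p 0, p 1) := by
      intro k
      induction k with
      | zero => rfl
      | succ k ih => rw [← ih, ← halt (2 * k)]; rfl
    obtain ⟨l, hl | hl⟩ := Nat.even_or_odd' m
    · refine h.noAlt l p (hl ▸ hg v w hw) ⟨fun i j => ?_, hE, halt⟩
      rw [hinj, hl]
    · have h1 := halt' (l + 1)
      have h2 : p (2 * (l + 1)) = p 1 := (hinj _ _).2 (by rw [show 2 * (l + 1) = 1 + m by omega]; simp [Nat.ModEq])
      have h3 : p (2 * (l + 1) + 1) = p 2 := (hinj _ _).2 (by rw [show 2 * (l + 1) + 1 = 2 + m by omega]; simp [Nat.ModEq])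
      rw [h2, h3] at h1
      exact hne 0 h1

theorem AltCycle.edge_inj {V : Type} {E : Set (Sym2 V)} {c : Sym2 V → ℕ} {l : ℕ} {p : ℕ → V}
    (h : AltCycle E c l p) (hl : 2 ≤ l) {i j : ℕ}
    (hij : s(p i, p (i + 1)) = s(p j, p (j + 1))) : i ≡ j [MOD 2 * l] := by
  rcases Sym2.eq_iff.1 hij with ⟨h1, -⟩ | ⟨h1, h2⟩
  · exact (h.inj _ _).1 h1
  · rw [h.inj] at h1 h2
    have h3 : j + 2 ≡ j + 0 [MOD 2 * l] := (h1.add_right 1).symm.trans h2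
    have h4 := (Nat.modEq_zero_iff_dvd.1 (Nat.ModEq.add_left_cancel' j h3))
    have := Nat.le_of_dvd (by omega) h4
    omega

theorem AltCycle.two_mul_le_card {V : Type} [Fintype V] {E : Set (Sym2 V)} {c : Sym2 V → ℕ}
    {l : ℕ} {p : ℕ → V} (h : AltCycle E c l p) : 2 * l ≤ Fintype.card V := by
  have hi : Function.Injective fun i : Fin (2 * l) => p i := fun i j hij =>
    Fin.ext (Nat.ModEq.eq_of_lt_of_lt ((h.inj _ _).1 hij) i.2 j.2)
  simpa using Fintype.card_le_of_injective _ hi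

/-- An alternating cycle can be re-based so that it starts with any prescribed one of its edges,
traversed in either direction. -/
theorem AltCycle.exists_start {V : Type} {E : Set (Sym2 V)} {c : Sym2 V → ℕ}
    {l : ℕ} {p : ℕ → V} (h : AltCycle E c l p) (hl : 0 < l) (k : ℕ) {x y : V}
    (hk : s(p k, p (k + 1)) = s(x, y)) :
    ∃ q, AltCycle E c l q ∧ q 0 = x ∧ q 1 = y ∧
      ∀ i, ∃ j, s(q i, q (i + 1)) = s(p j, p (j + 1)) := by
  obtain ⟨l, rfl⟩ : ∃ l', l = l' + 1 := ⟨l - 1, by omega⟩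
  have hs := h.shift k
  rcases Sym2.eq_iff.1 hk with ⟨h1, h2⟩ | ⟨h1, h2⟩
  · exact ⟨_, hs, by simpa using h1, by simpa [add_comm] using h2,
      fun i => ⟨i + k, by rw [add_right_comm]⟩⟩
  · refine ⟨_, hs.mirror, by simpa [add_comm] using h2, ?_, fun i => ?_⟩
    · rw [← h1, ← h.periodic k]
      congr 1
      ring
    · refine ⟨1 + (2 * l + 1) * (i + 1) + k, ?_⟩
      rw [Sym2.eq_swap, ← h.periodic (1 + (2 * l + 1) * i + k),
        show 1 + (2 * l + 1) * i + k + 2 * (l + 1) = 1 + (2 * l + 1) * (i + 1) + k + 1 by ring]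

namespace ColoringExtension
open Finset
open scoped Classical

variable {V : Type} {E₀ : Set (Sym2 V)} {c : Sym2 V → ℕ} {g n m : ℕ}

/-- The colouring `c` on `E₀`, combined with `φ` shifted by `n` elsewhere. -/
noncomputable def combine (E₀ : Set (Sym2 V)) (c : Sym2 V → ℕ) (n : ℕ) (φ : Sym2 V → Fin m)
    (e : Sym2 V) : ℕ :=
  if e ∈ E₀ then c e else n + φ e

/-- `φ` colours a linked path of `k + 1` edges from `x` to `y` alternately by `α` and `β`, the
edges being distinct members of `S` outside `Q`; consecutive edges are joined by `link`. -/
def LinkedPath (S : Finset (Sym2 V)) (link : V → V) (φ : Sym2 V → Fin m) :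
    ℕ → Finset (Sym2 V) → V → V → Fin m → Fin m → Prop
  | 0, Q, x, y, α, _ => s(x, y) ∈ S ∧ s(x, y) ∉ Q ∧ φ s(x, y) = α
  | k + 1, Q, x, y, α, β => ∃ w, s(x, w) ∈ S ∧ s(x, w) ∉ Q ∧ φ s(x, w) = α ∧
      LinkedPath S link φ k (insert s(x, w) Q) (link w) y β α

theorem linkedPath_of_seq {S : Finset (Sym2 V)} {link : V → V} {φ : Sym2 V → Fin m} (k : ℕ)
    (Q : Finset (Sym2 V)) (u v : ℕ → V) (α β : Fin m)
    (hS : ∀ i ≤ k, s(u i, v i) ∈ S) (hQ : ∀ i ≤ k, s(u i, v i) ∉ Q)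
    (hinj : ∀ i ≤ k, ∀ j ≤ k, s(u i, v i) = s(u j, v j) → i = j)
    (hlink : ∀ i < k, link (v i) = u (i + 1))
    (hα : ∀ i ≤ k, φ s(u i, v i) = if Even i then α else β) :
    LinkedPath S link φ k Q (u 0) (v k) α β := by
  induction k generalizing Q u v α β with
  | zero => exact ⟨hS 0 le_rfl, hQ 0 le_rfl, by simpa using hα 0 le_rfl⟩
  | succ k ih =>
    refine ⟨v 0, hS 0 (by omega), hQ 0 (by omega), by simpa using hα 0 (by omega), ?_⟩
    rw [hlink 0 (by omega)]
    refine ih (insert s(u 0, v 0) Q) (fun i => u (i + 1)) (fun i => v (i + 1)) β α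
      (fun i hi => hS _ (by omega)) (fun i hi h => ?_) (fun i hi j hj h => ?_)
      (fun i hi => hlink _ (by omega)) (fun i hi => ?_)
    · rcases mem_insert.1 h with h | h
      · have := hinj _ (by omega) _ (by omega) h
        omega
      · exact hQ _ (by omega) h
    · have := hinj _ (by omega) _ (by omega) h
      omega
    · have := hα (i + 1) (by omega)
      rw [this]
      by_cases h : Even i <;> simp [h, Nat.even_add_one]

variable [Fintype V]

/-- The good extensions of `c` to the additional edge set `S`, normalised to be `z` off `S`. -/
noncomputable def extensions (g : ℕ) (E₀ : Set (Sym2 V)) (c : Sym2 V → ℕ) (n : ℕ) (z : Fin m)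
    (S : Finset (Sym2 V)) : Finset (Sym2 V → Fin m) :=
  univ.filter fun φ => (∀ e ∉ S, φ e = z) ∧ GoodColoring g (E₀ ∪ S) (combine E₀ c n φ)

theorem card_filter_agree_le (z : Fin m) {S Q : Finset (Sym2 V)} (ψ : Sym2 V → Fin m) :
    ((extensions g E₀ c n z S).filter fun φ => ∀ e ∈ Q, φ e = ψ e).card ≤
      (extensions g E₀ c n z (S \ Q)).card := by
  refine card_le_card_of_injOn (fun φ e => if e ∈ Q then z else φ e) ?_ ?_
  · intro φ hφ
    simp only [extensions, coe_filter, mem_filter, mem_univ, true_and, Set.mem_ofPred_eq] at hφ ⊢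
    refine ⟨fun e he => ?_, hφ.1.2.mono (Set.union_subset_union_right _ ?_) fun e he => ?_⟩
    · rw [mem_sdiff, not_and, not_not] at he
      split_ifs with h
      · rfl
      · exact hφ.1.1 e fun h' => h (he h')
    · exact_mod_cast sdiff_subset
    · unfold combine
      rcases he with he | he
      · simp [he]
      · have he' : e ∉ Q := (mem_sdiff.1 (mem_coe.1 he)).2
        simp [he']
  · intro φ hφ φ' hφ' h
    simp only [coe_filter, Set.mem_ofPred_eq] at hφ hφ'
    ext1 e
    by_cases he : e ∈ Q
    · rw [hφ.2 e he, hφ'.2 e he]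
    · simpa [he] using congrFun h e

/-- The number of extensions grows by a factor at least `b` with every edge of `S`. -/
def Grows (g : ℕ) (E₀ : Set (Sym2 V)) (c : Sym2 V → ℕ) (n : ℕ) (z : Fin m) (b : ℝ)
    (S : Finset (Sym2 V)) : Prop :=
  ∀ Q ⊆ S, b ^ Q.card * (extensions g E₀ c n z (S \ Q)).card ≤ (extensions g E₀ c n z S).card

theorem card_filter_linkedPath_le {z : Fin m} {b : ℝ} (hb : 0 < b) {S : Finset (Sym2 V)}
    (hS : Grows g E₀ c n z b S) {d : ℕ}
    (hd : ∀ x, (univ.filter fun w => s(x, w) ∈ S).card ≤ d) (link : V → V) (k : ℕ)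
    (Q : Finset (Sym2 V)) (hQ : Q ⊆ S) (ψ : Sym2 V → Fin m) (x y : V) (α β : Fin m) :
    (((extensions g E₀ c n z S).filter fun φ =>
      (∀ e ∈ Q, φ e = ψ e) ∧ LinkedPath S link φ k Q x y α β).card : ℝ) ≤
      d ^ k * (extensions g E₀ c n z S).card / b ^ (k + 1 + Q.card) := by
  induction k generalizing Q ψ x α β with
  | zero =>
    by_cases hxy : s(x, y) ∈ S ∧ s(x, y) ∉ Q
    · have h1 := hS (insert s(x, y) Q) (insert_subset hxy.1 hQ)
      rw [card_insert_of_notMem hxy.2] at h1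
      have h2 := card_filter_agree_le (g := g) (E₀ := E₀) (c := c) (n := n) z (S := S)
        (Q := insert s(x, y) Q) (Function.update ψ s(x, y) α)
      rw [pow_zero, one_mul, le_div_iff₀ (by positivity), mul_comm]
      rw [show 0 + 1 + Q.card = Q.card + 1 by ring]
      refine le_trans (mul_le_mul_of_nonneg_left ?_ (by positivity)) h1
      refine le_trans (Nat.cast_le.2 (card_le_card ?_)) (Nat.cast_le.2 h2)
      intro φ hφ
      obtain ⟨h0, hψ, -, -, hα⟩ := mem_filter.1 hφ
      refine mem_filter.2 ⟨h0, fun e he => ?_⟩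
      rcases mem_insert.1 he with rfl | he
      · simp [hα]
      · rw [Function.update_of_ne (ne_of_mem_of_not_mem he hxy.2)]
        exact hψ e he
    · rw [filter_false_of_mem]
      · simp only [card_empty, Nat.cast_zero]
        positivity
      · intro φ _ h
        exact hxy ⟨h.2.1, h.2.2.1⟩
  | succ k ih =>
    let W := univ.filter fun w => s(x, w) ∈ S
    have h1 : ((extensions g E₀ c n z S).filter fun φ =>
        (∀ e ∈ Q, φ e = ψ e) ∧ LinkedPath S link φ (k + 1) Q x y α β) ⊆
        W.biUnion fun w => if s(x, w) ∈ Q then ∅ else (extensions g E₀ c n z S).filter fun φ =>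
          (∀ e ∈ insert s(x, w) Q, φ e = Function.update ψ s(x, w) α e) ∧
            LinkedPath S link φ k (insert s(x, w) Q) (link w) y β α := by
      intro φ hφ
      obtain ⟨h0, hψ, w, hw, hwQ, hα, hp⟩ := mem_filter.1 hφ
      refine mem_biUnion.2 ⟨w, mem_filter.2 ⟨mem_univ _, hw⟩, ?_⟩
      rw [if_neg hwQ, mem_filter]
      refine ⟨h0, fun e he => ?_, hp⟩
      rcases mem_insert.1 he with rfl | he
      · simp [hα]
      · rw [Function.update_of_ne (ne_of_mem_of_not_mem he hwQ)]
        exact hψ e he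
    refine (Nat.cast_le.2 ((card_le_card h1).trans card_biUnion_le)).trans ?_
    rw [Nat.cast_sum]
    have h2 : ∀ w ∈ W, (((if s(x, w) ∈ Q then ∅ else (extensions g E₀ c n z S).filter fun φ =>
          (∀ e ∈ insert s(x, w) Q, φ e = Function.update ψ s(x, w) α e) ∧
            LinkedPath S link φ k (insert s(x, w) Q) (link w) y β α).card : ℕ) : ℝ) ≤
        d ^ k * (extensions g E₀ c n z S).card / b ^ (k + 1 + 1 + Q.card) := by
      intro w hw
      split_ifs with hwQ
      · simp only [card_empty, Nat.cast_zero]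
        positivity
      · have := ih (insert s(x, w) Q) (insert_subset (mem_filter.1 hw).2 hQ)
          (Function.update ψ s(x, w) α) (link w) β α
        rwa [card_insert_of_notMem hwQ,
          show k + 1 + (Q.card + 1) = k + 1 + 1 + Q.card by ring] at this
    refine (sum_le_sum h2).trans ?_
    rw [sum_const, nsmul_eq_mul]
    have h3 : (W.card : ℝ) ≤ d := Nat.cast_le.2 (hd x)
    refine (mul_le_mul_of_nonneg_right h3 (by positivity)).trans (le_of_eq ?_)
    rw [pow_succ]
    ring

end ColoringExtension

namespace ColoringExtension
open Finset
open scoped Classical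

variable {V : Type} {E₀ : Set (Sym2 V)} {c : Sym2 V → ℕ} {g n m : ℕ}

theorem combine_of_mem {φ : Sym2 V → Fin m} {e : Sym2 V} (he : e ∈ E₀) :
    combine E₀ c n φ e = c e := if_pos he

theorem combine_of_notMem {φ : Sym2 V → Fin m} {e : Sym2 V} (he : e ∉ E₀) :
    combine E₀ c n φ e = n + φ e := if_neg he

/-- The partner of `x` in the colour class `b` of `E₀`, or `x` itself if there is none. -/
noncomputable def partner (E₀ : Set (Sym2 V)) (c : Sym2 V → ℕ) (b : ℕ) (x : V) : V :=
  if h : ∃ y, s(x, y) ∈ E₀ ∧ c s(x, y) = b then h.choose else x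

theorem partner_eq (hc : GoodColoring g E₀ c) {x y : V} {b : ℕ} (hxy : s(x, y) ∈ E₀)
    (hb : c s(x, y) = b) : partner E₀ c b x = y := by
  have h : ∃ y, s(x, y) ∈ E₀ ∧ c s(x, y) = b := ⟨y, hxy, hb⟩
  rw [partner, dif_pos h]
  exact hc.proper x _ _ h.choose_spec.1 hxy (h.choose_spec.2.trans hb.symm)

variable [Fintype V]

/-- The ways in which giving colour `a` to the edge `s(x, y)` can spoil a good extension. -/
theorem obstruction (hg : 6 ≤ g) (hc : GoodColoring g E₀ c) (hcn : ∀ e ∈ E₀, c e < n)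
    {z : Fin m} {S : Finset (Sym2 V)} {x y : V} (hxy : s(x, y) ∉ E₀)
    {φ : Sym2 V → Fin m} (hφ : φ ∈ extensions g E₀ c n z S) {a : Fin m}
    (ha : Function.update φ s(x, y) a ∉ extensions g E₀ c n z (insert s(x, y) S)) :
    (∃ u ∈ ({x, y} : Finset V), ∃ w, s(u, w) ∈ S ∧ φ s(u, w) = a) ∨
    (∃ b < n, ∃ j < Fintype.card V,
      LinkedPath S (partner E₀ c b) φ (j + 1) ∅ (partner E₀ c b y) (partner E₀ c b x) a a) ∨
    ∃ a', ∃ j < Fintype.card V, LinkedPath S id φ (2 * j + 4) ∅ y x a' a := by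
  simp only [extensions, mem_filter, mem_univ, true_and] at hφ ha
  set ψ := Function.update φ s(x, y) a with hψ
  have hψe : ψ s(x, y) = a := by simp [ψ]
  have hψne : ∀ e, e ≠ s(x, y) → ψ e = φ e := fun e he => Function.update_of_ne he _ _
  have hcomb : ∀ e, e ≠ s(x, y) → combine E₀ c n φ e = combine E₀ c n ψ e := fun e he => by
    simp only [combine, hψne e he]
  have hmem : ∀ e ∈ E₀ ∪ ((insert s(x, y) S : Finset (Sym2 V)) : Set (Sym2 V)),
      e ≠ s(x, y) → e ∈ E₀ ∪ (S : Set (Sym2 V)) := by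
    rintro e (he | he) hne
    · exact Or.inl he
    · exact Or.inr ((mem_insert.1 (mem_coe.1 he)).resolve_left hne)
  have hmemS : ∀ e ∈ E₀ ∪ ((insert s(x, y) S : Finset (Sym2 V)) : Set (Sym2 V)),
      n ≤ combine E₀ c n ψ e → e ≠ s(x, y) →
        e ∈ S ∧ combine E₀ c n ψ e = n + φ e := by
    intro e he hn hne
    rcases hmem e he hne with h | h
    · rw [combine_of_mem h] at hn
      exact absurd (hcn e h) (by omega)
    · have h0 : e ∉ E₀ := fun h0 => by
        rw [combine_of_mem h0] at hn
        exact absurd (hcn e h0) (by omega)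
      exact ⟨mem_coe.1 h, by rw [combine_of_notMem h0, hψne e hne]⟩
  have hcxy : combine E₀ c n ψ s(x, y) = n + a := by rw [combine_of_notMem hxy, hψe]
  by_contra! hcon
  obtain ⟨hno1, hno2, hno3⟩ := hcon
  refine ha ⟨fun e he => ?_, ⟨fun u v w hv hw hvw => ?_, fun l p hl hp => ?_⟩⟩
  · rw [mem_insert, not_or] at he
    rw [hψne e he.1, hφ.1 e he.2]
  · by_contra hne
    have key : ∀ v w, s(u, w) ∈ E₀ ∪ ((insert s(x, y) S : Finset (Sym2 V)) : Set (Sym2 V)) →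
        v ≠ w → combine E₀ c n ψ s(u, v) = combine E₀ c n ψ s(u, w) → s(u, v) ≠ s(x, y) := by
      intro v w hw hne hvw hv
      have hwne : s(u, w) ≠ s(x, y) := fun h => hne (Sym2.congr_right.1 (hv.trans h.symm))
      rw [hv, hcxy] at hvw
      obtain ⟨h1, h2⟩ := hmemS _ hw (by omega) hwne
      have hu : u ∈ ({x, y} : Finset V) := by
        have : u ∈ s(x, y) := hv ▸ Sym2.mem_mk_left u v
        simpa using this
      exact hno1 u hu w h1 (Fin.ext (by omega))
    have h1 := key v w hw hne hvw
    have h2 := key w v hv (Ne.symm hne) hvw.symm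
    exact hne (hφ.2.proper u v w (hmem _ hv h1) (hmem _ hw h2) (by rw [hcomb _ h1, hcomb _ h2, hvw]))
  · by_cases hk : ∃ k, s(p k, p (k + 1)) = s(x, y)
    · obtain ⟨k, hk⟩ := hk
      obtain ⟨q, hq, hq0, hq1, -⟩ := hp.exists_start (by omega) k hk
      have hcard := hq.two_mul_le_card
      have h01 : s(q 0, q 1) = s(x, y) := by rw [hq0, hq1]
      have hev : ∀ i, combine E₀ c n ψ s(q (2 * i), q (2 * i + 1)) = n + a := fun i => by
        have := hq.alt_add 0 i
        rw [zero_add] at this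
        rw [this, h01, hcxy]
      have hodd : ∀ i, combine E₀ c n ψ s(q (2 * i + 1), q (2 * i + 2)) =
          combine E₀ c n ψ s(q 1, q 2) := fun i => by
        have := hq.alt_add 1 i
        rw [add_comm 1] at this
        exact this
      have hlt : ∀ i < 2 * l, ∀ j < 2 * l, s(q i, q (i + 1)) = s(q j, q (j + 1)) → i = j :=
        fun i hi j hj h => Nat.ModEq.eq_of_lt_of_lt (hq.edge_inj (by omega) h) hi hj
      have hne : ∀ i, 0 < i → i < 2 * l → s(q i, q (i + 1)) ≠ s(x, y) := fun i h0 hi h => by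
        have := hlt i hi 0 (by omega) (h.trans h01.symm)
        omega
      have hevS : ∀ i, 0 < i → i < l → s(q (2 * i), q (2 * i + 1)) ∈ S ∧
          φ s(q (2 * i), q (2 * i + 1)) = a := fun i h0 hi => by
        obtain ⟨h1, h2⟩ := hmemS _ (hq.mem (2 * i)) (by rw [hev]; omega)
          (hne _ (by omega) (by omega))
        rw [hev] at h2
        exact ⟨h1, Fin.ext (by omega)⟩
      by_cases hb : combine E₀ c n ψ s(q 1, q 2) < n
      · have hoddE : ∀ i, s(q (2 * i + 1), q (2 * i + 2)) ∈ E₀ := fun i => by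
          by_contra h
          have := hodd i
          rw [combine_of_notMem h] at this
          omega
        have hoddc : ∀ i, c s(q (2 * i + 1), q (2 * i + 2)) = combine E₀ c n ψ s(q 1, q 2) :=
          fun i => by rw [← hodd i, combine_of_mem (hoddE i)]
        have hpart : ∀ i, partner E₀ c (combine E₀ c n ψ s(q 1, q 2)) (q (2 * i + 1)) =
            q (2 * i + 2) := fun i => partner_eq hc (hoddE i) (hoddc i)
        refine hno2 _ hb (l - 3) (by omega) ?_
        have hy := hpart 0
        have hx : partner E₀ c (combine E₀ c n ψ s(q 1, q 2)) (q 0) = q (2 * (l - 1) + 1) := by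
          refine partner_eq hc ?_ ?_
          · have := hoddE (l - 1)
            rwa [show 2 * (l - 1) + 2 = 0 + 2 * l by omega, hq.periodic, Sym2.eq_swap] at this
          · have := hoddc (l - 1)
            rwa [show 2 * (l - 1) + 2 = 0 + 2 * l by omega, hq.periodic, Sym2.eq_swap] at this
        rw [← hq0, ← hq1, hx]
        rw [show 2 * 0 + 1 = 1 from rfl] at hy
        rw [hy, show l - 1 = (l - 3 + 1) + 1 by omega]
        refine linkedPath_of_seq (l - 3 + 1) ∅ (fun i => q (2 * (i + 1)))
          (fun i => q (2 * (i + 1) + 1)) a a (fun i hi => (hevS _ (by omega) (by omega)).1)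
          (fun i hi => notMem_empty _) (fun i hi j hj h => ?_) (fun i hi => hpart _)
          (fun i hi => ?_)
        · have := hlt _ (by omega) _ (by omega) h
          omega
        · rw [(hevS _ (by omega) (by omega)).2, ite_self]
      · have hoddS : ∀ i, i < l → s(q (2 * i + 1), q (2 * i + 2)) ∈ S ∧
            combine E₀ c n ψ s(q 1, q 2) = n + φ s(q (2 * i + 1), q (2 * i + 2)) := fun i hi => by
          obtain ⟨h1, h2⟩ := hmemS _ (hq.mem (2 * i + 1))
            (by rw [show 2 * i + 1 + 1 = 2 * i + 2 from rfl, hodd]; omega)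
            (hne _ (by omega) (by omega))
          exact ⟨h1, by rw [← hodd i]; exact h2⟩
        refine hno3 (φ s(q 1, q 2)) (l - 3) (by omega) ?_
        have hx : x = q (2 * (l - 3) + 4 + 2) := by
          rw [← hq0, ← hq.periodic 0]
          congr 1
          omega
        rw [hx, ← hq1]
        refine linkedPath_of_seq (2 * (l - 3) + 4) ∅ (fun i => q (i + 1)) (fun i => q (i + 2))
          (φ s(q 1, q 2)) a (fun i hi => ?_) (fun i hi => notMem_empty _)
          (fun i hi j hj h => ?_) (fun i hi => rfl) (fun i hi => ?_)
        · obtain ⟨j, rfl | rfl⟩ := Nat.even_or_odd' i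
          · exact (hoddS j (by omega)).1
          · exact (hevS (j + 1) (by omega) (by omega)).1
        · have := hlt _ (by omega) _ (by omega) h
          omega
        · obtain ⟨j, rfl | rfl⟩ := Nat.even_or_odd' i
          · rw [if_pos (even_two_mul j)]
            have h1 := (hoddS 0 (by omega)).2
            have h2 := (hoddS j (by omega)).2
            exact Fin.ext (by simpa using h2.symm.trans h1)
          · rw [if_neg (by simp)]
            exact (hevS (j + 1) (by omega) (by omega)).2
    · push Not at hk
      exact hφ.2.noAlt l p hl (hp.mono (fun i => hmem _ (hp.mem i) (hk i)) fun i => hcomb _ (hk i))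

theorem card_step (hg : 6 ≤ g) (hc : GoodColoring g E₀ c) (hcn : ∀ e ∈ E₀, c e < n)
    (hm : 0 < m) {d : ℕ} (hnm : 20 * (n + m) * d ≤ m ^ 2) {z : Fin m} {S : Finset (Sym2 V)}
    {e : Sym2 V} (he : e ∉ E₀) (heS : e ∉ S)
    (hd : ∀ x, (univ.filter fun w => s(x, w) ∈ S).card ≤ d)
    (hS : Grows g E₀ c n z (m / 2) S) :
    (m / 2 : ℝ) * (extensions g E₀ c n z S).card ≤
      (extensions g E₀ c n z (insert e S)).card := by
  induction e using Sym2.ind with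
  | _ x y =>
  set C := extensions g E₀ c n z S with hC
  set M := Fintype.card V
  have hm' : (0 : ℝ) < m := Nat.cast_pos.2 hm
  let P := C ×ˢ (univ : Finset (Fin m))
  let bad : (Sym2 V → Fin m) × Fin m → Prop :=
    fun q => Function.update q.1 s(x, y) q.2 ∉ extensions g E₀ c n z (insert s(x, y) S)
  have hP : ((P.filter bad).card : ℝ) + (P.filter fun q => ¬ bad q).card = C.card * m := by
    rw [← Nat.cast_add, card_filter_add_card_filter_not, card_product, card_univ, Fintype.card_fin,
      Nat.cast_mul]
  have hgood : (P.filter fun q => ¬ bad q).card ≤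
      (extensions g E₀ c n z (insert s(x, y) S)).card := by
    refine card_le_card_of_injOn (fun q => Function.update q.1 s(x, y) q.2) ?_ ?_
    · intro q hq
      exact not_not.1 (mem_filter.1 (mem_coe.1 hq)).2
    · rintro ⟨φ, a⟩ hq ⟨φ', a'⟩ hq' h
      have h1 := mem_product.1 (mem_filter.1 (mem_coe.1 hq)).1
      have h1' := mem_product.1 (mem_filter.1 (mem_coe.1 hq')).1
      simp only [hC, extensions, mem_filter] at h1 h1'
      have h2 : a = a' := by simpa using congrFun h s(x, y)
      refine Prod.ext (funext fun f => ?_) h2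
      by_cases hf : f = s(x, y)
      · rw [hf]
        exact (h1.1.2.1 _ heS).trans (h1'.1.2.1 _ heS).symm
      · simpa [hf] using congrFun h f
  let L1 : ℕ → ℕ → Fin m → Finset ((Sym2 V → Fin m)) := fun b j a => C.filter fun φ =>
    (∀ e ∈ (∅ : Finset (Sym2 V)), φ e = z) ∧
      LinkedPath S (partner E₀ c b) φ (j + 1) ∅ (partner E₀ c b y) (partner E₀ c b x) a a
  let L2 : Fin m → ℕ → Fin m → Finset ((Sym2 V → Fin m)) := fun a' j a => C.filter fun φ =>
    (∀ e ∈ (∅ : Finset (Sym2 V)), φ e = z) ∧ LinkedPath S id φ (2 * j + 4) ∅ y x a' a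
  have hbad : P.filter bad ⊆
      ((({x, y} : Finset V).biUnion fun u => (univ.filter fun w => s(u, w) ∈ S).biUnion fun w =>
        C.image fun φ => (φ, φ s(u, w))) ∪
      (univ : Finset (Fin m)).biUnion fun a => (range n).biUnion fun b => (range M).biUnion fun j =>
        (L1 b j a).image fun φ => (φ, a)) ∪
      (univ : Finset (Fin m)).biUnion fun a => (univ : Finset (Fin m)).biUnion fun a' =>
        (range M).biUnion fun j => (L2 a' j a).image fun φ => (φ, a) := by
    rintro ⟨φ, a⟩ hq
    obtain ⟨hq, hb⟩ := mem_filter.1 hq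
    have hφ := (mem_product.1 hq).1
    simp only [mem_union, mem_biUnion, mem_image, mem_univ, true_and, mem_range, Prod.mk.injEq]
    rcases obstruction hg hc hcn he hφ hb with
      ⟨u, hu, w, hw, ha⟩ | ⟨b, hb, j, hj, hp⟩ | ⟨a', j, hj, hp⟩
    · exact Or.inl (Or.inl ⟨u, hu, w, by simpa using hw, φ, hφ, rfl, ha⟩)
    · exact Or.inl (Or.inr ⟨a, b, hb, j, hj, φ, mem_filter.2 ⟨hφ, by simp, hp⟩, rfl, rfl⟩)
    · exact Or.inr ⟨a, a', j, hj, φ, mem_filter.2 ⟨hφ, by simp, hp⟩, rfl, rfl⟩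
  have hr : (d : ℝ) / (m / 2) ≤ 1 / 2 := by
    have : 20 * m * d ≤ m * m := by nlinarith
    have : 20 * d ≤ m := Nat.le_of_mul_le_mul_left (by linarith) hm
    have : (20 * d : ℝ) ≤ m := by exact_mod_cast this
    rw [div_le_iff₀ (by positivity)]
    linarith
  have hr0 : (0 : ℝ) ≤ (d : ℝ) / (m / 2) := by positivity
  have hb0 : (m : ℝ) / 2 ≠ 0 := by positivity
  set t : ℝ := d * C.card / (m / 2) ^ 2 with ht
  have ht0 : 0 ≤ t := by positivity
  have hL1 : ∀ b j a, ((L1 b j a).card : ℝ) ≤ t * (1 / 2) ^ j := by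
    intro b j a
    have h := card_filter_linkedPath_le (by positivity) hS hd (partner E₀ c b) (j + 1) ∅
      (empty_subset _) (fun _ => z) (partner E₀ c b y) (partner E₀ c b x) a a
    refine h.trans (le_trans (le_of_eq ?_)
      (mul_le_mul_of_nonneg_left (pow_le_pow_left₀ hr0 hr j) ht0))
    rw [ht, card_empty, ← hC]
    generalize (m : ℝ) / 2 = b at hb0
    rw [div_pow]
    field_simp
    ring
  have hL2 : ∀ a' j a, ((L2 a' j a).card : ℝ) ≤ t * (1 / 2) ^ j := by
    intro b j a
    have h := card_filter_linkedPath_le (by positivity) hS hd id (2 * j + 4) ∅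
      (empty_subset _) (fun _ => z) y x b a
    refine h.trans (le_trans (le_of_eq ?_)
      (mul_le_mul_of_nonneg_left ((pow_le_pow_left₀ hr0 hr (2 * j + 3)).trans
        (pow_le_pow_of_le_one (by norm_num) (by norm_num) (show j ≤ 2 * j + 3 by omega))) ht0))
    rw [ht, card_empty, ← hC]
    generalize (m : ℝ) / 2 = b at hb0
    rw [div_pow]
    field_simp
    ring
  have hgeom : ∀ f : ℕ → ℝ, (∀ j, f j ≤ t * (1 / 2) ^ j) → ∑ j ∈ range M, f j ≤ t * 2 := by
    intro f hf
    refine (sum_le_sum fun j _ => hf j).trans ?_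
    rw [← mul_sum]
    exact mul_le_mul_of_nonneg_left (sum_geometric_two_le M) ht0
  have hb1 : ((({x, y} : Finset V).biUnion fun u => (univ.filter fun w => s(u, w) ∈ S).biUnion
      fun w => C.image fun φ => (φ, φ s(u, w))).card : ℝ) ≤ 2 * (d * C.card) := by
    have h : (({x, y} : Finset V).biUnion fun u => (univ.filter fun w => s(u, w) ∈ S).biUnion
        fun w => C.image fun φ => (φ, φ s(u, w))).card ≤ 2 * (d * C.card) := by
      refine (card_biUnion_le_card_mul _ _ (d * C.card) fun u _ => ?_).trans
        (Nat.mul_le_mul_right _ (card_le_two))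
      exact (card_biUnion_le_card_mul _ _ C.card fun w _ => card_image_le).trans
        (Nat.mul_le_mul_right _ (hd u))
    exact_mod_cast h
  have hb2 : (((univ : Finset (Fin m)).biUnion fun a => (range n).biUnion fun b =>
      (range M).biUnion fun j => (L1 b j a).image fun φ => (φ, a)).card : ℝ) ≤
      m * (n * (t * 2)) := by
    have h : ∀ a, (((range n).biUnion fun b =>
        (range M).biUnion fun j => (L1 b j a).image fun φ => (φ, a)).card : ℝ) ≤ n * (t * 2) := by
      intro a
      refine (Nat.cast_le.2 card_biUnion_le).trans ?_
      rw [Nat.cast_sum]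
      refine (sum_le_card_nsmul _ _ (t * 2) fun b _ => ?_).trans (by simp)
      refine (Nat.cast_le.2 card_biUnion_le).trans ?_
      rw [Nat.cast_sum]
      exact hgeom _ fun j => (Nat.cast_le.2 card_image_le).trans (hL1 b j a)
    refine (Nat.cast_le.2 card_biUnion_le).trans ?_
    rw [Nat.cast_sum]
    exact (sum_le_card_nsmul _ _ _ fun a _ => h a).trans (by simp)
  have hb3 : (((univ : Finset (Fin m)).biUnion fun a => (univ : Finset (Fin m)).biUnion fun a' =>
        (range M).biUnion fun j => (L2 a' j a).image fun φ => (φ, a)).card : ℝ) ≤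
      m * (m * (t * 2)) := by
    have h : ∀ a, (((univ : Finset (Fin m)).biUnion fun a' =>
        (range M).biUnion fun j => (L2 a' j a).image fun φ => (φ, a)).card : ℝ) ≤
          m * (t * 2) := by
      intro a
      refine (Nat.cast_le.2 card_biUnion_le).trans ?_
      rw [Nat.cast_sum]
      refine (sum_le_card_nsmul _ _ (t * 2) fun b _ => ?_).trans (by simp)
      refine (Nat.cast_le.2 card_biUnion_le).trans ?_
      rw [Nat.cast_sum]
      exact hgeom _ fun j => (Nat.cast_le.2 card_image_le).trans (hL2 b j a)
    refine (Nat.cast_le.2 card_biUnion_le).trans ?_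
    rw [Nat.cast_sum]
    exact (sum_le_card_nsmul _ _ _ fun a _ => h a).trans (by simp)
  have htotal : ((P.filter bad).card : ℝ) ≤
      2 * (d * C.card) + m * (n * (t * 2)) + m * (m * (t * 2)) := by
    refine (Nat.cast_le.2 ((card_le_card hbad).trans
      ((card_union_le _ _).trans (Nat.add_le_add_right (card_union_le _ _) _)))).trans ?_
    push_cast
    linarith
  have hfin : 2 * (d * C.card) + m * (n * (t * 2)) + m * (m * (t * 2)) ≤ m / 2 * (C.card : ℝ) := by
    have h1 : 2 * (d * C.card) + m * (n * (t * 2)) + m * (m * (t * 2)) =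
        (2 * d * m + 8 * (n + m) * d) / m * (C.card : ℝ) := by
      rw [ht]
      field_simp
      ring
    rw [h1]
    refine mul_le_mul_of_nonneg_right ?_ (Nat.cast_nonneg _)
    rw [div_le_iff₀ hm']
    have h2 : (20 * (n + m) * d : ℝ) ≤ m ^ 2 := by exact_mod_cast hnm
    have h3 : (0 : ℝ) ≤ n * d := by positivity
    nlinarith
  have := (Nat.cast_le (α := ℝ)).2 hgood
  linarith

theorem grows (hg : 6 ≤ g) (hc : GoodColoring g E₀ c) (hcn : ∀ e ∈ E₀, c e < n)
    (hm : 0 < m) {d : ℕ} (hnm : 20 * (n + m) * d ≤ m ^ 2) (z : Fin m) (S : Finset (Sym2 V))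
    (hE : ∀ e ∈ S, e ∉ E₀) (hd : ∀ x, (univ.filter fun w => s(x, w) ∈ S).card ≤ d) :
    Grows g E₀ c n z (m / 2) S := by
  induction S using Finset.strongInduction with
  | H S ih =>
  intro Q hQ
  rcases Q.eq_empty_or_nonempty with rfl | ⟨e, he⟩
  · simp
  · have hd' : ∀ x, (univ.filter fun w => s(x, w) ∈ S.erase e).card ≤ d := fun x =>
      (card_le_card (monotone_filter_right _ fun w _ => mem_of_mem_erase)).trans (hd x)
    have h1 := ih (S.erase e) (erase_ssubset (hQ he)) (fun f hf => hE f (mem_of_mem_erase hf)) hd'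
    have h2 := card_step hg hc hcn hm hnm (hE e (hQ he)) (notMem_erase e S) hd' h1
    have h3 := h1 (Q.erase e) (erase_subset_erase e hQ)
    rw [insert_erase (hQ he)] at h2
    have h4 : S.erase e \ Q.erase e = S \ Q := by
      ext f
      by_cases hf : f = e
      · simp [hf, he]
      · simp [hf]
    rw [h4] at h3
    rw [← card_erase_add_one he, pow_succ']
    refine le_trans ?_ h2
    rw [mul_assoc]
    exact mul_le_mul_of_nonneg_left h3 (by positivity)

/-- A good colouring extends to a sparse set `F` of further edges using few additional colours. -/
theorem exists_extension (hg : 6 ≤ g) (hc : GoodColoring g E₀ c) (hcn : ∀ e ∈ E₀, c e < n)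
    (hm : 0 < m) {d : ℕ} (hnm : 20 * (n + m) * d ≤ m ^ 2) (F : Finset (Sym2 V))
    (hE : ∀ e ∈ F, e ∉ E₀) (hd : ∀ x, (univ.filter fun w => s(x, w) ∈ F).card ≤ d) :
    ∃ c', GoodColoring g (E₀ ∪ F) c' ∧ ∀ e ∈ E₀ ∪ (F : Set (Sym2 V)), c' e < n + m := by
  have h := grows hg hc hcn hm hnm ⟨0, hm⟩ F hE hd F subset_rfl
  rw [sdiff_self] at h
  have h0 : 0 < (extensions g E₀ c n ⟨0, hm⟩ (⊥ : Finset (Sym2 V))).card := by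
    refine card_pos.2 ⟨fun _ => ⟨0, hm⟩, mem_filter.2 ⟨mem_univ _, fun _ _ => rfl, ?_⟩⟩
    refine hc.mono (by simp) fun e he => combine_of_mem ?_
    simpa using he
  have hm' : (0 : ℝ) < m := Nat.cast_pos.2 hm
  have h1 : (0 : ℝ) < (extensions g E₀ c n ⟨0, hm⟩ F).card := lt_of_lt_of_le (by positivity) h
  obtain ⟨φ, hφ⟩ := card_pos.1 (Nat.cast_pos.1 h1)
  refine ⟨_, (mem_filter.1 hφ).2.2, fun e _ => ?_⟩
  by_cases he' : e ∈ E₀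
  · rw [combine_of_mem he']
    exact Nat.lt_add_right _ (hcn e he')
  · rw [combine_of_notMem he']
    omega

end ColoringExtension

namespace RandomMatching

open Finset
open scoped Classical

variable {V : Type} {R : SimpleGraph V}

theorem exists_isCycle_of_walk {a b : V} (h : R.Adj b a) (q : R.Walk a b) (hq : s(b, a) ∉ q.edges) :
    ∃ w : R.Walk b b, w.IsCycle ∧ w.length ≤ q.length + 1 := by
  refine ⟨Walk.cons h q.bypass, ?_, ?_⟩
  · exact (Walk.cons_isCycle_iff _ _).2
      ⟨q.bypass_isPath, fun h' => hq (q.edges_bypass_subset_edges h')⟩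
  · simpa using q.length_bypass_le_length

/-- Vertices reachable from `u` by a walk of length at most `k` that avoids `p`. -/
def Branch (R : SimpleGraph V) (k : ℕ) (u p : V) : Set V :=
  {x | ∃ q : R.Walk u x, q.length ≤ k ∧ p ∉ q.support}

theorem self_mem_branch {k : ℕ} {u p : V} (h : u ≠ p) : u ∈ Branch R k u p :=
  ⟨Walk.nil, by simp, by simpa using h.symm⟩

theorem notMem_branch {k : ℕ} {u p : V} : p ∉ Branch R k u p := by
  rintro ⟨q, -, hq⟩
  exact hq q.end_mem_support

theorem branch_mono {k l : ℕ} (h : k ≤ l) (u p : V) : Branch R k u p ⊆ Branch R l u p :=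
  fun _ ⟨q, hq, hp⟩ => ⟨q, hq.trans h, hp⟩

theorem mem_branch_of_adj {k : ℕ} {u p x y : V} (hx : x ∈ Branch R k u p) (hxy : R.Adj x y)
    (hy : y ≠ p) : y ∈ Branch R (k + 1) u p := by
  obtain ⟨q, hq, hp⟩ := hx
  refine ⟨q.concat hxy, by simpa using hq, ?_⟩
  rw [Walk.support_concat]
  simpa using ⟨hp, hy.symm⟩

theorem branch_subset {g : ℕ} (hg : ∀ v (w : R.Walk v v), w.IsCycle → g ≤ w.length)
    {k : ℕ} (hk : k + 3 ≤ g) {u p c : V} (hup : R.Adj u p) (huc : R.Adj u c)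
    (hcp : c ≠ p) : Branch R k c u ⊆ Branch R (k + 1) u p := by
  rintro x ⟨q, hq, hu⟩
  refine ⟨Walk.cons huc q, by simpa using hq, ?_⟩
  intro hp
  have hp : p ∈ q.support := by simpa [hup.ne'] using hp
  obtain ⟨w, hw, hl⟩ := exists_isCycle_of_walk huc ((q.takeUntil p hp).concat hup.symm) (by
    rw [Walk.edges_concat, List.concat_eq_append]
    intro h
    rcases List.mem_append.1 h with h | h
    · exact hu (q.support_takeUntil_subset_support hp (Walk.fst_mem_support_of_mem_edges _ h))
    · exact hcp (by simpa [huc.ne, hup.ne', eq_comm] using h))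
  have := hg _ w hw
  have := q.length_takeUntil_le_length hp
  rw [Walk.length_concat] at hl
  omega

theorem disjoint_branch {g : ℕ} (hg : ∀ v (w : R.Walk v v), w.IsCycle → g ≤ w.length)
    {k : ℕ} (hk : 2 * k + 3 ≤ g) {u c c' : V} (huc : R.Adj u c)
    (huc' : R.Adj u c') (hcc : c ≠ c') : Disjoint (Branch R k c u) (Branch R k c' u) := by
  rw [Set.disjoint_left]
  rintro x ⟨q, hq, hu⟩ ⟨q', hq', hu'⟩
  obtain ⟨w, hw, hl⟩ := exists_isCycle_of_walk huc ((q.append q'.reverse).concat huc'.symm) (by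
    rw [Walk.edges_concat, List.concat_eq_append, Walk.edges_append, Walk.edges_reverse]
    intro h
    rcases List.mem_append.1 h with h | h
    · rcases List.mem_append.1 h with h | h
      · exact hu (Walk.fst_mem_support_of_mem_edges _ h)
      · exact hu' (Walk.fst_mem_support_of_mem_edges _ (List.mem_reverse.1 h))
    · exact hcc (by simpa [huc.ne, huc'.ne', eq_comm] using h))
  have := hg _ w hw
  rw [Walk.length_concat, Walk.length_append, Walk.length_reverse] at hl
  omega

theorem disjoint_branch_of_adj {g : ℕ} (hg : ∀ v (w : R.Walk v v), w.IsCycle → g ≤ w.length)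
    {k : ℕ} (hk : 2 * k + 2 ≤ g) {v w : V} (hvw : R.Adj v w) :
    Disjoint (Branch R k v w) (Branch R k w v) := by
  rw [Set.disjoint_left]
  rintro x ⟨q, hq, hu⟩ ⟨q', hq', hu'⟩
  obtain ⟨c, hc, hl⟩ := exists_isCycle_of_walk hvw.symm (q.append q'.reverse) (by
    rw [Walk.edges_append, Walk.edges_reverse]
    intro h
    rcases List.mem_append.1 h with h | h
    · exact hu (Walk.fst_mem_support_of_mem_edges _ h)
    · exact hu' (Walk.snd_mem_support_of_mem_edges _ (List.mem_reverse.1 h)))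
  have := hg _ c hc
  rw [Walk.length_append, Walk.length_reverse] at hl
  omega

end RandomMatching

namespace RandomMatching

open Finset
open scoped Classical

variable {V : Type} {R : SimpleGraph V}

/-- In the greedy matching process in which the edge `e` arrives at time `τ e` and the vertex `u`
retires at time `σ u`, the vertex `u` is unmatched just before time `j` when the edge to `p` is
ignored. Vertices at which two edges arrive simultaneously are treated as matched. -/
def Alive (R : SimpleGraph V) (σ : V → ℕ) (τ : Sym2 V → ℕ) (j : ℕ) (u p : V) : Prop :=
  j < σ u ∧ ∀ c, R.Adj u c → c ≠ p → τ s(u, c) ≠ j ∧ ∀ _ : τ s(u, c) < j,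
    ¬ Alive R σ τ (τ s(u, c)) c u
termination_by j

theorem alive_iff {σ : V → ℕ} {τ : Sym2 V → ℕ} {j : ℕ} {u p : V} : Alive R σ τ j u p ↔
    j < σ u ∧ ∀ c, R.Adj u c → c ≠ p → τ s(u, c) ≠ j ∧ (τ s(u, c) < j →
      ¬ Alive R σ τ (τ s(u, c)) c u) := by
  rw [Alive]

/-- The edge `vw` is selected by the greedy process run up to time `T`. -/
def Matched (R : SimpleGraph V) (T : ℕ) (σ : V → ℕ) (τ : Sym2 V → ℕ) (v w : V) : Prop :=
  R.Adj v w ∧ τ s(v, w) < T ∧ Alive R σ τ (τ s(v, w)) v w ∧ Alive R σ τ (τ s(v, w)) w v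

/-- The partner of `v` in the greedy matching, or `v` itself if `v` is unmatched. -/
noncomputable def mate (R : SimpleGraph V) (T : ℕ) (σ : V → ℕ) (τ : Sym2 V → ℕ) (v : V) : V :=
  if h : ∃ w, Matched R T σ τ v w then h.choose else v

variable {T : ℕ} {σ σ' : V → ℕ} {τ τ' : Sym2 V → ℕ}

theorem Matched.symm {v w : V} (h : Matched R T σ τ v w) : Matched R T σ τ w v := by
  rw [Matched, Sym2.eq_swap]
  exact ⟨h.1.symm, h.2.1, h.2.2.2, h.2.2.1⟩

theorem Matched.unique {v w w' : V} (h : Matched R T σ τ v w) (h' : Matched R T σ τ v w') :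
    w = w' := by
  by_contra hne
  have key : ∀ w w', w ≠ w' → Matched R T σ τ v w → Matched R T σ τ v w' →
      τ s(v, w) ≤ τ s(v, w') → False := by
    intro w w' hne h h' hle
    have h1 := (alive_iff.1 h'.2.2.1).2 w h.1 hne
    exact h1.2 (lt_of_le_of_ne hle h1.1) h.2.2.2
  rcases le_total (τ s(v, w)) (τ s(v, w')) with hle | hle
  · exact key w w' hne h h' hle
  · exact key w' w (Ne.symm hne) h' h hle

theorem Matched.mate_eq {v w : V} (h : Matched R T σ τ v w) : mate R T σ τ v = w := by
  have h' : ∃ w, Matched R T σ τ v w := ⟨w, h⟩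
  rw [mate, dif_pos h']
  exact h'.choose_spec.unique h

theorem matched_mate {v : V} (h : mate R T σ τ v ≠ v) : Matched R T σ τ v (mate R T σ τ v) := by
  by_cases h' : ∃ w, Matched R T σ τ v w
  · obtain ⟨w, hw⟩ := h'
    rwa [hw.mate_eq]
  · exact absurd (dif_neg h') h

theorem mate_eq_iff {v w : V} (hvw : v ≠ w) : mate R T σ τ v = w ↔ Matched R T σ τ v w := by
  refine ⟨fun h => ?_, Matched.mate_eq⟩
  have := matched_mate (R := R) (T := T) (σ := σ) (τ := τ) (v := v) (by rw [h]; exact hvw.symm)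
  rwa [h] at this

theorem mate_involutive : Function.Involutive (mate R T σ τ) := by
  intro v
  by_cases h : mate R T σ τ v = v
  · rw [h, h]
  · exact (matched_mate h).symm.mate_eq

theorem mate_adj {v : V} (h : mate R T σ τ v ≠ v) : R.Adj v (mate R T σ τ v) :=
  (matched_mate h).1

theorem mate_congr {v : V} (h : ∀ w, R.Adj v w → (Matched R T σ τ v w ↔ Matched R T σ' τ' v w)) :
    mate R T σ τ v = mate R T σ' τ' v := by
  by_cases h' : ∃ w, Matched R T σ τ v w
  · obtain ⟨w, hw⟩ := h'
    rw [hw.mate_eq, ((h w hw.1).1 hw).mate_eq]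
  · have hnot : ¬ ∃ w, Matched R T σ' τ' v w := fun ⟨w, hw⟩ => h' ⟨w, (h w hw.1).2 hw⟩
    rw [mate, mate, dif_neg h', dif_neg hnot]

/-- If the regions `B j u p` contain everything visible in the recursion defining `Alive j u p`,
then `Alive` only depends on the seeds in these regions. -/
theorem alive_congr {B : ℕ → V → V → Set V} (hu : ∀ j u p, R.Adj u p → u ∈ B j u p)
    (hc : ∀ j u p c, R.Adj u p → R.Adj u c → c ≠ p → c ∈ B j u p) {J : ℕ}
    (hB : ∀ i j u p c, i < j → j < J → R.Adj u p → R.Adj u c → c ≠ p → B i c u ⊆ B j u p)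
    {j : ℕ} (hj : j < J) {u p : V} (hup : R.Adj u p) (hσ : ∀ x ∈ B j u p, σ x = σ' x)
    (hτ : ∀ x ∈ B j u p, ∀ y ∈ B j u p, τ s(x, y) = τ' s(x, y)) :
    Alive R σ τ j u p ↔ Alive R σ' τ' j u p := by
  induction j using Nat.strong_induction_on generalizing u p with
  | _ j ih =>
  rw [alive_iff, alive_iff, hσ u (hu j u p hup)]
  refine and_congr_right fun _ => forall_congr' fun c => imp_congr_right fun huc =>
    imp_congr_right fun hcp => ?_
  rw [← hτ u (hu j u p hup) c (hc j u p c hup huc hcp)]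
  refine and_congr_right fun _ => imp_congr_right fun hlt => not_congr ?_
  have hsub := hB _ _ u p c hlt hj hup huc hcp
  exact ih _ hlt (hlt.trans hj) huc.symm (fun x hx => hσ x (hsub hx))
    fun x hx y hy => hτ x (hsub hx) y (hsub hy)

theorem alive_congr_branch {g : ℕ} (hg : ∀ v (w : R.Walk v v), w.IsCycle → g ≤ w.length) {j : ℕ}
    (hj : j + 4 ≤ g) {u p : V} (hup : R.Adj u p) (hσ : ∀ x ∈ Branch R (j + 1) u p, σ x = σ' x)
    (hτ : ∀ x ∈ Branch R (j + 1) u p, ∀ y ∈ Branch R (j + 1) u p, τ s(x, y) = τ' s(x, y)) :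
    Alive R σ τ j u p ↔ Alive R σ' τ' j u p := by
  refine alive_congr (B := fun j => Branch R (j + 1)) (J := j + 1)
    (fun j u p h => self_mem_branch h.ne)
    (fun j u p c h hc hcp => branch_mono (by omega) _ _
      (mem_branch_of_adj (k := 0) (self_mem_branch h.ne) hc hcp))
    (fun i k u p c hik hkj h hc hcp => ?_) (Nat.lt_succ_self j) hup hσ hτ
  exact (branch_subset hg (by omega) h hc hcp).trans (branch_mono (by omega) _ _)

theorem alive_diff {u : V} (hσ : ∀ x y, x ≠ u → y ≠ u → τ s(x, y) = τ' s(x, y))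
    (hτ' : ∀ y, R.Adj u y → T ≤ τ' s(u, y)) {j : ℕ} (hj : j < T) {x y : V} (hx : x ≠ u)
    (h : ¬ (Alive R σ τ j x y ↔ Alive R σ τ' j x y)) :
    ∃ w, R.Adj u w ∧ τ s(u, w) < T ∧ x ∈ Branch R j w u := by
  induction j using Nat.strong_induction_on generalizing x y with
  | _ j ih =>
  by_contra hcon
  refine h ?_
  rw [alive_iff, alive_iff]
  refine and_congr_right fun _ => forall_congr' fun c => imp_congr_right fun hxc =>
    imp_congr_right fun hcy => ?_
  by_cases hc : c = u
  · subst hc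
    have h1 := hτ' x hxc.symm
    have h2 : T ≤ τ s(c, x) := by
      by_contra hlt
      exact hcon ⟨x, hxc.symm, not_le.1 hlt, self_mem_branch hx⟩
    rw [Sym2.eq_swap] at h1 h2
    exact iff_of_true ⟨by omega, by omega⟩ ⟨by omega, by omega⟩
  · rw [← hσ x c hx hc]
    refine and_congr_right fun _ => imp_congr_right fun hlt => not_congr ?_
    by_contra hne
    obtain ⟨w, hw, hwT, hcw⟩ := ih _ hlt (hlt.trans hj) hc hne
    exact hcon ⟨w, hw, hwT, branch_mono hlt _ _ (mem_branch_of_adj hcw hxc.symm hx)⟩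

theorem mate_diff {u : V} (hσ : ∀ x y, x ≠ u → y ≠ u → τ s(x, y) = τ' s(x, y))
    (hτ' : ∀ y, R.Adj u y → T ≤ τ' s(u, y)) {x : V} (hx : x ≠ u)
    (h : mate R T σ τ x ≠ mate R T σ τ' x) :
    ∃ w, R.Adj u w ∧ τ s(u, w) < T ∧ x ∈ Branch R T w u := by
  by_contra hcon
  refine h (mate_congr fun y hxy => ?_)
  rw [Matched, Matched]
  refine and_congr_right fun _ => ?_
  by_cases hy : y = u
  · subst hy
    refine iff_of_false (fun h => hcon ⟨x, hxy.symm, ?_, self_mem_branch hx⟩) fun h => ?_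
    · rw [Sym2.eq_swap]
      exact h.1
    · have := hτ' x hxy.symm
      rw [Sym2.eq_swap] at this
      exact absurd h.1 (not_lt.2 this)
  · rw [← hσ x y hx hy]
    refine and_congr_right fun hlt => and_congr ?_ ?_
    · by_contra hne
      obtain ⟨w, hw, hwT, hcw⟩ := alive_diff hσ hτ' hlt hx hne
      exact hcon ⟨w, hw, hwT, branch_mono hlt.le _ _ hcw⟩
    · by_contra hne
      obtain ⟨w, hw, hwT, hcw⟩ := alive_diff hσ hτ' hlt hy hne
      exact hcon ⟨w, hw, hwT, branch_mono hlt _ _ (mem_branch_of_adj hcw hxy.symm hx)⟩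

theorem mate_eq_self_of_le {u : V} (hτ : ∀ y, R.Adj u y → T ≤ τ s(u, y)) :
    mate R T σ τ u = u := by
  by_contra h
  have := matched_mate h
  exact absurd this.2.1 (not_lt.2 (hτ _ this.1))

end RandomMatching

namespace RandomMatching

open Finset ProductWeight
open scoped Classical

/-- The random seeds: a retirement time and a coin for every vertex, an arrival time for every
pair of vertices. -/
abbrev Seed (V : Type) : Type := V ⊕ V ⊕ Sym2 V

variable {V : Type} {N : ℕ}

def retire (ω : Seed V → Fin N) (v : V) : ℕ := ω (.inl v)

def Asleep (ω : Seed V → Fin N) (v : V) : Prop := (ω (.inr (.inl v)) : ℕ) = 0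

def arrive (ω : Seed V → Fin N) (e : Sym2 V) : ℕ := ω (.inr (.inr e))

/-- The matching-related seeds inside a set of vertices. -/
def seeds (B : Set V) : Set (Seed V) :=
  {x | (∃ v ∈ B, x = .inl v) ∨ ∃ v ∈ B, ∃ w ∈ B, x = .inr (.inr s(v, w))}

theorem seeds_mono {B B' : Set V} (h : B ⊆ B') : seeds B ⊆ seeds B' := by
  rintro x (⟨v, hv, rfl⟩ | ⟨v, hv, w, hw, rfl⟩)
  · exact Or.inl ⟨v, h hv, rfl⟩
  · exact Or.inr ⟨v, h hv, w, h hw, rfl⟩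

theorem inl_mem_seeds {B : Set V} {v : V} : (.inl v : Seed V) ∈ seeds B ↔ v ∈ B := by
  simp [seeds]

theorem inr_mem_seeds {B : Set V} {v w : V} :
    (.inr (.inr s(v, w)) : Seed V) ∈ seeds B ↔ v ∈ B ∧ w ∈ B := by
  constructor
  · rintro (⟨x, hx, h⟩ | ⟨x, hx, y, hy, h⟩)
    · simp at h
    · have h : s(v, w) = s(x, y) := by simpa using h
      rcases Sym2.eq_iff.1 h with ⟨rfl, rfl⟩ | ⟨rfl, rfl⟩
      · exact ⟨hx, hy⟩
      · exact ⟨hy, hx⟩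
  · exact fun h => Or.inr ⟨v, h.1, w, h.2, rfl⟩

theorem disjoint_seeds {B B' : Set V} (h : Disjoint B B') : Disjoint (seeds B) (seeds B') := by
  rw [Set.disjoint_left] at h ⊢
  rintro x (⟨v, hv, rfl⟩ | ⟨v, hv, w, hw, rfl⟩) h'
  · exact h hv (inl_mem_seeds.1 h')
  · exact h hv (inr_mem_seeds.1 h').1

variable {R : SimpleGraph V} {g : ℕ}

theorem dependsOn_alive (hg : ∀ v (w : R.Walk v v), w.IsCycle → g ≤ w.length) {j k : ℕ}
    (hjk : j < k) (hj : j + 4 ≤ g) {u p : V} (hup : R.Adj u p) :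
    DependsOn (fun ω : Seed V → Fin N => Alive R (retire ω) (arrive ω) j u p)
      (seeds (Branch R k u p)) := by
  intro ω ω' h
  have hsub := branch_mono (R := R) (show j + 1 ≤ k from hjk) u p
  refine propext (alive_congr_branch hg hj hup (fun x hx => ?_) fun x hx y hy => ?_)
  · exact congrArg Fin.val (h _ (inl_mem_seeds.2 (hsub hx)))
  · exact congrArg Fin.val (h _ (inr_mem_seeds.2 ⟨hsub hx, hsub hy⟩))

/-- The conditional death probability of a neighbour-free vertex after `j` steps. -/
noncomputable def hazard (N D : ℕ) : ℕ → ℝ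
  | 0 => 1 / N
  | j + 1 => hazard N D j + (1 - hazard N D j) ^ (D - 1) / N

theorem hazard_eq_sum (N D j : ℕ) :
    hazard N D j = 1 / N + ∑ i ∈ range j, (1 - hazard N D i) ^ (D - 1) / N := by
  induction j with
  | zero => simp [hazard]
  | succ j ih =>
    rw [hazard, sum_range_succ]
    nth_rewrite 1 [ih]
    ring

theorem hazard_bounds {N D j : ℕ} (hj : j < N) :
    1 / (N : ℝ) ≤ hazard N D j ∧ hazard N D j ≤ (j + 1) / N := by
  have hN : (0 : ℝ) < N := by exact_mod_cast (by omega : 0 < N)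
  induction j with
  | zero => simp [hazard]
  | succ j ih =>
    obtain ⟨h1, h2⟩ := ih (by omega)
    have h3 : hazard N D j ≤ 1 := by
      refine h2.trans ((div_le_one hN).2 ?_)
      exact_mod_cast (by omega : j + 1 ≤ N)
    have h4 : (1 - hazard N D j) ^ (D - 1) ≤ 1 :=
      pow_le_one₀ (by linarith) (by linarith [(by positivity : (0 : ℝ) ≤ 1 / N)])
    have h5 : 0 ≤ (1 - hazard N D j) ^ (D - 1) := pow_nonneg (by linarith) _
    rw [hazard]
    constructor
    · linarith [div_nonneg h5 hN.le]
    · push_cast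
      rw [add_div _ 1]
      exact add_le_add h2 ((div_le_div_iff_of_pos_right hN).2 h4)

variable [Fintype V]

/-- The law of the seeds: uniform arrival times, coins falling asleep with probability `p`, and
retirement times making all vertices look as if they had degree `D`. -/
structure IsLaw (R : SimpleGraph V) (D T : ℕ) (p : ℝ) (μ : Seed V → Fin N → ℝ) : Prop
    extends IsProb μ where
  arrive_eq : ∀ e, ∀ i < N, Pr μ (fun ω => arrive ω e = i) = 1 / N
  retire_gt : ∀ u, ∀ j < T, Pr μ (fun ω => j < retire ω u) =
    (1 - hazard N D j) ^ (D - (univ.filter fun w => R.Adj u w).card)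
  asleep : ∀ v, Pr μ (fun ω => Asleep ω v) = p

variable {D T : ℕ} {p : ℝ} {μ : Seed V → Fin N → ℝ}

theorem IsLaw.pr_alive (hμ : IsLaw R D T p μ)
    (hg : ∀ v (w : R.Walk v v), w.IsCycle → g ≤ w.length) (hT : 2 * T + 10 ≤ g) (hTN : T < N)
    (hD : ∀ u, (univ.filter fun w => R.Adj u w).card ≤ D) {j : ℕ} (hj : j < T) {u q : V}
    (huq : R.Adj u q) :
    Pr μ (fun ω => Alive R (retire ω) (arrive ω) j u q) = (1 - hazard N D j) ^ (D - 1) := by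
  induction j using Nat.strong_induction_on generalizing u q with
  | _ j ih =>
  set C := (univ.filter fun w => R.Adj u w).erase q with hC
  have hCcard : C.card + 1 = (univ.filter fun w => R.Adj u w).card :=
    card_erase_add_one (by simpa using huq)
  let A : V → (Seed V → Fin N) → Prop := fun c ω => arrive ω s(u, c) ≠ j ∧
    (arrive ω s(u, c) < j → ¬ Alive R (retire ω) (arrive ω) (arrive ω s(u, c)) c u)
  have hAdj : ∀ c ∈ C, R.Adj u c := fun c hc => (mem_filter.1 (mem_of_mem_erase hc)).2
  have hA : ∀ c ∈ C, DependsOn (A c) (insert (.inr (.inr s(u, c))) (seeds (Branch R j c u))) := by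
    intro c hc ω ω' h
    have h1 : arrive ω s(u, c) = arrive ω' s(u, c) :=
      congrArg Fin.val (h _ (Set.mem_insert _ _))
    simp only [A, ← h1]
    refine propext (and_congr_right fun _ => imp_congr_right fun hlt => not_congr ?_)
    exact iff_of_eq (dependsOn_alive hg hlt (by omega) (hAdj c hc).symm
      fun x hx => h x (Set.mem_insert_of_mem _ hx))
  have hdisj : ∀ c ∈ C, ∀ c' ∈ C, c ≠ c' →
      Disjoint (insert (.inr (.inr s(u, c))) (seeds (Branch R j c u)))
        (insert (.inr (.inr s(u, c'))) (seeds (Branch R j c' u))) := by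
    intro c hc c' hc' hne
    have hu : u ≠ c' := (hAdj c' hc').ne
    rw [Set.disjoint_insert_left, Set.disjoint_insert_right]
    refine ⟨?_, ?_, disjoint_seeds (disjoint_branch hg (by omega) (hAdj c hc) (hAdj c' hc') hne)⟩
    · rintro (h | h)
      · have h : s(u, c) = s(u, c') := by simpa using h
        exact hne (Sym2.congr_right.1 h)
      · exact notMem_branch (inr_mem_seeds.1 h).1
    · exact fun h => notMem_branch (inr_mem_seeds.1 h).1
  have hPA : ∀ c ∈ C, Pr μ (A c) = 1 - hazard N D j := by
    intro c hc
    have hnot : Pr μ (fun ω => ¬ A c ω) = hazard N D j := by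
      rw [Pr_exists_eq_sum (range (j + 1)) (B := fun i ω => arrive ω s(u, c) = i ∧
        (i < j → Alive R (retire ω) (arrive ω) i c u)), sum_range_succ, hazard_eq_sum]
      · rw [add_comm]
        congr 1
        · simpa using hμ.arrive_eq s(u, c) j (by omega)
        · refine sum_congr rfl fun i hi => ?_
          have hi : i < j := mem_range.1 hi
          have h1 : (fun ω : Seed V → Fin N => arrive ω s(u, c) = i ∧
              (i < j → Alive R (retire ω) (arrive ω) i c u)) =
              fun ω => arrive ω s(u, c) = i ∧ Alive R (retire ω) (arrive ω) i c u :=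
            funext fun ω => by simp [hi]
          rw [h1, Pr_and_of_dependsOn hμ.toIsProb (s := {.inr (.inr s(u, c))})
            (t := seeds (Branch R j c u)), hμ.arrive_eq _ _ (by omega),
            ih i hi (hi.trans hj) (hAdj c hc).symm]
          · ring
          · intro ω ω' h
            have : arrive ω s(u, c) = arrive ω' s(u, c) := congrArg Fin.val (h _ rfl)
            simp only [this]
          · exact dependsOn_alive hg hi (by omega) (hAdj c hc).symm
          · rw [Set.disjoint_singleton_left]
            exact fun h => notMem_branch (inr_mem_seeds.1 h).1
      · intro ω
        simp only [A, mem_range]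
        constructor
        · intro h
          by_cases h1 : arrive ω s(u, c) = j
          · exact ⟨j, by omega, h1, fun h => absurd h (lt_irrefl _)⟩
          · have h2 : arrive ω s(u, c) < j ∧
                Alive R (retire ω) (arrive ω) (arrive ω s(u, c)) c u := by
              by_contra hcon
              exact h ⟨h1, fun h3 h4 => hcon ⟨h3, h4⟩⟩
            exact ⟨_, by omega, rfl, fun _ => h2.2⟩
        · rintro ⟨i, hi, rfl, h⟩ ⟨h1, h2⟩
          exact h2 (by omega) (h (by omega))
      · rintro ω k k' - - ⟨h, -⟩ ⟨h', -⟩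
        exact h.symm.trans h'
    have := Pr_not hμ.toIsProb (A c)
    linarith
  have hall : Pr μ (fun ω => ∀ c ∈ C, A c ω) = (1 - hazard N D j) ^ C.card := by
    rw [Pr_forall_of_dependsOn hμ.toIsProb C hA hdisj, prod_congr rfl hPA, prod_const]
  have heq : (fun ω : Seed V → Fin N => Alive R (retire ω) (arrive ω) j u q) =
      fun ω => (j < retire ω u) ∧ ∀ c ∈ C, A c ω := by
    refine funext fun ω => propext ?_
    rw [alive_iff]
    refine and_congr_right fun _ => forall_congr' fun c => ?_
    simp only [hC, mem_erase, mem_filter, mem_univ, true_and, and_imp, A]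
    exact ⟨fun h h1 h2 => h h2 h1, fun h h1 h2 => h h2 h1⟩
  rw [heq, Pr_and_of_dependsOn hμ.toIsProb (s := {.inl u}) (t := {x | x ≠ .inl u}), hall,
    hμ.retire_gt u j hj, ← pow_add]
  · congr 1
    have := hD u
    omega
  · intro ω ω' h
    have : retire ω u = retire ω' u := congrArg Fin.val (h _ rfl)
    simp only [this]
  · intro ω ω' h
    refine propext (forall_congr' fun c => imp_congr_right fun hc => iff_of_eq (hA c hc ?_))
    intro x hx
    refine h x ?_
    rintro rfl
    rcases hx with hx | hx
    · simp at hx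
    · exact notMem_branch (inl_mem_seeds.1 hx)
  · simp

theorem IsLaw.pr_matched (hμ : IsLaw R D T p μ)
    (hg : ∀ v (w : R.Walk v v), w.IsCycle → g ≤ w.length) (hT : 2 * T + 10 ≤ g) (hTN : T < N)
    (hD : ∀ u, (univ.filter fun w => R.Adj u w).card ≤ D) {v w : V} (hvw : R.Adj v w) :
    Pr μ (fun ω => Matched R T (retire ω) (arrive ω) v w) =
      ∑ i ∈ range T, ((1 - hazard N D i) ^ (D - 1)) ^ 2 / N := by
  rw [Pr_exists_eq_sum (range T) (B := fun i ω => arrive ω s(v, w) = i ∧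
    Alive R (retire ω) (arrive ω) i v w ∧ Alive R (retire ω) (arrive ω) i w v)]
  · refine sum_congr rfl fun i hi => ?_
    have hi : i < T := mem_range.1 hi
    rw [Pr_and_of_dependsOn hμ.toIsProb (s := {.inr (.inr s(v, w))})
        (t := seeds (Branch R T v w) ∪ seeds (Branch R T w v)),
      Pr_and_of_dependsOn hμ.toIsProb (dependsOn_alive hg hi (by omega) hvw)
        (dependsOn_alive hg hi (by omega) hvw.symm)
        (disjoint_seeds (disjoint_branch_of_adj hg (by omega) hvw)),
      hμ.arrive_eq _ _ (by omega), hμ.pr_alive hg hT hTN hD hi hvw,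
      hμ.pr_alive hg hT hTN hD hi hvw.symm]
    · ring
    · intro ω ω' h
      have : arrive ω s(v, w) = arrive ω' s(v, w) := congrArg Fin.val (h _ rfl)
      simp only [this]
    · intro ω ω' h
      exact propext (and_congr
        (iff_of_eq (dependsOn_alive hg hi (by omega) hvw fun x hx => h x (Or.inl hx)))
        (iff_of_eq (dependsOn_alive hg hi (by omega) hvw.symm fun x hx => h x (Or.inr hx))))
    · rw [Set.disjoint_singleton_left]
      rintro (h | h)
      · exact notMem_branch (inr_mem_seeds.1 h).2
      · exact notMem_branch (inr_mem_seeds.1 h).1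
  · intro ω
    constructor
    · exact fun h => ⟨_, mem_range.2 h.2.1, rfl, h.2.2⟩
    · rintro ⟨i, hi, rfl, h⟩
      exact ⟨hvw, mem_range.1 hi, h⟩
  · rintro ω k k' - - ⟨h, -⟩ ⟨h', -⟩
    exact h.symm.trans h'

theorem IsLaw.pr_mate_ne (hμ : IsLaw R D T p μ)
    (hg : ∀ v (w : R.Walk v v), w.IsCycle → g ≤ w.length) (hT : 2 * T + 10 ≤ g) (hTN : T < N)
    (hD : ∀ u, (univ.filter fun w => R.Adj u w).card ≤ D) (v : V) :
    Pr μ (fun ω => mate R T (retire ω) (arrive ω) v ≠ v) =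
      (univ.filter fun w => R.Adj v w).card *
        ∑ i ∈ range T, ((1 - hazard N D i) ^ (D - 1)) ^ 2 / N := by
  rw [Pr_exists_eq_sum (univ.filter fun w => R.Adj v w)
    (B := fun w ω => Matched R T (retire ω) (arrive ω) v w)]
  · rw [sum_congr rfl fun w hw => hμ.pr_matched hg hT hTN hD (mem_filter.1 hw).2, sum_const,
      nsmul_eq_mul]
  · intro ω
    constructor
    · intro h
      have := matched_mate h
      exact ⟨_, mem_filter.2 ⟨mem_univ _, this.1⟩, this⟩
    · rintro ⟨w, -, h⟩
      rw [h.mate_eq]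
      exact h.1.ne'
  · exact fun ω w w' _ _ h h' => h.unique h'

end RandomMatching

namespace RandomMatching

open Finset ProductWeight
open scoped Classical

theorem mul_pow_sub_pow_le {a b : ℝ} (hb : 0 ≤ b) (hab : b ≤ a) (m : ℕ) :
    a * (a ^ m - b ^ m) ≤ m * a ^ m * (a - b) := by
  induction m with
  | zero => simp
  | succ m ih =>
    have ha := hb.trans hab
    have h1 := mul_le_mul_of_nonneg_left ih ha
    have h2 : b ^ m ≤ a ^ m := pow_le_pow_left₀ hb hab m
    have h3 : a * b ^ m * (a - b) ≤ a * a ^ m * (a - b) :=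
      mul_le_mul_of_nonneg_right (mul_le_mul_of_nonneg_left h2 ha) (sub_nonneg.2 hab)
    push_cast
    calc a * (a ^ (m + 1) - b ^ (m + 1)) = a * (a * (a ^ m - b ^ m)) + a * b ^ m * (a - b) := by
          ring
      _ ≤ a * (m * a ^ m * (a - b)) + a * a ^ m * (a - b) := add_le_add h1 h3
      _ = _ := by ring

theorem hazard_le_succ {N D j : ℕ} (hj : j < N) : hazard N D j ≤ hazard N D (j + 1) := by
  have hN : (0 : ℝ) < N := by exact_mod_cast (by omega : 0 < N)
  have h : hazard N D j ≤ 1 := (hazard_bounds hj).2.trans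
    ((div_le_one hN).2 (by exact_mod_cast (by omega : j + 1 ≤ N)))
  rw [hazard]
  linarith [div_nonneg (pow_nonneg (sub_nonneg.2 h) (D - 1)) hN.le]

theorem hazard_mono {N D i j : ℕ} (hij : i ≤ j) (hj : j < N) : hazard N D i ≤ hazard N D j := by
  induction j, hij using Nat.le_induction with
  | base => exact le_rfl
  | succ j _ ih => exact (ih (by omega)).trans (hazard_le_succ (by omega))

theorem one_sub_hazard_nonneg {N D j : ℕ} (hj : j < N) : 0 ≤ 1 - hazard N D j := by
  have hN : (0 : ℝ) < N := by exact_mod_cast (by omega : 0 < N)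
  exact sub_nonneg.2 ((hazard_bounds hj).2.trans
    ((div_le_one hN).2 (by exact_mod_cast (by omega : j + 1 ≤ N))))

theorem sum_sq_ge {N D T : ℕ} (hTN : T < N) :
    (1 - hazard N D T) * ((1 - hazard N D 0) ^ (D - 1) - (1 - hazard N D T) ^ (D - 1)) ≤
      D * ∑ i ∈ range T, ((1 - hazard N D i) ^ (D - 1)) ^ 2 / N := by
  have hN : (0 : ℝ) < N := by exact_mod_cast (by omega : 0 < N)
  rw [← sum_range_sub' (fun i => (1 - hazard N D i) ^ (D - 1)), mul_sum, mul_sum]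
  refine sum_le_sum fun i hi => ?_
  have hi : i < T := mem_range.1 hi
  have h0 := one_sub_hazard_nonneg (D := D) (show i + 1 < N by omega)
  have h1 := hazard_le_succ (D := D) (show i < N by omega)
  have h2 := hazard_mono (D := D) hi.le hTN
  have h3 := one_sub_hazard_nonneg (D := D) (show i < N by omega)
  have hdiff : (1 - hazard N D i) - (1 - hazard N D (i + 1)) =
      (1 - hazard N D i) ^ (D - 1) / N := by
    rw [hazard]; ring
  have h4 := mul_pow_sub_pow_le h0 (by linarith : 1 - hazard N D (i + 1) ≤ 1 - hazard N D i) (D - 1)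
  have h5 : (1 - hazard N D (i + 1)) ^ (D - 1) ≤ (1 - hazard N D i) ^ (D - 1) :=
    pow_le_pow_left₀ h0 (by linarith) _
  have h6 : ((D - 1 : ℕ) : ℝ) ≤ D := by exact_mod_cast Nat.sub_le D 1
  rw [hdiff] at h4
  calc _ ≤ (1 - hazard N D i) * ((1 - hazard N D i) ^ (D - 1) - (1 - hazard N D (i + 1)) ^ (D - 1)) :=
        mul_le_mul_of_nonneg_right (by linarith) (by linarith)
    _ ≤ _ := h4
    _ = (D - 1 : ℕ) * (((1 - hazard N D i) ^ (D - 1)) ^ 2 / N) := by ring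
    _ ≤ _ := mul_le_mul_of_nonneg_right h6 (by positivity)

theorem pow_hazard_le {D n K : ℕ} {η : ℝ} (hη0 : 0 < η) (hD : 2 ≤ D) (hn : 0 < n)
    (hK : 2 / η ^ 2 ≤ K) (hKD : K < D) :
    (1 - hazard (n * D) D (K * n)) ^ (D - 1) ≤ η := by
  set z := hazard (n * D) D (K * n) with hz
  have hTN : K * n < n * D := by rw [mul_comm n]; exact Nat.mul_lt_mul_of_pos_right hKD hn
  have hz1 := one_sub_hazard_nonneg (D := D) hTN
  by_contra hlt
  push Not at hlt
  have hDpos : (0 : ℝ) < D := by exact_mod_cast (by omega : 0 < D)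
  have hnpos : (0 : ℝ) < n := by exact_mod_cast hn
  have h1 : K * η / D ≤ z := by
    rw [hz, hazard_eq_sum]
    have h2 : ∑ i ∈ range (K * n), η / (n * D : ℕ) ≤
        ∑ i ∈ range (K * n), (1 - hazard (n * D) D i) ^ (D - 1) / (n * D : ℕ) := by
      refine sum_le_sum fun i hi => ?_
      have hi : i < K * n := mem_range.1 hi
      refine div_le_div_of_nonneg_right (hlt.le.trans ?_) (Nat.cast_nonneg _)
      exact pow_le_pow_left₀ hz1 (by linarith [hazard_mono (D := D) hi.le hTN]) _
    rw [sum_const, card_range, nsmul_eq_mul] at h2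
    have h3 : ((K * n : ℕ) : ℝ) * (η / (n * D : ℕ)) = K * η / D := by
      push_cast
      field_simp
    have h4 : (0 : ℝ) ≤ 1 / (n * D : ℕ) := by positivity
    linarith
  have h5 : (1 - z) ^ (D - 1) ≤ Real.exp (-(1 / η)) := by
    calc (1 - z) ^ (D - 1) ≤ (Real.exp (-z)) ^ (D - 1) :=
          pow_le_pow_left₀ hz1 (by linarith [Real.add_one_le_exp (-z)]) _
      _ = Real.exp (-(z * (D - 1 : ℕ))) := by rw [← Real.exp_nat_mul]; congr 1; ring
      _ ≤ _ := by
        refine Real.exp_le_exp.2 (neg_le_neg ?_)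
        have h6 : (D : ℝ) / 2 ≤ (D - 1 : ℕ) := by
          have : D ≤ 2 * (D - 1) := by omega
          have : (D : ℝ) ≤ 2 * (D - 1 : ℕ) := by exact_mod_cast this
          linarith
        calc 1 / η = (2 / η ^ 2) * η / D * (D / 2) := by field_simp
          _ ≤ K * η / D * (D / 2) := by gcongr
          _ ≤ z * (D - 1 : ℕ) := mul_le_mul h1 h6 (by positivity) (le_trans (by positivity) h1)
  have h7 : Real.exp (-(1 / η)) ≤ η := by
    rw [Real.exp_neg, inv_le_comm₀ (Real.exp_pos _) hη0, ← one_div]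
    linarith [Real.add_one_le_exp (1 / η)]
  linarith

theorem coverage_ge {D n K : ℕ} {η : ℝ} (hη0 : 0 < η) (hη1 : η ≤ 1) (hD : 2 ≤ D) (hn : 0 < n)
    (hnη : 1 / (n : ℝ) ≤ η) (hK : 2 / η ^ 2 ≤ K) (hKD : ((K : ℝ) + 1) / D ≤ η) :
    1 - 3 * η ≤
      D * ∑ i ∈ range (K * n), ((1 - hazard (n * D) D i) ^ (D - 1)) ^ 2 / (n * D : ℕ) := by
  have hDpos : (0 : ℝ) < D := by exact_mod_cast (by omega : 0 < D)
  have hnpos : (0 : ℝ) < n := by exact_mod_cast hn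
  have hn1 : (1 : ℝ) ≤ n := by exact_mod_cast hn
  have hKD' : K < D := by
    have h := (div_le_iff₀ hDpos).1 hKD
    have : (K : ℝ) < D := by nlinarith
    exact_mod_cast this
  have hTN : K * n < n * D := by rw [mul_comm n]; exact Nat.mul_lt_mul_of_pos_right hKD' hn
  have h1 := pow_hazard_le hη0 hD hn hK hKD'
  have h2 : hazard (n * D) D (K * n) ≤ η := by
    refine (hazard_bounds hTN).2.trans (le_trans ?_ hKD)
    push_cast
    rw [div_le_div_iff₀ (by positivity) hDpos]
    nlinarith [mul_pos hnpos hDpos]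
  have h3 : 1 - η ≤ (1 - hazard (n * D) D 0) ^ (D - 1) := by
    have hb := one_add_mul_le_pow (a := -hazard (n * D) D 0) (by
      have := one_sub_hazard_nonneg (D := D) (show 0 < n * D by positivity)
      linarith) (D - 1)
    have h4 : ((D - 1 : ℕ) : ℝ) ≤ D := by exact_mod_cast Nat.sub_le D 1
    have h5 : ((D - 1 : ℕ) : ℝ) * hazard (n * D) D 0 ≤ η := by
      refine le_trans ?_ hnη
      rw [hazard]
      push_cast
      calc ((D - 1 : ℕ) : ℝ) * (1 / (n * D)) ≤ D * (1 / (n * D)) := by gcongr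
        _ = 1 / n := by field_simp
    calc 1 - η ≤ 1 + ((D - 1 : ℕ) : ℝ) * -hazard (n * D) D 0 := by linarith
      _ ≤ _ := hb
      _ = _ := by rw [← sub_eq_add_neg]
  refine le_trans ?_ (sum_sq_ge hTN)
  by_cases hη2 : η ≤ 1 / 2
  · calc 1 - 3 * η ≤ (1 - η) * (1 - 2 * η) := by nlinarith
      _ ≤ _ := mul_le_mul (by linarith) (by linarith) (by linarith)
        (one_sub_hazard_nonneg hTN)
  · have h6 : (1 - hazard (n * D) D (K * n)) ^ (D - 1) ≤ (1 - hazard (n * D) D 0) ^ (D - 1) :=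
      pow_le_pow_left₀ (one_sub_hazard_nonneg hTN)
        (by linarith [hazard_mono (D := D) (Nat.zero_le (K * n)) hTN]) _
    have := mul_nonneg (one_sub_hazard_nonneg (D := D) hTN) (sub_nonneg.2 h6)
    linarith

variable {V : Type} [Fintype V] {R : SimpleGraph V} {N D T : ℕ} {p : ℝ}

theorem exists_isLaw (hTN : T < N) (hN : 2 ≤ N) (hp0 : 0 ≤ p) (hp1 : p ≤ 1) :
    ∃ μ : Seed V → Fin N → ℝ, IsLaw R D T p μ := by
  have hNpos : (0 : ℝ) < N := by exact_mod_cast (by omega : 0 < N)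
  let deg : V → ℕ := fun u => (univ.filter fun w => R.Adj u w).card
  let κ : V → ℕ → ℝ := fun u s => if s = 0 then 1 else
    if s - 1 < T then (1 - hazard N D (s - 1)) ^ (D - deg u) else 0
  have hκ : ∀ u s, κ u (s + 1) ≤ κ u s := by
    intro u s
    simp only [κ, Nat.add_eq_zero_iff, one_ne_zero, and_false, if_false, Nat.add_sub_cancel]
    by_cases hs : s < T
    · rw [if_pos hs]
      have h0 := one_sub_hazard_nonneg (D := D) (hs.trans hTN)
      by_cases hs0 : s = 0
      · rw [if_pos hs0]
        refine pow_le_one₀ h0 ?_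
        have := (hazard_bounds (D := D) (hs.trans hTN)).1
        have h1 : (0 : ℝ) ≤ 1 / N := by positivity
        linarith
      · rw [if_neg hs0, if_pos (by omega)]
        refine pow_le_pow_left₀ h0 ?_ _
        linarith [hazard_mono (D := D) (show s - 1 ≤ s by omega) (hs.trans hTN)]
    · rw [if_neg hs]
      split_ifs with h1 h2
      · exact zero_le_one
      · exact pow_nonneg (one_sub_hazard_nonneg (by omega)) _
      · exact le_rfl
  have hκN : ∀ u, κ u N = 0 := by
    intro u
    simp only [κ]
    rw [if_neg (by omega), if_neg (by omega)]
  have htail : ∀ u j, j < N → (∑ s : Fin N, if j < (s : ℕ) then κ u s - κ u (s + 1) else 0) =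
      κ u (j + 1) := by
    intro u j hj
    rw [Fin.sum_univ_eq_sum_range (fun s => if j < s then κ u s - κ u (s + 1) else 0),
      ← sum_filter]
    have : (range N).filter (fun s => j < s) = Ico (j + 1) N := by
      ext s; simp only [mem_filter, mem_range, mem_Ico]; omega
    rw [this, sum_Ico_eq_sum_range]
    have h := sum_range_sub' (fun k => κ u (j + 1 + k)) (N - (j + 1))
    simp only [add_assoc] at h ⊢
    rw [h, show j + (1 + (N - (j + 1))) = N by omega, hκN]
    simp
  let μ : Seed V → Fin N → ℝ := Sum.elim (fun u s => κ u s - κ u (s + 1))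
    (Sum.elim (fun _ s => if (s : ℕ) = 0 then p else if (s : ℕ) = 1 then 1 - p else 0)
      fun _ _ => 1 / N)
  have hcoin : ∀ f : ℕ → ℝ, (∑ s : Fin N, f s * (if (s : ℕ) = 0 then p else
      if (s : ℕ) = 1 then 1 - p else 0)) = f 0 * p + f 1 * (1 - p) := by
    intro f
    rw [Fin.sum_univ_eq_sum_range (fun s => f s * (if s = 0 then p else if s = 1 then 1 - p else 0)),
      show N = 2 + (N - 2) by omega, sum_range_add, sum_range_succ, sum_range_one]
    simp [show ∀ x, 2 + x ≠ 1 by omega]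
  have hμ : IsProb μ := by
    constructor
    · rintro (u | v | e) s
      · exact sub_nonneg.2 (hκ u s)
      · simp only [μ, Sum.elim_inr, Sum.elim_inl]
        split_ifs <;> linarith
      · simp only [μ, Sum.elim_inr]
        positivity
    · rintro (u | v | e)
      · simp only [μ, Sum.elim_inl]
        rw [Fin.sum_univ_eq_sum_range (fun s => κ u s - κ u (s + 1)), sum_range_sub', hκN]
        simp [κ]
      · simpa [μ] using hcoin 1
      · simp [μ, hNpos.ne']
  refine ⟨μ, hμ, fun e i hi => ?_, fun u j hj => ?_, fun v => ?_⟩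
  · have h := Pr_coord hμ (.inr (.inr e)) (fun s : Fin N => (s : ℕ) = i)
    rw [show (fun ω : Seed V → Fin N => arrive ω e = i) =
      fun ω => (ω (.inr (.inr e)) : ℕ) = i from rfl, h]
    simp only [μ, Sum.elim_inr]
    rw [Fin.sum_univ_eq_sum_range (fun s => if s = i then 1 / (N : ℝ) else 0)]
    simp [hi]
  · have h := Pr_coord hμ (.inl u) (fun s : Fin N => j < (s : ℕ))
    rw [show (fun ω : Seed V → Fin N => j < retire ω u) =
      fun ω => j < (ω (.inl u) : ℕ) from rfl, h]
    simp only [μ, Sum.elim_inl]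
    rw [htail u j (hj.trans hTN)]
    simp [κ, hj, deg]
  · have h := Pr_coord hμ (.inr (.inl v)) (fun s : Fin N => (s : ℕ) = 0)
    rw [show (fun ω : Seed V → Fin N => Asleep ω v) =
      fun ω => (ω (.inr (.inl v)) : ℕ) = 0 from rfl, h]
    simp only [μ, Sum.elim_inr, Sum.elim_inl]
    have h' := hcoin fun s => if s = 0 then 1 else 0
    simp only [ite_mul, one_mul, zero_mul] at h'
    rw [h']
    simp

end RandomMatching

namespace RandomMatching

open Finset ProductWeight
open scoped Classical

variable {V : Type} {R : SimpleGraph V} {N D T g : ℕ} {p : ℝ}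

/-- The alternating path from `v` returns to `v` after `l` double steps, through awake vertices. -/
def Closing (f M : V → V) (sleep : V → Prop) (l : ℕ) (v : V) : Prop :=
  ((f ∘ M)^[l] v = v ∧ ∀ i < l, (f ∘ M)^[i] v ≠ f v) ∧
    (∀ i < l, ∀ j < l, (f ∘ M)^[i] v = (f ∘ M)^[j] v → i = j) ∧ ∀ i < l, ¬ sleep ((f ∘ M)^[i] v)

/-- The alternating path from `v` visits distinct awake vertices for `l` double steps. -/
def Long (f M : V → V) (sleep : V → Prop) (l : ℕ) (v : V) : Prop :=
  (∀ i < l, ∀ j < l, (f ∘ M)^[i] v = (f ∘ M)^[j] v → i = j) ∧ ∀ i < l, ¬ sleep ((f ∘ M)^[i] v)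

/-- The greedy matching determined by the seeds. -/
noncomputable def seedMate (R : SimpleGraph V) (T : ℕ) (ω : Seed V → Fin N) : V → V :=
  mate R T (retire ω) (arrive ω)

/-- The arrival times of the edges at `u`. -/
def star (u : V) : Set (Seed V) := {x | ∃ y, x = .inr (.inr s(u, y))}

/-- The seeds with all arrival times at `u` replaced by `top`. -/
noncomputable def mute (u : V) (top : Fin N) (ω : Seed V → Fin N) : Seed V → Fin N :=
  (star u).piecewise (fun _ => top) ω

theorem arrive_mute_star (u y : V) (top : Fin N) (ω : Seed V → Fin N) :
    arrive (mute u top ω) s(u, y) = top := by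
  rw [arrive, mute, Set.piecewise_eq_of_mem]
  exact ⟨y, rfl⟩

theorem arrive_mute_of_ne {u x y : V} (hx : x ≠ u) (hy : y ≠ u) (top : Fin N)
    (ω : Seed V → Fin N) : arrive (mute u top ω) s(x, y) = arrive ω s(x, y) := by
  rw [arrive, mute, Set.piecewise_eq_of_notMem, arrive]
  rintro ⟨z, hz⟩
  have hz : s(x, y) = s(u, z) := by simpa using hz
  rcases Sym2.eq_iff.1 hz with ⟨h, -⟩ | ⟨-, h⟩
  · exact hx h
  · exact hy h

theorem retire_mute (u : V) (top : Fin N) (ω : Seed V → Fin N) :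
    retire (mute u top ω) = retire ω := by
  funext x
  rw [retire, mute, Set.piecewise_eq_of_notMem, retire]
  rintro ⟨z, hz⟩
  simp at hz

theorem dependsOn_mute {α : Type*} (u : V) (top : Fin N) (F : (Seed V → Fin N) → α) :
    DependsOn (fun ω => F (mute u top ω)) (star u)ᶜ := by
  intro ω ω' h
  refine congrArg F (funext fun x => ?_)
  by_cases hx : x ∈ star u
  · simp [mute, hx]
  · simp [mute, hx, h x hx]

/-- The coin seeds. -/
def coins : Set (Seed V) := {x | ∃ v, x = .inr (.inl v)}

theorem dependsOn_seedMate : DependsOn (seedMate (N := N) R T) coinsᶜ := by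
  intro ω ω' h
  have h1 : retire ω = retire ω' := funext fun v =>
    congrArg Fin.val (h _ fun ⟨_, hx⟩ => by simp at hx)
  have h2 : arrive ω = arrive ω' := funext fun e =>
    congrArg Fin.val (h _ fun ⟨_, hx⟩ => by simp at hx)
  rw [seedMate, seedMate, h1, h2]

theorem exists_mem_branch_of_closing {f : V → V} (hf : Function.Involutive f) {ω : Seed V → Fin N}
    {top : Fin N} (htop : T ≤ top) {l : ℕ} (hl : 0 < l) {v : V}
    (h1 : (f ∘ seedMate R T ω)^[l] v = v)
    (h2 : ∀ i < l, (f ∘ seedMate R T ω)^[i] v ≠ f v) :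
    ∃ i < l, ∃ w, R.Adj (f v) w ∧ arrive ω s(f v, w) < T ∧
      (f ∘ seedMate R T (mute (f v) top ω))^[i] v ∈ Branch R T w (f v) := by
  set M := seedMate R T ω with hM
  set M' := seedMate R T (mute (f v) top ω) with hM'
  have hu : M' (f v) = f v := by
    refine mate_eq_self_of_le fun y _ => ?_
    rw [arrive_mute_star]
    exact htop
  have hex : ∃ i, i < l ∧ M ((f ∘ M)^[i] v) ≠ M' ((f ∘ M)^[i] v) := by
    by_contra hcon
    push Not at hcon
    have h3 := hcon (l - 1) (by omega)
    obtain ⟨k, rfl⟩ : ∃ k, l = k + 1 := ⟨l - 1, by omega⟩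
    rw [Function.iterate_succ_apply', Function.comp_apply] at h1
    have h4 : M ((f ∘ M)^[k] v) = f v := by rw [← h1, hf]; rw [h1]
    rw [Nat.add_sub_cancel, h4] at h3
    have h5 : M' (f v) = (f ∘ M)^[k] v := by rw [h3]; exact mate_involutive _
    exact h2 k (by omega) (by rw [← h5, hu])
  obtain ⟨hil, hne⟩ := Nat.find_spec hex
  set i := Nat.find hex
  have hmin : ∀ j < i, M ((f ∘ M)^[j] v) = M' ((f ∘ M)^[j] v) := by
    intro j hj
    have := Nat.find_min hex hj
    push Not at this
    exact this (hj.trans hil)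
  have hiter : ∀ j ≤ i, (f ∘ M')^[j] v = (f ∘ M)^[j] v := by
    intro j
    induction j with
    | zero => simp
    | succ j ih =>
      intro hj
      rw [Function.iterate_succ_apply', Function.iterate_succ_apply', ih (by omega),
        Function.comp_apply, Function.comp_apply, hmin j (by omega)]
  refine ⟨i, hil, ?_⟩
  rw [hiter i le_rfl]
  rw [hM, hM', seedMate, seedMate, retire_mute] at hne
  exact mate_diff (fun x y hx hy => (arrive_mute_of_ne hx hy top ω).symm)
    (fun y _ => by rw [arrive_mute_star]; exact htop) (h2 i hil) hne

theorem dependsOn_asleep (v : V) :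
    DependsOn (fun ω : Seed V → Fin N => ¬ Asleep ω v) {.inr (.inl v)} := by
  intro ω ω' h
  simp only [Asleep, h _ (Set.mem_singleton _)]

theorem asleep_piecewise (ω ω' : Seed V → Fin N) (v : V) :
    Asleep (coins.piecewise ω' ω) v = Asleep ω' v := by
  rw [Asleep, Asleep, Set.piecewise_eq_of_mem]
  exact ⟨v, rfl⟩

variable [Fintype V] {μ : Seed V → Fin N → ℝ}

theorem IsLaw.pr_arrive_lt (hμ : IsLaw R D T p μ) (hTN : T < N) (e : Sym2 V) :
    Pr μ (fun ω => arrive ω e < T) = T / N := by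
  rw [Pr_exists_eq_sum (range T) (B := fun i ω => arrive ω e = i) (fun ω => by simp)
    fun ω k k' _ _ h h' => h.symm.trans h',
    sum_congr rfl fun i hi => hμ.arrive_eq e i ((mem_range.1 hi).trans hTN)]
  simp [div_eq_mul_inv]

theorem IsLaw.pr_matched_le (hμ : IsLaw R D T p μ) (hTN : T < N) (v w : V) :
    Pr μ (fun ω => Matched R T (retire ω) (arrive ω) v w) ≤ T / N := by
  rw [← hμ.pr_arrive_lt hTN s(v, w)]
  exact Pr_mono hμ.toIsProb fun ω h => h.2.1

theorem IsLaw.pr_awake (hμ : IsLaw R D T p μ) (v : V) :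
    Pr μ (fun ω => ¬ Asleep ω v) = 1 - p := by
  rw [Pr_not hμ.toIsProb, hμ.asleep]

theorem IsLaw.pr_awake_le (hμ : IsLaw R D T p μ) (hp : p ≤ 1) {A : (Seed V → Fin N) → Prop}
    (hA : DependsOn A coinsᶜ) {X : (Seed V → Fin N) → ℕ → V} (hX : DependsOn X coinsᶜ) (l : ℕ) :
    Pr μ (fun ω => A ω ∧ (∀ i < l, ∀ j < l, X ω i = X ω j → i = j) ∧ ∀ i < l, ¬ Asleep ω (X ω i)) ≤
      (1 - p) ^ l * Pr μ A := by
  have hp' : 0 ≤ (1 - p) ^ l := pow_nonneg (by linarith) _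
  rw [show (1 - p) ^ l * Pr μ A = Ex μ _ from (Ex_mul_left _ _).symm]
  refine Pr_le_Ex_of_resample hμ.toIsProb coins fun ω => ?_
  have hAω : ∀ ω', A (coins.piecewise ω' ω) = A ω := fun ω' =>
    hA fun x hx => Set.piecewise_eq_of_notMem _ _ _ hx
  have hXω : ∀ ω', X (coins.piecewise ω' ω) = X ω := fun ω' =>
    hX fun x hx => Set.piecewise_eq_of_notMem _ _ _ hx
  simp only [hAω, hXω, asleep_piecewise]
  by_cases h : A ω ∧ ∀ i < l, ∀ j < l, X ω i = X ω j → i = j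
  · rw [if_pos h.1, mul_one]
    have h1 := Pr_forall_of_dependsOn hμ.toIsProb (range l)
      (A := fun i (ω' : Seed V → Fin N) => ¬ Asleep ω' (X ω i))
      (s := fun i => {.inr (.inl (X ω i))}) (fun i _ => dependsOn_asleep _)
      (fun i hi j hj hij => by
        simp only [Set.disjoint_singleton, ne_eq, Sum.inr.injEq, Sum.inl.injEq]
        exact fun h' => hij (h.2 i (mem_range.1 hi) j (mem_range.1 hj) h'))
    simp only [hμ.pr_awake, prod_const, card_range] at h1
    rw [← h1]
    exact Pr_mono hμ.toIsProb fun ω' h' i hi => h'.2.2 i (mem_range.1 hi)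
  · refine le_trans (le_of_eq (Pr_eq_zero fun ω' h' => h ⟨h'.1, h'.2.1⟩)) ?_
    split_ifs <;> simp [hp']

theorem IsLaw.pr_mem_branch_le (hμ : IsLaw R D T p μ) (hTN : T < N)
    (hg : ∀ v (w : R.Walk v v), w.IsCycle → g ≤ w.length) (hT : 2 * T + 10 ≤ g) (u : V)
    {X : (Seed V → Fin N) → V} (hX : DependsOn X (star u)ᶜ) :
    Pr μ (fun ω => ∃ w, R.Adj u w ∧ arrive ω s(u, w) < T ∧ X ω ∈ Branch R T w u) ≤ T / N := by
  set C := univ.filter fun w => R.Adj u w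
  have h1 : ∀ w ∈ C, Pr μ (fun ω => arrive ω s(u, w) < T ∧ X ω ∈ Branch R T w u) =
      T / N * Pr μ (fun ω => X ω ∈ Branch R T w u) := by
    intro w _
    rw [Pr_and_of_dependsOn hμ.toIsProb (s := {.inr (.inr s(u, w))}) (t := (star u)ᶜ),
      hμ.pr_arrive_lt hTN]
    · intro ω ω' h
      have : arrive ω s(u, w) = arrive ω' s(u, w) := congrArg Fin.val (h _ rfl)
      simp only [this]
    · intro ω ω' h
      simp only [hX h]
    · rw [Set.disjoint_singleton_left, Set.notMem_compl_iff]
      exact ⟨w, rfl⟩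
  calc _ ≤ ∑ w ∈ C, Pr μ (fun ω => arrive ω s(u, w) < T ∧ X ω ∈ Branch R T w u) :=
        Pr_le_sum hμ.toIsProb C fun ω ⟨w, hw, h⟩ => ⟨w, mem_filter.2 ⟨mem_univ _, hw⟩, h⟩
    _ = T / N * ∑ w ∈ C, Pr μ (fun ω => X ω ∈ Branch R T w u) := by
        rw [mul_sum]; exact sum_congr rfl h1
    _ = T / N * Pr μ (fun ω => ∃ w ∈ C, X ω ∈ Branch R T w u) := by
        rw [Pr_exists_eq_sum C (A := fun ω => ∃ w ∈ C, X ω ∈ Branch R T w u)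
          (B := fun w ω => X ω ∈ Branch R T w u) fun _ => Iff.rfl]
        intro ω w w' hw hw' h h'
        by_contra hne
        exact Set.disjoint_left.1 (disjoint_branch hg (by omega) (mem_filter.1 hw).2
          (mem_filter.1 hw').2 hne) h h'
    _ ≤ _ := mul_le_of_le_one_right (by positivity) (Pr_le_one hμ.toIsProb _)

theorem IsLaw.pr_closing_le (hμ : IsLaw R D T p μ) (hp : p ≤ 1) (hTN : T < N)
    (hg : ∀ v (w : R.Walk v v), w.IsCycle → g ≤ w.length) (hT : 2 * T + 10 ≤ g)
    {f : V → V} (hf : Function.Involutive f) {l : ℕ} (hl : 0 < l) (v : V) :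
    Pr μ (fun ω => Closing f (seedMate R T ω) (Asleep ω) l v) ≤ (1 - p) ^ l * (l * (T / N)) := by
  refine (hμ.pr_awake_le hp (A := fun ω => (f ∘ seedMate R T ω)^[l] v = v ∧
    ∀ i < l, (f ∘ seedMate R T ω)^[i] v ≠ f v) (X := fun ω i => (f ∘ seedMate R T ω)^[i] v)
    ?_ ?_ l).trans (mul_le_mul_of_nonneg_left ?_ (pow_nonneg (by linarith) _))
  · intro ω ω' h
    simp only [dependsOn_seedMate h]
  · intro ω ω' h
    simp only [dependsOn_seedMate h]
  · let top : Fin N := ⟨T, hTN⟩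
    refine (Pr_le_sum hμ.toIsProb (range l) (B := fun i ω => ∃ w, R.Adj (f v) w ∧
      arrive ω s(f v, w) < T ∧
      (f ∘ seedMate R T (mute (f v) top ω))^[i] v ∈ Branch R T w (f v)) ?_).trans ?_
    · rintro ω ⟨h1, h2⟩
      obtain ⟨i, hi, h⟩ := exists_mem_branch_of_closing hf (top := top) le_rfl hl h1 h2
      exact ⟨i, mem_range.2 hi, h⟩
    · refine (sum_le_sum fun i _ => hμ.pr_mem_branch_le hTN hg hT (f v)
        (X := fun ω => (f ∘ seedMate R T (mute (f v) top ω))^[i] v)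
        (dependsOn_mute (f v) top fun ω => (f ∘ seedMate R T ω)^[i] v)).trans ?_
      simp

theorem IsLaw.pr_long_le (hμ : IsLaw R D T p μ) (hp : p ≤ 1) (f : V → V) (l : ℕ) (v : V) :
    Pr μ (fun ω => Long f (seedMate R T ω) (Asleep ω) l v) ≤ (1 - p) ^ l := by
  have h := hμ.pr_awake_le hp (A := fun _ => True) (X := fun ω i => (f ∘ seedMate R T ω)^[i] v)
    (fun _ _ _ => rfl) (fun ω ω' h => by simp only [dependsOn_seedMate h]) l
  refine le_trans (Pr_mono hμ.toIsProb fun ω h => ⟨trivial, h⟩) (h.trans ?_)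
  exact mul_le_of_le_one_right (pow_nonneg (by linarith) _) (Pr_le_one hμ.toIsProb _)

theorem IsLaw.pr_mate_asleep_le (hμ : IsLaw R D T p μ) (v : V) :
    Pr μ (fun ω => Asleep ω (seedMate R T ω v)) ≤ p := by
  refine (Pr_le_Ex_of_resample hμ.toIsProb coins (F := fun _ => p) fun ω => ?_).trans
    (Ex_const hμ.toIsProb p).le
  have hM : ∀ ω', seedMate R T (coins.piecewise ω' ω) = seedMate R T ω := fun ω' =>
    dependsOn_seedMate fun x hx => Set.piecewise_eq_of_notMem _ _ _ hx
  simp only [hM, asleep_piecewise]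
  exact (hμ.asleep (seedMate R T ω v)).le

end RandomMatching

namespace RandomMatching

open Finset
open scoped Classical

variable {V : Type} {R : SimpleGraph V} {g h n m t L : ℕ} {E F : Set (Sym2 V)}
  {c : Sym2 V → ℕ} {φ : ℕ → V → V}

/-- Some path from `v` alternating between `M` and one of the first `m` matchings `φ b` is closed
of length between `2 * h` and `2 * L`, or is long. -/
def Bad (φ : ℕ → V → V) (M : V → V) (sleep : V → Prop) (h L m : ℕ) (v : V) : Prop :=
  ∃ b < m, (∃ l ∈ Ico h L, Closing (φ b) M sleep l v) ∨ Long (φ b) M sleep L v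

theorem bad_of_altCycle (hcm : ∀ e ∈ E, c e < m)
    (hφ : ∀ x y, s(x, y) ∈ E → φ (c s(x, y)) x = y) {M : V → V} {sleep : V → Prop}
    (hF : ∀ x y, s(x, y) ∈ F → M x = y ∧ ¬ sleep x) {l : ℕ} {p : ℕ → V} (hl : 2 ≤ l)
    (hh : h ≤ l) (hp : AltCycle (E ∪ F) (fun e => if e ∈ E then c e else m) l p)
    (h0 : s(p 0, p 1) ∉ E) : Bad φ M sleep h L m (p 0) := by
  have hev : ∀ i, s(p (2 * i), p (2 * i + 1)) ∈ F := by
    intro i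
    have h1 := hp.alt_add 0 i
    simp only [zero_add, h0, if_false] at h1
    rcases hp.mem (2 * i) with hi | hi
    · rw [if_pos hi] at h1
      exact absurd h1 (hcm _ hi).ne
    · exact hi
  have h1E : s(p 1, p 2) ∈ E := by
    rcases hp.mem 1 with hi | hi
    · exact hi
    · have h2 := (hF _ _ (hev 0)).1
      have h3 := (hF _ _ (by rw [Sym2.eq_swap]; exact hev 0)).1
      have h4 : p 0 = p 2 := h3.symm.trans (hF _ _ hi).1
      rw [hp.inj] at h4
      have := Nat.le_of_dvd (by omega) ((Nat.modEq_iff_dvd' (by omega)).1 h4)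
      omega
  set b := c s(p 1, p 2) with hb
  have hodd : ∀ i, s(p (2 * i + 1), p (2 * i + 2)) ∈ E ∧ c s(p (2 * i + 1), p (2 * i + 2)) = b := by
    intro i
    have h1 := hp.alt_add 1 i
    rw [add_comm 1] at h1
    simp only [h1E, if_true] at h1
    by_cases hi : s(p (2 * i + 1), p (2 * i + 2)) ∈ E
    · rw [if_pos hi] at h1
      exact ⟨hi, h1⟩
    · rw [if_neg hi] at h1
      exact absurd h1.symm (hcm _ h1E).ne
  have hiter : ∀ i, (φ b ∘ M)^[i] (p 0) = p (2 * i) := by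
    intro i
    induction i with
    | zero => rfl
    | succ i ih =>
      rw [Function.iterate_succ_apply', ih, Function.comp_apply, (hF _ _ (hev i)).1,
        ← (hodd i).2, hφ _ _ (hodd i).1, mul_add, mul_one]
  have hdist : ∀ k ≤ l, ∀ i < k, ∀ j < k,
      (φ b ∘ M)^[i] (p 0) = (φ b ∘ M)^[j] (p 0) → i = j := by
    intro k hk i hi j hj hij
    rw [hiter, hiter, hp.inj] at hij
    have := Nat.ModEq.eq_of_lt_of_lt hij (by omega) (by omega)
    omega
  have hawake : ∀ i, ¬ sleep ((φ b ∘ M)^[i] (p 0)) := by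
    intro i
    rw [hiter]
    exact (hF _ _ (hev i)).2
  refine ⟨b, hcm _ h1E, ?_⟩
  rcases lt_or_ge l L with hlL | hlL
  · refine Or.inl ⟨l, mem_Ico.2 ⟨hh, hlL⟩, ⟨?_, fun i hi hcon => ?_⟩, hdist l le_rfl,
      fun i _ => hawake i⟩
    · rw [hiter, ← hp.periodic 0, zero_add]
    · obtain ⟨k, rfl⟩ : ∃ k, l = k + 1 := ⟨l - 1, by omega⟩
      have hk : φ b (p 0) = p (2 * k + 1) := by
        have h5 := hodd k
        rw [Sym2.eq_swap, show p (2 * k + 2) = p 0 by rw [← hp.periodic 0, zero_add, mul_add]] at h5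
        rw [← h5.2]
        exact hφ _ _ h5.1
      rw [hiter, hk, hp.inj] at hcon
      have := Nat.ModEq.eq_of_lt_of_lt hcon (by omega) (by omega)
      omega
  · exact Or.inr ⟨hdist L hlL, fun i _ => hawake i⟩

/-- Adding a new colour class that is contained in a matching and avoids bad edges. -/
theorem goodColoring_union (hc : GoodColoring g E c) (hcm : ∀ e ∈ E, c e < m)
    (hφ : ∀ x y, s(x, y) ∈ E → φ (c s(x, y)) x = y) {M : V → V} {sleep : V → Prop}
    (hg : 2 * h ≤ g) (hh : 2 ≤ h) (hF : ∀ x y, s(x, y) ∈ F → (M x = y ∧ ¬ sleep x) ∧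
      ¬ (Bad φ M sleep h L m x ∧ Bad φ M sleep h L m y)) :
    GoodColoring g (E ∪ F) (fun e => if e ∈ E then c e else m) := by
  have hbad : ∀ l p, g ≤ 2 * l → AltCycle (E ∪ F) (fun e => if e ∈ E then c e else m) l p →
      s(p 0, p 1) ∈ E := by
    intro l p hl hp
    by_contra h0
    have hl' : h ≤ l := by omega
    obtain ⟨k, rfl⟩ : ∃ k, l = k + 1 := ⟨l - 1, by omega⟩
    have h1 := bad_of_altCycle (h := h) (L := L) hcm hφ (fun x y hxy => (hF x y hxy).1)
      (by omega) hl' hp h0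
    have hper : p (1 + (2 * k + 1)) = p 0 := by
      rw [← hp.periodic 0]
      congr 1
      ring
    have h2 := bad_of_altCycle (h := h) (L := L) hcm hφ (fun x y hxy => (hF x y hxy).1)
      (by omega) hl' hp.mirror (by
        simp only [mul_zero, add_zero, mul_one, hper]
        rwa [Sym2.eq_swap])
    exact (hF _ _ ((hp.mem 0).resolve_left h0)).2 ⟨h1, h2⟩
  refine ⟨fun x y z hy hz hyz => ?_, fun l p hl hp => ?_⟩
  · by_cases hyE : s(x, y) ∈ E <;> by_cases hzE : s(x, z) ∈ E
    · simp only [hyE, hzE, if_true] at hyz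
      exact hc.proper x y z hyE hzE hyz
    · simp only [hyE, hzE, if_true, if_false] at hyz
      exact absurd hyz (hcm _ hyE).ne
    · simp only [hyE, hzE, if_true, if_false] at hyz
      exact absurd hyz.symm (hcm _ hzE).ne
    · exact (hF _ _ (hy.resolve_left hyE)).1.1.symm.trans (hF _ _ (hz.resolve_left hzE)).1.1
  · have hall : ∀ i, s(p i, p (i + 1)) ∈ E := fun i => by
      have := hbad l _ hl (hp.shift i)
      rwa [zero_add, add_comm 1] at this
    exact hc.noAlt l p hl (hp.mono hall fun i => (if_pos (hall i)).symm)

/-- The edge `xy` receives colour `a` in a block of rounds with matchings `M`, where the earlier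
colour classes are contained in the matchings `φ b`, `b < n + a`. -/
def Col (φ : ℕ → V → V) (sleep : ℕ → V → Prop) (h L n a : ℕ) (x y : V) : Prop :=
  (φ (n + a) x = y ∧ x ≠ y ∧ ¬ sleep a x ∧ ¬ sleep a y) ∧
    ¬ (Bad φ (φ (n + a)) (sleep a) h L (n + a) x ∧ Bad φ (φ (n + a)) (sleep a) h L (n + a) y) ∧
    ∀ a' < a, φ (n + a') x ≠ y

theorem Col.symm {sleep : ℕ → V → Prop} (hinv : ∀ a, Function.Involutive (φ (n + a))) {a : ℕ}
    {x y : V} (hxy : Col φ sleep h L n a x y) : Col φ sleep h L n a y x := by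
  obtain ⟨⟨h1, h2, h3, h4⟩, h5, h6⟩ := hxy
  refine ⟨⟨?_, h2.symm, h4, h3⟩, fun h => h5 h.symm, fun a' ha' hcon => h6 a' ha' ?_⟩
  · rw [← h1, hinv]
  · rw [← hcon, hinv]

/-- The edges coloured in the first `k` rounds. -/
def colored (φ : ℕ → V → V) (sleep : ℕ → V → Prop) (h L n k : ℕ) : Set (Sym2 V) :=
  {e | ∃ a < k, ∃ x y, e = s(x, y) ∧ Col φ sleep h L n a x y}

theorem mem_colored {sleep : ℕ → V → Prop} (hinv : ∀ a, Function.Involutive (φ (n + a)))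
    {k : ℕ} {x y : V} :
    s(x, y) ∈ colored φ sleep h L n k ↔ ∃ a < k, Col φ sleep h L n a x y := by
  constructor
  · rintro ⟨a, ha, x', y', he, hcol⟩
    rcases Sym2.eq_iff.1 he with ⟨rfl, rfl⟩ | ⟨rfl, rfl⟩
    · exact ⟨a, ha, hcol⟩
    · exact ⟨a, ha, hcol.symm hinv⟩
  · rintro ⟨a, ha, hcol⟩
    exact ⟨a, ha, x, y, rfl, hcol⟩

theorem exists_goodColoring_colored (hc : GoodColoring g E c) (hcn : ∀ e ∈ E, c e < n)
    (hφ : ∀ x y, s(x, y) ∈ E → φ (c s(x, y)) x = y) {sleep : ℕ → V → Prop}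
    (hg : 2 * h ≤ g) (hh : 2 ≤ h) (hinv : ∀ a, Function.Involutive (φ (n + a)))
    (hE : ∀ a x, φ (n + a) x ≠ x → s(x, φ (n + a) x) ∉ E) (k : ℕ) :
    ∃ c', GoodColoring g (E ∪ colored φ sleep h L n k) c' ∧
      (∀ e ∈ E ∪ colored φ sleep h L n k, c' e < n + k) ∧
      ∀ x y, s(x, y) ∈ E ∪ colored φ sleep h L n k → φ (c' s(x, y)) x = y := by
  induction k with
  | zero =>
    have h0 : E ∪ colored φ sleep h L n 0 = E := by simp [colored]
    rw [h0]
    exact ⟨c, hc, hcn, hφ⟩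
  | succ k ih =>
    obtain ⟨c', h1, h2, h3⟩ := ih
    set E' := E ∪ colored φ sleep h L n k with hE'
    set F : Set (Sym2 V) := {e | ∃ x y, e = s(x, y) ∧ Col φ sleep h L n k x y} with hFdef
    have hEF : E ∪ colored φ sleep h L n (k + 1) = E' ∪ F := by
      rw [hE', Set.union_assoc]
      congr 1
      ext e
      simp only [colored, Set.mem_union, Set.mem_ofPred_eq, hFdef]
      constructor
      · rintro ⟨a, ha, h⟩
        rcases Nat.lt_succ_iff_lt_or_eq.1 ha with ha | rfl
        · exact Or.inl ⟨a, ha, h⟩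
        · exact Or.inr h
      · rintro (⟨a, ha, h⟩ | h)
        · exact ⟨a, by omega, h⟩
        · exact ⟨k, by omega, h⟩
    have hF : ∀ x y, s(x, y) ∈ F → Col φ sleep h L n k x y := by
      rintro x y ⟨x', y', he, hcol⟩
      rcases Sym2.eq_iff.1 he with ⟨rfl, rfl⟩ | ⟨rfl, rfl⟩
      · exact hcol
      · exact hcol.symm hinv
    have hFE : ∀ x y, s(x, y) ∈ F → s(x, y) ∉ E' := by
      rintro x y hxy (hmem | hmem)
      · obtain ⟨h4, h5, -⟩ := (hF x y hxy).1
        rw [← h4] at hmem h5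
        exact hE k x h5.symm hmem
      · obtain ⟨a, ha, hcol⟩ := (mem_colored hinv).1 hmem
        exact (hF x y hxy).2.2 a ha hcol.1.1
    rw [hEF]
    refine ⟨_, goodColoring_union (L := L) (sleep := sleep k) h1 h2 h3 hg hh fun x y hxy =>
      ⟨⟨(hF x y hxy).1.1, (hF x y hxy).1.2.2.1⟩, (hF x y hxy).2.1⟩, ?_, ?_⟩
    · rintro e -
      split_ifs with he
      · exact (h2 e he).trans (by omega)
      · omega
    · intro x y hxy
      split_ifs with he
      · exact h3 x y he
      · exact (hF x y (hxy.resolve_left he)).1.1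

theorem card_neighbors_add_le [Fintype V] {sleep : ℕ → V → Prop} {R' : SimpleGraph V}
    (hinv : ∀ a, Function.Involutive (φ (n + a)))
    (hR : ∀ a x, φ (n + a) x ≠ x → R.Adj x (φ (n + a) x))
    (hR' : R' = R.deleteEdges (colored φ sleep h L n t)) (v : V) :
    (univ.filter fun w => R'.Adj v w).card +
      ((range t).filter fun a => Col φ sleep h L n a v (φ (n + a) v)).card ≤
      (univ.filter fun w => R.Adj v w).card := by
  subst hR'
  have hinj : Set.InjOn (fun a => φ (n + a) v)
      ((range t).filter fun a => Col φ sleep h L n a v (φ (n + a) v) : Finset ℕ) := by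
    intro a ha a' ha' haa
    have h1 := (mem_filter.1 ha).2.2.2
    have h2 := (mem_filter.1 ha').2.2.2
    rcases lt_trichotomy a a' with hlt | rfl | hlt
    · exact absurd haa (h2 a hlt)
    · rfl
    · exact absurd haa.symm (h1 a' hlt)
  rw [← card_image_of_injOn hinj, ← card_union_of_disjoint]
  · refine card_le_card (union_subset (fun w hw => ?_) fun w hw => ?_)
    · simp only [mem_filter, mem_univ, true_and, deleteEdges_adj] at hw ⊢
      exact hw.1
    · obtain ⟨a, ha, rfl⟩ := mem_image.1 hw
      exact mem_filter.2 ⟨mem_univ _, hR a v (mem_filter.1 ha).2.1.2.1.symm⟩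
  · rw [Finset.disjoint_left]
    intro w hw hw'
    obtain ⟨a, ha, rfl⟩ := mem_image.1 hw'
    simp only [mem_filter, mem_univ, true_and, deleteEdges_adj, mem_range] at hw ha
    exact hw.2 ((mem_colored hinv).2 ⟨a, ha.1, ha.2⟩)

end RandomMatching

namespace RandomMatching

open Finset ProductWeight
open scoped Classical

variable {V : Type} {G R : SimpleGraph V} {h n m T N L : ℕ}

/-- The vertices at distance at most `r` from `v`. -/
def ball (G : SimpleGraph V) (r : ℕ) (v : V) : Set V := {x | ∃ w : G.Walk v x, w.length ≤ r}

theorem self_mem_ball (r : ℕ) (v : V) : v ∈ ball G r v := ⟨.nil, Nat.zero_le _⟩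

theorem ball_mono {r s : ℕ} (hrs : r ≤ s) (v : V) : ball G r v ⊆ ball G s v :=
  fun _ ⟨w, hw⟩ => ⟨w, hw.trans hrs⟩

theorem ball_subset {r s : ℕ} {v x : V} (hx : x ∈ ball G r v) : ball G s x ⊆ ball G (r + s) v := by
  obtain ⟨w, hw⟩ := hx
  rintro y ⟨w', hw'⟩
  exact ⟨w.append w', by rw [Walk.length_append]; omega⟩

theorem mem_ball_comm {r : ℕ} {v x : V} (hx : x ∈ ball G r v) : v ∈ ball G r x := by
  obtain ⟨w, hw⟩ := hx
  exact ⟨w.reverse, by rwa [Walk.length_reverse]⟩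

theorem mem_ball_one {v x : V} (hx : G.Adj v x) : x ∈ ball G 1 v := ⟨hx.toWalk, le_rfl⟩

theorem card_ball_le [Fintype V] {Δ : ℕ}
    (hΔ : ∀ v, (univ.filter fun w => G.Adj v w).card ≤ Δ) (r : ℕ) (v : V) :
    (univ.filter fun x => x ∈ ball G r v).card ≤ (Δ + 1) ^ r := by
  induction r generalizing v with
  | zero =>
    rw [pow_zero, card_le_one]
    rintro x hx y hy
    obtain ⟨w, hw⟩ := (mem_filter.1 hx).2
    obtain ⟨w', hw'⟩ := (mem_filter.1 hy).2
    rw [← Walk.eq_of_length_eq_zero (Nat.le_zero.1 hw), Walk.eq_of_length_eq_zero (Nat.le_zero.1 hw')]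
  | succ r ih =>
    have hsub : (univ.filter fun x => x ∈ ball G (r + 1) v) ⊆
        (insert v (univ.filter fun w => G.Adj v w)).biUnion
          fun y => univ.filter fun x => x ∈ ball G r y := by
      intro x hx
      obtain ⟨w, hw⟩ := (mem_filter.1 hx).2
      cases w with
      | nil => exact mem_biUnion.2 ⟨v, mem_insert_self _ _, by simp [self_mem_ball]⟩
      | @cons _ y _ hvy w =>
        refine mem_biUnion.2 ⟨y, mem_insert_of_mem (by simpa using hvy), ?_⟩
        rw [Walk.length_cons] at hw
        exact mem_filter.2 ⟨mem_univ _, w, by omega⟩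
    refine (card_le_card hsub).trans ((card_biUnion_le_card_mul _ _ _ fun y _ => ih y).trans ?_)
    rw [pow_succ']
    exact Nat.mul_le_mul_right _ ((card_insert_le _ _).trans (Nat.succ_le_succ (hΔ v)))

/-- All seeds inside a set of vertices. -/
def zone (B : Set V) : Set (Seed V) := seeds B ∪ {x | ∃ v ∈ B, x = .inr (.inl v)}

theorem zone_mono {B B' : Set V} (hB : B ⊆ B') : zone B ⊆ zone B' :=
  Set.union_subset_union (seeds_mono hB) fun _ ⟨v, hv, hx⟩ => ⟨v, hB hv, hx⟩

theorem exists_mem_of_not_disjoint_zone {B B' : Set V} (hB : ¬ Disjoint (zone B) (zone B')) :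
    ∃ x, x ∈ B ∧ x ∈ B' := by
  by_contra hcon
  push Not at hcon
  refine hB (Set.disjoint_left.2 ?_)
  rintro x (h1 | ⟨v, hv, rfl⟩) (h2 | ⟨w, hw, h3⟩)
  · exact Set.disjoint_left.1 (disjoint_seeds (Set.disjoint_left.2 hcon)) h1 h2
  · subst h3
    rcases h1 with ⟨v, -, h⟩ | ⟨v, -, w, -, h⟩ <;> simp at h
  · rcases h2 with ⟨v, -, h⟩ | ⟨v, -, w, -, h⟩ <;> simp at h
  · have : v = w := by simpa using h3
    exact hcon v hv (this ▸ hw)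

theorem seedMate_congr (hR : R ≤ G) {ω ω' : Seed V → Fin N} {v : V}
    (hω : ∀ x ∈ zone (ball G (T + 1) v), ω x = ω' x) : seedMate R T ω v = seedMate R T ω' v := by
  have hret : ∀ x ∈ ball G (T + 1) v, retire ω x = retire ω' x := fun x hx =>
    congrArg Fin.val (hω _ (Or.inl (inl_mem_seeds.2 hx)))
  have harr : ∀ x ∈ ball G (T + 1) v, ∀ y ∈ ball G (T + 1) v,
      arrive ω s(x, y) = arrive ω' s(x, y) := fun x hx y hy =>
    congrArg Fin.val (hω _ (Or.inl (inr_mem_seeds.2 ⟨hx, hy⟩)))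
  have hal : ∀ j < T, ∀ u p, R.Adj u p → ball G (j + 1) u ⊆ ball G (T + 1) v →
      (Alive R (retire ω) (arrive ω) j u p ↔ Alive R (retire ω') (arrive ω') j u p) := by
    intro j hj u p hup hsub
    refine alive_congr (B := fun j u _ => ball G (j + 1) u) (J := T)
      (fun j u _ _ => self_mem_ball _ _)
      (fun j u _ c _ hc _ => ball_mono (by omega) _ (mem_ball_one (hR hc)))
      (fun i j u _ c hij _ _ hc _ => ?_) hj hup (fun x hx => hret x (hsub hx))
      fun x hx y hy => harr x (hsub hx) y (hsub hy)
    exact (ball_subset (mem_ball_one (hR hc))).trans (ball_mono (by omega) _)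
  refine mate_congr fun w hvw => ?_
  have hw1 := mem_ball_one (hR hvw)
  rw [Matched, Matched, harr v (self_mem_ball _ _) w (ball_mono (by omega) _ hw1)]
  refine and_congr_right fun _ => and_congr_right fun hlt => and_congr ?_ ?_
  · exact hal _ hlt v w hvw (ball_mono (by omega) _)
  · exact hal _ hlt w v hvw.symm ((ball_subset hw1).trans (ball_mono (by omega) _))

theorem seedMate_mem_ball (hR : R ≤ G) (ω : Seed V → Fin N) (v : V) :
    seedMate R T ω v ∈ ball G 1 v := by
  by_cases hv : seedMate R T ω v = v
  · rw [hv]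
    exact self_mem_ball _ _
  · exact mem_ball_one (hR (mate_adj hv))

theorem asleep_congr {B : Set V} {ω ω' : Seed V → Fin N} (hω : ∀ x ∈ zone B, ω x = ω' x) {v : V}
    (hv : v ∈ B) : Asleep ω v ↔ Asleep ω' v := by
  rw [Asleep, Asleep, hω _ (Or.inr ⟨v, hv, rfl⟩)]

section Congr

variable {f f' M M' : V → V} {sleep sleep' : V → Prop} {v : V}

theorem iterate_congr (hf : ∀ x, f x ∈ ball G 1 x) (hM : ∀ x, M x ∈ ball G 1 x)
    (hff : ∀ x ∈ ball G (2 * L) v, f x = f' x) (hMM : ∀ x ∈ ball G (2 * L) v, M x = M' x)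
    {i : ℕ} (hi : i ≤ L) :
    (f ∘ M)^[i] v = (f' ∘ M')^[i] v ∧ (f ∘ M)^[i] v ∈ ball G (2 * i) v := by
  induction i with
  | zero => exact ⟨rfl, self_mem_ball _ _⟩
  | succ i ih =>
    obtain ⟨h1, h2⟩ := ih (by omega)
    have h3 : M ((f ∘ M)^[i] v) ∈ ball G (2 * i + 1) v := ball_subset h2 (hM _)
    rw [Function.iterate_succ_apply', Function.iterate_succ_apply', Function.comp_apply,
      Function.comp_apply, ← h1, ← hMM _ (ball_mono (by omega) _ h2),
      ← hff _ (ball_mono (by omega) _ h3)]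
    exact ⟨rfl, ball_subset h3 (hf _)⟩

theorem closing_congr (hf : ∀ x, f x ∈ ball G 1 x) (hM : ∀ x, M x ∈ ball G 1 x)
    (hff : ∀ x ∈ ball G (2 * L) v, f x = f' x) (hMM : ∀ x ∈ ball G (2 * L) v, M x = M' x)
    (hs : ∀ x ∈ ball G (2 * L) v, sleep x ↔ sleep' x) {l : ℕ} (hl : l ≤ L)
    (hc : Closing f M sleep l v) : Closing f' M' sleep' l v := by
  have hit := fun {i : ℕ} (hi : i ≤ L) => iterate_congr hf hM hff hMM hi
  obtain ⟨⟨h1, h2⟩, h3, h4⟩ := hc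
  refine ⟨⟨by rw [← (hit hl).1, h1], fun i hi => ?_⟩, fun i hi j hj => ?_, fun i hi => ?_⟩
  · rw [← (hit (by omega)).1, ← hff _ (self_mem_ball _ _)]
    exact h2 i hi
  · rw [← (hit (by omega)).1, ← (hit (by omega)).1]
    exact h3 i hi j hj
  · have h5 := hit (i := i) (by omega)
    rw [← h5.1, ← hs _ (ball_mono (by omega) _ h5.2)]
    exact h4 i hi

theorem long_congr (hf : ∀ x, f x ∈ ball G 1 x) (hM : ∀ x, M x ∈ ball G 1 x)
    (hff : ∀ x ∈ ball G (2 * L) v, f x = f' x) (hMM : ∀ x ∈ ball G (2 * L) v, M x = M' x)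
    (hs : ∀ x ∈ ball G (2 * L) v, sleep x ↔ sleep' x)
    (hc : Long f M sleep L v) : Long f' M' sleep' L v := by
  have hit := fun {i : ℕ} (hi : i ≤ L) => iterate_congr hf hM hff hMM hi
  obtain ⟨h3, h4⟩ := hc
  refine ⟨fun i hi j hj => ?_, fun i hi => ?_⟩
  · rw [← (hit hi.le).1, ← (hit hj.le).1]
    exact h3 i hi j hj
  · have h5 := hit (i := i) hi.le
    rw [← h5.1, ← hs _ (ball_mono (by omega) _ h5.2)]
    exact h4 i hi

theorem bad_congr {φ φ' : ℕ → V → V} (hφ : ∀ b x, φ b x ∈ ball G 1 x)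
    (hM : ∀ x, M x ∈ ball G 1 x) (hφφ : ∀ b < m, ∀ x ∈ ball G (2 * L) v, φ b x = φ' b x)
    (hMM : ∀ x ∈ ball G (2 * L) v, M x = M' x) (hs : ∀ x ∈ ball G (2 * L) v, sleep x ↔ sleep' x)
    (hb : Bad φ M sleep h L m v) : Bad φ' M' sleep' h L m v := by
  obtain ⟨b, hb, hc⟩ := hb
  refine ⟨b, hb, hc.imp ?_ fun hc => long_congr (hφ b) hM (hφφ b hb) hMM hs hc⟩
  rintro ⟨l, hl, hc⟩
  exact ⟨l, hl, closing_congr (hφ b) hM (hφφ b hb) hMM hs (mem_Ico.1 hl).2.le hc⟩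

theorem col_congr {φ φ' : ℕ → V → V} {sleep sleep' : ℕ → V → Prop} {a : ℕ}
    (hφ : ∀ b x, φ b x ∈ ball G 1 x) (hφ' : ∀ b x, φ' b x ∈ ball G 1 x)
    (hφφ : ∀ b ≤ n + a, ∀ x ∈ ball G (2 * L + 1) v, φ b x = φ' b x)
    (hs : ∀ x ∈ ball G (2 * L + 1) v, sleep a x ↔ sleep' a x)
    (hc : Col φ sleep h L n a v (φ (n + a) v)) : Col φ' sleep' h L n a v (φ' (n + a) v) := by
  have h0 : ∀ b ≤ n + a, φ b v = φ' b v := fun b hb => hφφ b hb v (self_mem_ball _ _)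
  rw [← h0 _ le_rfl]
  have h1 := hφ (n + a) v
  have hbad : ∀ y ∈ ball G 1 v, Bad φ' (φ' (n + a)) (sleep' a) h L (n + a) y →
      Bad φ (φ (n + a)) (sleep a) h L (n + a) y := by
    intro y hy
    have hsub : ball G (2 * L) y ⊆ ball G (2 * L + 1) v :=
      (ball_subset hy).trans (ball_mono (by omega) _)
    exact bad_congr hφ' (hφ' _) (fun b hb x hx => (hφφ b hb.le x (hsub hx)).symm)
      (fun x hx => (hφφ _ le_rfl x (hsub hx)).symm) fun x hx => (hs x (hsub hx)).symm
  obtain ⟨⟨h2, h3, h4, h5⟩, h6, h7⟩ := hc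
  refine ⟨⟨(h0 _ le_rfl).symm, h3, ?_, ?_⟩, fun h8 => h6 ?_, fun a' ha' => ?_⟩
  · rwa [← hs _ (self_mem_ball _ _)]
  · rwa [← hs _ (ball_mono (by omega) _ h1)]
  · exact ⟨hbad _ (self_mem_ball _ _) h8.1, hbad _ h1 h8.2⟩
  · rw [← h0 _ (by omega)]
    exact h7 a' ha'

end Congr

end RandomMatching

namespace ProductWeight

open scoped Classical

theorem Pr_comp {ι S : Type} [Fintype ι] [Fintype S] {μ : ι → S → ℝ} (hμ : IsProb μ) {κ : Type}
    [Fintype κ] {j : κ → ι} (hj : Function.Injective j) (A : (κ → S) → Prop) :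
    Pr μ (fun ω => A (fun k => ω (j k))) = Pr (fun k => μ (j k)) A :=
  Ex_comp hμ hj fun ω => if A ω then 1 else 0

end ProductWeight

namespace RandomMatching

open Finset ProductWeight ColoringExtension
open scoped Classical

variable {V : Type} {G R : SimpleGraph V} {g h n m t T N L D : ℕ} {E : Set (Sym2 V)}
  {c : Sym2 V → ℕ}

theorem partner_involutive (hc : GoodColoring g E c) (b : ℕ) :
    Function.Involutive (partner E c b) := by
  intro x
  by_cases h : ∃ y, s(x, y) ∈ E ∧ c s(x, y) = b
  · obtain ⟨y, hy, hb⟩ := h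
    rw [partner_eq hc hy hb]
    rw [Sym2.eq_swap] at hy hb
    exact partner_eq hc hy hb
  · have h1 : partner E c b x = x := dif_neg h
    rw [h1, h1]

theorem partner_mem_ball (hE : E ⊆ G.edgeSet) (b : ℕ) (x : V) :
    partner E c b x ∈ ball G 1 x := by
  by_cases h : ∃ y, s(x, y) ∈ E ∧ c s(x, y) = b
  · have h1 : partner E c b x = h.choose := dif_pos h
    rw [h1]
    exact mem_ball_one (hE h.choose_spec.1)
  · have h1 : partner E c b x = x := dif_neg h
    rw [h1]
    exact self_mem_ball _ _

/-- An upper bound for the probability that a vertex is bad for a given earlier colour. -/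
noncomputable def badBound (p ρ : ℝ) (h L : ℕ) : ℝ :=
  ∑ l ∈ Ico h L, (1 - p) ^ l * (l * ρ) + (1 - p) ^ L

section Law

variable [Fintype V] {μ : Seed V → Fin N → ℝ} {p : ℝ}

theorem IsLaw.pr_bad_le (hμ : IsLaw R D T p μ) (hp : p ≤ 1) (hTN : T < N)
    (hg : ∀ v (w : R.Walk v v), w.IsCycle → g ≤ w.length) (hT : 2 * T + 10 ≤ g) (hh : 2 ≤ h)
    {φ : ℕ → V → V} (hφ : ∀ b < m, Function.Involutive (φ b)) (v : V) :
    Pr μ (fun ω => Bad φ (seedMate R T ω) (Asleep ω) h L m v) ≤ m * badBound p (T / N) h L := by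
  refine (Pr_le_sum hμ.toIsProb (range m) (B := fun b ω =>
    (∃ l ∈ Ico h L, Closing (φ b) (seedMate R T ω) (Asleep ω) l v) ∨
      Long (φ b) (seedMate R T ω) (Asleep ω) L v) fun ω ⟨b, hb, h⟩ =>
    ⟨b, mem_range.2 hb, h⟩).trans ?_
  refine (sum_le_card_nsmul _ _ (badBound p (T / N) h L) fun b hb => ?_).trans (by simp)
  refine (Pr_or_le hμ.toIsProb (B := fun ω =>
    ∃ l ∈ Ico h L, Closing (φ b) (seedMate R T ω) (Asleep ω) l v)
    (C := fun ω => Long (φ b) (seedMate R T ω) (Asleep ω) L v) fun _ h => h).trans ?_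
  refine add_le_add ((Pr_le_sum hμ.toIsProb (Ico h L) (B := fun l ω =>
    Closing (φ b) (seedMate R T ω) (Asleep ω) l v) fun _ h => h).trans ?_) (hμ.pr_long_le hp _ _ _)
  exact sum_le_sum fun l hl =>
    hμ.pr_closing_le hp hTN hg hT (hφ b (mem_range.1 hb)) (by have := (mem_Ico.1 hl).1; omega) v

theorem IsLaw.pr_fail_le (hμ : IsLaw R D T p μ) (hp : p ≤ 1) (hTN : T < N)
    (hg : ∀ v (w : R.Walk v v), w.IsCycle → g ≤ w.length) (hT : 2 * T + 10 ≤ g) (hh : 2 ≤ h)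
    (hD : ∀ u, (univ.filter fun w => R.Adj u w).card ≤ D)
    {φ : ℕ → V → V} (hφ : ∀ b < m, Function.Involutive (φ b)) (old : Finset V) (v : V) :
    Pr μ (fun ω => seedMate R T ω v = v ∨ Asleep ω v ∨ Asleep ω (seedMate R T ω v) ∨
      Bad φ (seedMate R T ω) (Asleep ω) h L m v ∨ ∃ y ∈ old, y ≠ v ∧ seedMate R T ω v = y) ≤
      (1 - (univ.filter fun w => R.Adj v w).card *
        ∑ i ∈ range T, ((1 - hazard N D i) ^ (D - 1)) ^ 2 / N) + (p + (p +
        (m * badBound p (T / N) h L + old.card * (T / N)))) := by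
  have hP := hμ.toIsProb
  refine (Pr_or_le hP fun _ h => h).trans (add_le_add ?_ <|
    (Pr_or_le hP fun _ h => h).trans (add_le_add (hμ.asleep v).le <|
    (Pr_or_le hP fun _ h => h).trans (add_le_add (hμ.pr_mate_asleep_le v) <|
    (Pr_or_le hP fun _ h => h).trans (add_le_add (hμ.pr_bad_le hp hTN hg hT hh hφ v) ?_))))
  · rw [← hμ.pr_mate_ne hg hT hTN hD v, ← Pr_not hP]
    exact Pr_mono hP fun ω h h' => h' h
  · refine (Pr_le_sum hP old (B := fun y ω => y ≠ v ∧ seedMate R T ω v = y)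
      fun _ h => h).trans ((sum_le_card_nsmul _ _ ((T : ℝ) / N) fun y _ => ?_).trans (by simp))
    refine le_trans (Pr_mono hP fun ω ⟨h1, h2⟩ => ?_) (hμ.pr_matched_le hTN v y)
    exact (mate_eq_iff h1.symm).1 h2

end Law

section Round

variable [NeZero t]

/-- The seeds of round `a` in a block of `t` rounds. -/
def round (ω : Fin t × Seed V → Fin N) (a : ℕ) : Seed V → Fin N :=
  fun x => ω (Fin.ofNat t a, x)

/-- The seeds of round `a`, as a set of coordinates. -/
def roundSeeds (V : Type) (t a : ℕ) : Set (Fin t × Seed V) := {q | (q.1 : ℕ) = a}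

/-- The first `n` matchings are given by `f`, the others are those of the rounds. -/
noncomputable def blockMate (f : ℕ → V → V) (n : ℕ) (R : SimpleGraph V) (T : ℕ)
    (ω : Fin t × Seed V → Fin N) (b : ℕ) : V → V :=
  if b < n then f b else seedMate R T (round ω (b - n))

/-- Vertex `v` fails to get a coloured edge in round `a`. -/
def Fails (f : ℕ → V → V) (R : SimpleGraph V) (n T h L : ℕ) (ω : Fin t × Seed V → Fin N) (a : ℕ)
    (v : V) : Prop :=
  ¬ Col (blockMate f n R T ω) (fun a => Asleep (round ω a)) h L n a v (blockMate f n R T ω (n + a) v)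

variable {f : ℕ → V → V}

theorem blockMate_add (ω : Fin t × Seed V → Fin N) (a : ℕ) :
    blockMate f n R T ω (n + a) = seedMate R T (round ω a) := by
  simp [blockMate]

theorem blockMate_mem_ball (hR : R ≤ G) (hf : ∀ b x, f b x ∈ ball G 1 x)
    (ω : Fin t × Seed V → Fin N) (b : ℕ) (x : V) : blockMate f n R T ω b x ∈ ball G 1 x := by
  rw [blockMate]
  split_ifs
  · exact hf b x
  · exact seedMate_mem_ball hR _ _

theorem blockMate_involutive (hf : ∀ b, Function.Involutive (f b))
    (ω : Fin t × Seed V → Fin N) (b : ℕ) : Function.Involutive (blockMate f n R T ω b) := by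
  rw [blockMate]
  split_ifs
  · exact hf b
  · exact mate_involutive

theorem fails_congr (hR : R ≤ G) (hf : ∀ b x, f b x ∈ ball G 1 x) {ω ω' : Fin t × Seed V → Fin N}
    {a : ℕ} {v : V}
    (hω : ∀ i ≤ a, ∀ x ∈ zone (ball G (2 * L + T + 2) v), round ω i x = round ω' i x)
    (hfail : Fails f R n T h L ω a v) : Fails f R n T h L ω' a v := by
  refine fun hcol => hfail (col_congr (blockMate_mem_ball hR hf _) (blockMate_mem_ball hR hf _)
    (fun b hb x hx => ?_) (fun x hx => ?_) hcol)
  · rw [blockMate, blockMate]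
    split_ifs
    · rfl
    · refine (seedMate_congr hR fun y hy => hω _ (by omega) y (zone_mono ?_ hy)).symm
      exact (ball_subset hx).trans (ball_mono (by omega) _)
  · exact (asleep_congr (hω a le_rfl) (ball_mono (by omega) _ hx)).symm

theorem round_piecewise_self (ω ω' : Fin t × Seed V → Fin N) {a : ℕ} (ha : a < t) :
    round ((roundSeeds V t a).piecewise ω' ω) a = round ω' a := by
  funext x
  exact Set.piecewise_eq_of_mem _ _ _ (Nat.mod_eq_of_lt ha)

theorem round_piecewise_of_ne (ω ω' : Fin t × Seed V → Fin N) {a i : ℕ} (hi : i < t)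
    (hia : i ≠ a) : round ((roundSeeds V t a).piecewise ω' ω) i = round ω i := by
  funext x
  exact Set.piecewise_eq_of_notMem _ _ _ fun h => hia ((Nat.mod_eq_of_lt hi).symm.trans h)

variable [Fintype V] {μ : Seed V → Fin N → ℝ} {p : ℝ}

theorem IsLaw.pr_fails_le (hμ : IsLaw R D T p μ) (hp : p ≤ 1) (hTN : T < N)
    (hg : ∀ v (w : R.Walk v v), w.IsCycle → g ≤ w.length) (hT : 2 * T + 10 ≤ g) (hh : 2 ≤ h)
    (hD : ∀ u, (univ.filter fun w => R.Adj u w).card ≤ D)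
    (hf : ∀ b, Function.Involutive (f b)) {a : ℕ} (ha : a < t) (v : V)
    (ω : Fin t × Seed V → Fin N) :
    Pr (fun q : Fin t × Seed V => μ q.2)
      (fun ω' => Fails f R n T h L ((roundSeeds V t a).piecewise ω' ω) a v) ≤
      (1 - (univ.filter fun w => R.Adj v w).card *
        ∑ i ∈ range T, ((1 - hazard N D i) ^ (D - 1)) ^ 2 / N) + (p + (p +
        ((n + a : ℕ) * badBound p (T / N) h L + a * (T / N)))) := by
  have hP : IsProb (fun q : Fin t × Seed V => μ q.2) :=
    ⟨fun q => hμ.nonneg q.2, fun q => hμ.sum_eq_one q.2⟩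
  set φ := blockMate f n R T ω with hφ
  set old := (range a).image fun a' => φ (n + a') v with hold
  have hcard : old.card ≤ a := card_image_le.trans (card_range a).le
  refine le_trans ?_ (le_trans (hμ.pr_fail_le (L := L) hp hTN hg hT hh hD (m := n + a) (φ := φ)
    (fun b _ => blockMate_involutive hf ω b) old v) ?_)
  · have hcomp := Pr_comp hP (j := fun x : Seed V => ((Fin.ofNat t a, x) : Fin t × Seed V))
      (fun x y hxy => (Prod.mk.inj hxy).2)
      (fun ρ => seedMate R T ρ v = v ∨ Asleep ρ v ∨ Asleep ρ (seedMate R T ρ v) ∨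
        Bad φ (seedMate R T ρ) (Asleep ρ) h L (n + a) v ∨
        ∃ y ∈ old, y ≠ v ∧ seedMate R T ρ v = y)
    refine le_trans ?_ hcomp.le
    refine Pr_mono hP fun ω' hfail => ?_
    change seedMate R T (round ω' a) v = v ∨ Asleep (round ω' a) v ∨
      Asleep (round ω' a) (seedMate R T (round ω' a) v) ∨
        Bad φ (seedMate R T (round ω' a)) (Asleep (round ω' a)) h L (n + a) v ∨
        ∃ y ∈ old, y ≠ v ∧ seedMate R T (round ω' a) v = y
    by_contra! hcon
    obtain ⟨h1, h2, h3, h4, h5⟩ := hcon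
    have hlt : ∀ b < n + a, blockMate f n R T ((roundSeeds V t a).piecewise ω' ω) b = φ b := by
      intro b hb
      rw [hφ, blockMate, blockMate]
      split_ifs
      · rfl
      · rw [round_piecewise_of_ne _ _ (by omega) (by omega)]
    refine hfail ?_
    rw [Col]
    simp only [blockMate_add, round_piecewise_self _ _ ha]
    refine ⟨⟨trivial, h1.symm, h2, h3⟩, fun ⟨⟨b, hb, h6⟩, _⟩ => h4 ⟨b, hb, ?_⟩, fun a' ha' h6 => ?_⟩
    · rwa [← hlt b hb]
    · rw [← blockMate_add (f := f) (n := n), hlt _ (by omega)] at h6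
      exact h5 _ (mem_image.2 ⟨a', mem_range.2 ha', rfl⟩) (by rw [h6]; exact h1) h6.symm
  · have : (old.card : ℝ) ≤ a := by exact_mod_cast hcard
    gcongr

end Round

end RandomMatching

namespace RandomMatching

open Finset ProductWeight ColoringExtension
open scoped Classical

variable {V : Type} [Fintype V] {G R : SimpleGraph V} {g h n t T N L D Δ : ℕ} {η : ℝ}
  {f : ℕ → V → V}

theorem exists_few_fails [NeZero t] (hR : R ≤ G) (hf : ∀ b, Function.Involutive (f b))
    (hfb : ∀ b x, f b x ∈ ball G 1 x)
    (hg : ∀ v (w : R.Walk v v), w.IsCycle → g ≤ w.length)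
    (hΔ : ∀ v, (univ.filter fun w => G.Adj v w).card ≤ Δ)
    (hD : ∀ u, (univ.filter fun w => R.Adj u w).card ≤ D)
    (hT : 2 * T + 10 ≤ g) (hh : 2 ≤ h) (hTN : T < N) (hN : 2 ≤ N) (hη0 : 0 < η) (hη : η ≤ 1 / 10)
    (hcov : 1 - 3 * η ≤ D * ∑ i ∈ range T, ((1 - hazard N D i) ^ (D - 1)) ^ 2 / N)
    (htD : t ≤ η * D) (hbad : (n + t : ℕ) * badBound η (T / N) h L ≤ η)
    (htT : t * ((T : ℝ) / N) ≤ η)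
    (hlll : Real.exp (-(t * η ^ 2 / 4)) ≤
      1 / (4 * ((Δ + 1 : ℕ) : ℝ) ^ (2 * (2 * L + T + 2)))) :
    ∃ ω : Fin t × Seed V → Fin N, ∀ v, D - t < (univ.filter fun w => R.Adj v w).card →
      (((range t).filter fun a => Fails f R n T h L ω a v).card : ℝ) < 9 * η * t := by
  obtain ⟨μ, hμ⟩ := exists_isLaw (R := R) (D := D) (T := T) (p := η) hTN hN hη0.le (by linarith)
  have hP : IsProb (fun q : Fin t × Seed V => μ q.2) :=
    ⟨fun q => hμ.nonneg q.2, fun q => hμ.sum_eq_one q.2⟩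
  set r := 2 * L + T + 2
  let Y : V → ℕ → (Fin t × Seed V → Fin N) → ℝ := fun v a ω =>
    if a < t ∧ Fails f R n T h L ω a v then 1 else 0
  have hsum : ∀ v ω, ∑ a ∈ range t, Y v a ω =
      (((range t).filter fun a => Fails f R n T h L ω a v).card : ℝ) := by
    intro v ω
    rw [card_filter, Nat.cast_sum]
    refine sum_congr rfl fun a ha => ?_
    simp [Y, mem_range.1 ha]
  have hβ : 0 ≤ badBound η (T / N) h L := by
    have : 0 ≤ 1 - η := by linarith
    exact add_nonneg (sum_nonneg fun l _ => by positivity) (by positivity)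
  have hconc : ∀ v, D - t < (univ.filter fun w => R.Adj v w).card →
      Pr (fun q : Fin t × Seed V => μ q.2) (fun ω => (8 * η + η) * t ≤ ∑ a ∈ range t, Y v a ω) ≤
        Real.exp (-(t * η ^ 2 / 4)) := by
    intro v hv
    refine Pr_sum_ge_le hP (roundSeeds V t) (Y v) (fun a ω => ?_) (fun a k hak ω ω' hω => ?_)
      (by linarith) (by linarith) hη0 (by linarith) (fun a ω => ?_) t
    · simp only [Y]
      split_ifs <;> simp
    · by_cases hat : a < t
      · have hround : ∀ i ≤ a, ∀ x, round ω i x = round ω' i x := fun i hi x =>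
          hω _ fun hmem => by
            have : i % t = k := hmem
            rw [Nat.mod_eq_of_lt (by omega)] at this
            omega
        have : Fails f R n T h L ω a v ↔ Fails f R n T h L ω' a v :=
          ⟨fails_congr hR hfb fun i hi x _ => hround i hi x,
            fails_congr hR hfb fun i hi x _ => (hround i hi x).symm⟩
        simp only [Y, this]
      · simp only [Y, hat, false_and]
    · by_cases hat : a < t
      · simp only [Y, hat, true_and]
        refine (hμ.pr_fails_le (L := L) (by linarith) hTN hg hT hh hD hf hat v ω).trans ?_
        have hdeg : (1 - η) * D ≤ ((univ.filter fun w => R.Adj v w).card : ℝ) := by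
          have : (D : ℝ) ≤ ((univ.filter fun w => R.Adj v w).card : ℝ) + t := by
            exact_mod_cast (by omega : D ≤ (univ.filter fun w => R.Adj v w).card + t)
          linarith
        have hS : 0 ≤ ∑ i ∈ range T, ((1 - hazard N D i) ^ (D - 1)) ^ 2 / (N : ℝ) :=
          sum_nonneg fun i _ => by positivity
        have h1 : (1 - η) * (1 - 3 * η) ≤ ((univ.filter fun w => R.Adj v w).card : ℝ) *
            ∑ i ∈ range T, ((1 - hazard N D i) ^ (D - 1)) ^ 2 / N := by
          calc _ ≤ (1 - η) * (D * ∑ i ∈ range T, ((1 - hazard N D i) ^ (D - 1)) ^ 2 / N) :=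
                mul_le_mul_of_nonneg_left hcov (by linarith)
            _ ≤ _ := by
                rw [← mul_assoc]
                exact mul_le_mul_of_nonneg_right hdeg hS
        have h2 : ((n + a : ℕ) : ℝ) * badBound η (T / N) h L ≤ η :=
          le_trans (mul_le_mul_of_nonneg_right (by exact_mod_cast (by omega)) hβ) hbad
        have h3 : (a : ℝ) * (T / N) ≤ η :=
          le_trans (mul_le_mul_of_nonneg_right (by exact_mod_cast hat.le) (by positivity)) htT
        nlinarith
      · simp only [Y, hat, false_and, if_false]
        rw [Ex_const hP]
        linarith
  have hball := card_ball_le hΔ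
  obtain ⟨ω, hω⟩ : ∃ ω, ∀ v, ¬ (D - t < (univ.filter fun w => R.Adj v w).card ∧
      (8 * η + η) * t ≤ ∑ a ∈ range t, Y v a ω) := by
    refine exists_avoiding hP (s := fun v => {q | q.2 ∈ zone (ball G r v)})
      (d := ((Δ + 1 : ℕ) : ℝ) ^ (2 * r)) (fun v ω ω' hω => ?_) (one_le_pow₀ (by simp))
      (fun v => ?_) (fun v => ?_)
    · have : ∀ a, Fails f R n T h L ω a v ↔ Fails f R n T h L ω' a v := fun a =>
        ⟨fails_congr hR hfb fun i _ x hx => hω (Fin.ofNat t i, x) hx,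
          fails_congr hR hfb fun i _ x hx => (hω (Fin.ofNat t i, x) hx).symm⟩
      simp only [Y, this]
    · have h1 : (univ.filter fun w => ¬ Disjoint {q : Fin t × Seed V | q.2 ∈ zone (ball G r w)}
          {q | q.2 ∈ zone (ball G r v)}) ⊆ univ.filter fun w => w ∈ ball G (2 * r) v := by
        intro w hw
        obtain ⟨q, hq, hq'⟩ := Set.not_disjoint_iff.1 (mem_filter.1 hw).2
        obtain ⟨x, hx, hx'⟩ := exists_mem_of_not_disjoint_zone
          (Set.not_disjoint_iff.2 ⟨q.2, hq, hq'⟩)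
        rw [two_mul]
        exact mem_filter.2 ⟨mem_univ _, ball_subset hx' (mem_ball_comm hx)⟩
      exact_mod_cast (card_le_card h1).trans (hball (2 * r) v)
    · by_cases hv : D - t < (univ.filter fun w => R.Adj v w).card
      · simp only [hv, true_and]
        exact (hconc v hv).trans hlll
      · rw [Pr_eq_zero fun ω h => hv h.1]
        positivity
  refine ⟨ω, fun v hv => ?_⟩
  rw [← hsum]
  by_contra! hcon
  exact hω v ⟨hv, by linarith⟩

/-- A block of `t` new colours decreases the maximum degree of the uncoloured graph by almost `t`. -/
theorem exists_block (hR : R ≤ G) {c : Sym2 V → ℕ}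
    (hc : GoodColoring g (G.edgeSet \ R.edgeSet) c) (hcn : ∀ e ∈ G.edgeSet \ R.edgeSet, c e < n)
    (hg : ∀ v (w : G.Walk v v), w.IsCycle → g ≤ w.length)
    (hΔ : ∀ v, (univ.filter fun w => G.Adj v w).card ≤ Δ)
    (hD : ∀ u, (univ.filter fun w => R.Adj u w).card ≤ D)
    (hT : 2 * T + 10 ≤ g) (hh : 2 ≤ h) (hhg : 2 * h ≤ g) (hTN : T < N) (hN : 2 ≤ N) (hη0 : 0 < η)
    (hη : η ≤ 1 / 10)
    (hcov : 1 - 3 * η ≤ D * ∑ i ∈ range T, ((1 - hazard N D i) ^ (D - 1)) ^ 2 / N)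
    (htD : t ≤ η * D) (hbad : (n + t : ℕ) * badBound η (T / N) h L ≤ η)
    (htT : t * ((T : ℝ) / N) ≤ η)
    (hlll : Real.exp (-(t * η ^ 2 / 4)) ≤
      1 / (4 * ((Δ + 1 : ℕ) : ℝ) ^ (2 * (2 * L + T + 2)))) :
    ∃ R' ≤ R, ∃ c', GoodColoring g (G.edgeSet \ R'.edgeSet) c' ∧
      (∀ e ∈ G.edgeSet \ R'.edgeSet, c' e < n + t) ∧
      ∀ v, ((univ.filter fun w => R'.Adj v w).card : ℝ) ≤ D - (1 - 9 * η) * t := by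
  rcases Nat.eq_zero_or_pos t with rfl | ht
  · exact ⟨R, le_rfl, c, hc, hcn, fun v => by simpa using hD v⟩
  have : NeZero t := ⟨ht.ne'⟩
  set E := G.edgeSet \ R.edgeSet with hE
  have hgR : ∀ v (w : R.Walk v v), w.IsCycle → g ≤ w.length := fun v w hw => by
    simpa using hg v (w.mapLe hR) (hw.mapLe hR)
  obtain ⟨ω, hω⟩ := exists_few_fails (n := n) (f := partner E c) hR (partner_involutive hc)
    (partner_mem_ball Set.sdiff_subset) hgR hΔ hD hT hh hTN hN hη0 hη hcov htD hbad htT hlll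
  set φ := blockMate (partner E c) n R T ω with hφdef
  set sleep : ℕ → V → Prop := fun a => Asleep (round ω a)
  have hinv : ∀ a, Function.Involutive (φ (n + a)) := fun a =>
    blockMate_involutive (partner_involutive hc) ω _
  have hadj : ∀ a x, φ (n + a) x ≠ x → R.Adj x (φ (n + a) x) := by
    intro a x hx
    rw [hφdef, blockMate_add] at hx ⊢
    exact mate_adj hx
  obtain ⟨c', h1, h2, -⟩ := exists_goodColoring_colored (L := L) (sleep := sleep) hc hcn (φ := φ)
    (fun x y hxy => by rw [hφdef, blockMate, if_pos (hcn _ hxy)]; exact partner_eq hc hxy rfl)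
    hhg hh hinv (fun a x hx hmem => hmem.2 (hadj a x hx)) t
  obtain ⟨R', hR'⟩ : ∃ R', R' = R.deleteEdges (colored φ sleep h L n t) := ⟨_, rfl⟩
  have hsub : G.edgeSet \ R'.edgeSet ⊆
      E ∪ colored φ sleep h L n t := by
    rintro e ⟨he, he'⟩
    by_cases heR : e ∈ R.edgeSet
    · rw [hR', edgeSet_deleteEdges] at he'
      exact Or.inr (by_contra fun h => he' ⟨heR, h⟩)
    · exact Or.inl ⟨he, heR⟩
  refine ⟨R', hR'.trans_le (deleteEdges_le _), c', h1.mono hsub fun _ _ => rfl,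
    fun e he => h2 e (hsub he), fun v => ?_⟩
  have h3 := card_neighbors_add_le hinv hadj hR' v
  have h4 : ((range t).filter fun a => Col φ sleep h L n a v (φ (n + a) v)).card +
      ((range t).filter fun a => Fails (partner E c) R n T h L ω a v).card = t := by
    refine Eq.trans ?_ ((card_filter_add_card_filter_not (s := range t)
      fun a => Col φ sleep h L n a v (φ (n + a) v)).trans (card_range t))
    congr!
  have htD' : t ≤ D := by
    have h5 : (t : ℝ) ≤ D := htD.trans (mul_le_of_le_one_left (by positivity) (by linarith))
    exact_mod_cast h5
  by_cases hv : D - t < (univ.filter fun w => R.Adj v w).card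
  · have h5 := hω v hv
    have h6 := hD v
    have h7 : ((univ.filter fun w => R'.Adj v w).card : ℝ) +
        t ≤ D + ((range t).filter fun a => Fails (partner E c) R n T h L ω a v).card := by
      exact_mod_cast (by omega)
    linarith
  · have h5 : ((univ.filter fun w => R'.Adj v w).card : ℝ) +
        t ≤ D := by
      exact_mod_cast (by omega)
    have : 0 ≤ 9 * η * t := by positivity
    linarith

end RandomMatching

namespace RandomMatching

open Finset ProductWeight ColoringExtension Filter Topology
open scoped Classical

theorem exists_tail_le {η γ : ℝ} (hη0 : 0 < η) (hη1 : η ≤ 1) (hγ : 0 < γ) :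
    ∃ h : ℕ, 2 ≤ h ∧ ∀ L : ℕ, ∑ l ∈ Ico h L, (1 - η) ^ l * (l : ℝ) ≤ γ := by
  have hs : Summable fun l : ℕ => (1 - η) ^ l * (l : ℝ) := by
    have h := summable_pow_mul_geometric_of_norm_lt_one 1 (r := 1 - η)
      (by rw [Real.norm_eq_abs, abs_lt]; constructor <;> linarith)
    simpa [mul_comm] using h
  have h0 : ∀ l : ℕ, 0 ≤ (1 - η) ^ l * (l : ℝ) := fun l =>
    mul_nonneg (pow_nonneg (by linarith) _) (Nat.cast_nonneg _)
  obtain ⟨h, h1, h2⟩ := ((hs.hasSum.tendsto_sum_nat.eventually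
    (lt_mem_nhds (sub_lt_self (∑' l : ℕ, (1 - η) ^ l * (l : ℝ)) hγ))).and
      (eventually_ge_atTop 2)).exists
  refine ⟨h, h2, fun L => ?_⟩
  rcases le_total h L with hL | hL
  · have h3 := sum_range_add_sum_Ico (fun l : ℕ => (1 - η) ^ l * (l : ℝ)) hL
    have h4 := hs.sum_le_tsum (range L) fun l _ => h0 l
    linarith
  · simp [hL, hγ.le]

variable {V : Type} [Fintype V] {G : SimpleGraph V} {g h n t T K n₀ d L D Δ : ℕ} {η γ : ℝ}

/-- Numerical conditions under which a block of `t` colours can be used as long as the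
uncoloured graph has maximum degree more than `d`. -/
structure Admissible (g h t K n₀ d L Δ : ℕ) (η γ : ℝ) : Prop where
  η_pos : 0 < η
  η_le : η ≤ 1 / 10
  n₀_pos : 0 < n₀
  inv_n₀_le : 1 / (n₀ : ℝ) ≤ η
  le_K : 2 / η ^ 2 ≤ K
  le_d : (K : ℝ) + 1 ≤ η * d
  t_le : (t : ℝ) * K ≤ η * d
  t_le' : 2 * t ≤ Δ
  girth_le : 2 * (K * n₀) + 10 ≤ g
  two_le : 2 ≤ h
  h_le : 2 * h ≤ g
  tail_le : ∑ l ∈ Ico h L, (1 - η) ^ l * (l : ℝ) ≤ γ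
  bad_le : 2 * Δ * (γ * (K / d) + (1 - η) ^ L) ≤ η
  exp_le : Real.exp (-(t * η ^ 2 / 4)) ≤
    1 / (4 * ((Δ + 1 : ℕ) : ℝ) ^ (2 * (2 * L + K * n₀ + 2)))

theorem Admissible.exists_block (H : Admissible g h t K n₀ d L Δ η γ) {R : SimpleGraph V}
    (hR : R ≤ G) {c : Sym2 V → ℕ} (hc : GoodColoring g (G.edgeSet \ R.edgeSet) c)
    (hcn : ∀ e ∈ G.edgeSet \ R.edgeSet, c e < n)
    (hg : ∀ v (w : G.Walk v v), w.IsCycle → g ≤ w.length)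
    (hΔ : ∀ v, (univ.filter fun w => G.Adj v w).card ≤ Δ)
    (hD : ∀ u, (univ.filter fun w => R.Adj u w).card ≤ D) (hd : d ≤ D) (hn : n + t ≤ 2 * Δ) :
    ∃ R' ≤ R, ∃ c', GoodColoring g (G.edgeSet \ R'.edgeSet) c' ∧
      (∀ e ∈ G.edgeSet \ R'.edgeSet, c' e < n + t) ∧
      ∀ v, ((univ.filter fun w => R'.Adj v w).card : ℝ) ≤ D - (1 - 9 * η) * t := by
  have hη0 := H.η_pos
  have hη := H.η_le
  have hn₀ : (0 : ℝ) < n₀ := Nat.cast_pos.2 H.n₀_pos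
  have hdD : (d : ℝ) ≤ D := Nat.cast_le.2 hd
  have hK2 : (2 : ℝ) ≤ K := by
    refine le_trans ?_ H.le_K
    rw [le_div_iff₀ (by positivity)]
    nlinarith
  have hηd : η * d ≤ η * D := mul_le_mul_of_nonneg_left hdD hη0.le
  have hd0 : (0 : ℝ) < d := by
    by_contra! h0
    have := H.le_d
    nlinarith
  have hD0 : (0 : ℝ) < D := hd0.trans_le hdD
  have hKD : (K : ℝ) + 1 ≤ η * D := H.le_d.trans hηd
  have hKD' : (K : ℝ) < D := by nlinarith
  have hKDn : K < D := Nat.cast_lt.1 hKD'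
  have hK2n : 2 ≤ K := by exact_mod_cast hK2
  have hratio : ((K * n₀ : ℕ) : ℝ) / (n₀ * D : ℕ) = K / D := by
    push_cast
    field_simp
  refine RandomMatching.exists_block (T := K * n₀) (N := n₀ * D) (L := L) (h := h) hR hc hcn hg hΔ
    hD H.girth_le H.two_le H.h_le ?_ ?_ hη0 hη ?_ ?_ ?_ ?_ H.exp_le
  · rw [mul_comm]
    exact Nat.mul_lt_mul_of_pos_left hKDn H.n₀_pos
  · nlinarith [H.n₀_pos]
  · exact coverage_ge hη0 (by linarith) (by omega) H.n₀_pos H.inv_n₀_le H.le_K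
      ((div_le_iff₀ hD0).2 hKD)
  · have := H.t_le
    have : (0 : ℝ) ≤ t := Nat.cast_nonneg t
    nlinarith
  · rw [hratio]
    refine le_trans ?_ H.bad_le
    have h1 : ((n + t : ℕ) : ℝ) ≤ 2 * Δ := by exact_mod_cast hn
    have h2 : badBound η (K / D) h L ≤ γ * (K / d) + (1 - η) ^ L := by
      simp only [badBound, ← mul_assoc, ← sum_mul]
      have h3 : (K : ℝ) / D ≤ K / d := div_le_div_of_nonneg_left (by positivity) hd0 hdD
      have h4 : 0 ≤ ∑ l ∈ Ico h L, (1 - η) ^ l * (l : ℝ) :=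
        sum_nonneg fun l _ => mul_nonneg (pow_nonneg (by linarith) _) (Nat.cast_nonneg _)
      gcongr
      · exact h4.trans H.tail_le
      · exact H.tail_le
    have h5 : 0 ≤ γ * (K / d) + (1 - η) ^ L := by
      have h4 : 0 ≤ ∑ l ∈ Ico h L, (1 - η) ^ l * (l : ℝ) :=
        sum_nonneg fun l _ => mul_nonneg (pow_nonneg (by linarith) _) (Nat.cast_nonneg _)
      have := h4.trans H.tail_le
      have : 0 ≤ (1 - η) ^ L := pow_nonneg (by linarith) _
      positivity
    calc _ ≤ ((n + t : ℕ) : ℝ) * (γ * (K / d) + (1 - η) ^ L) :=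
          mul_le_mul_of_nonneg_left h2 (Nat.cast_nonneg _)
      _ ≤ _ := mul_le_mul_of_nonneg_right h1 h5
  · rw [hratio, mul_div_assoc', div_le_iff₀ hD0]
    exact H.t_le.trans hηd

/-- All but a graph of maximum degree `d` can be coloured with almost `Δ` colours. -/
theorem Admissible.exists_sparse [Nonempty V] (H : Admissible g h t K n₀ d L Δ η γ) (ht : 0 < t)
    (hη : η ≤ 1 / 30)
    (hg : ∀ v (w : G.Walk v v), w.IsCycle → g ≤ w.length)
    (hΔ : ∀ v, (univ.filter fun w => G.Adj v w).card ≤ Δ) :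
    ∃ R ≤ G, ∃ c n, GoodColoring g (G.edgeSet \ R.edgeSet) c ∧
      (∀ e ∈ G.edgeSet \ R.edgeSet, c e < n) ∧ (n : ℝ) * (1 - 9 * η) ≤ Δ ∧
      ∀ v, (univ.filter fun w => R.Adj v w).card ≤ d := by
  by_contra hcon
  have ht' : (0 : ℝ) < t := Nat.cast_pos.2 ht
  have key : ∀ j : ℕ, ∃ R ≤ G, ∃ c, GoodColoring g (G.edgeSet \ R.edgeSet) c ∧
      (∀ e ∈ G.edgeSet \ R.edgeSet, c e < j * t) ∧
      ∀ v, ((univ.filter fun w => R.Adj v w).card : ℝ) ≤ Δ - (1 - 9 * η) * (j * t : ℕ) := by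
    intro j
    induction j with
    | zero =>
      refine ⟨G, le_rfl, fun _ => 0, ⟨by simp, fun l p _ hp => ?_⟩, by simp, by simpa using hΔ⟩
      simpa using hp.mem 0
    | succ j ih =>
      obtain ⟨R, hR, c, hc, hcn, hdeg⟩ := ih
      have hj : ((j * t : ℕ) : ℝ) * (1 - 9 * η) ≤ Δ := by
        have := hdeg (Classical.arbitrary V)
        have h0 : (0 : ℝ) ≤ ((univ.filter fun w => R.Adj (Classical.arbitrary V) w).card : ℝ) :=
          Nat.cast_nonneg _
        linarith
      obtain ⟨u, -, hu⟩ := exists_max_image univ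
        (fun v => (univ.filter fun w => R.Adj v w).card) univ_nonempty
      have hd : d ≤ (univ.filter fun w => R.Adj u w).card := by
        by_contra! hlt
        exact hcon ⟨R, hR, c, j * t, hc, hcn, hj, fun v => (hu v (mem_univ _)).trans hlt.le⟩
      have hn : j * t + t ≤ 2 * Δ := by
        have h1 : ((2 * t : ℕ) : ℝ) ≤ Δ := Nat.cast_le.2 H.t_le'
        have h2 : (0 : ℝ) ≤ (j * t : ℕ) := Nat.cast_nonneg _
        have h3 : ((j * t + t : ℕ) : ℝ) ≤ (2 * Δ : ℕ) := by
          push_cast at *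
          nlinarith
        exact_mod_cast h3
      obtain ⟨R', hR', c', hc', hcn', hdeg'⟩ := H.exists_block hR hc hcn hg hΔ
        (fun v => hu v (mem_univ _)) hd hn
      refine ⟨R', hR'.trans hR, c', hc', by rwa [add_one_mul], fun v => (hdeg' v).trans ?_⟩
      have := hdeg u
      push_cast at *
      linarith
  obtain ⟨j, hj⟩ := exists_nat_gt (2 * (Δ : ℝ))
  obtain ⟨R, -, c, -, -, hdeg⟩ := key j
  have h1 := hdeg (Classical.arbitrary V)
  have h0 : (0 : ℝ) ≤ ((univ.filter fun w => R.Adj (Classical.arbitrary V) w).card : ℝ) :=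
    Nat.cast_nonneg _
  have h2 : (1 : ℝ) ≤ t := by exact_mod_cast ht
  have h3 : (j : ℝ) ≤ (j * t : ℕ) := by
    push_cast
    exact le_mul_of_one_le_right (Nat.cast_nonneg _) h2
  have h4 : (0 : ℝ) ≤ (j * t : ℕ) := Nat.cast_nonneg _
  nlinarith

end RandomMatching

namespace RandomMatching

open Finset Filter Topology

theorem tendsto_nat_sqrt_atTop : Tendsto Nat.sqrt atTop atTop :=
  tendsto_atTop.2 fun b => (eventually_ge_atTop (b * b)).mono fun _ h => Nat.le_sqrt.2 h

theorem eventually_decay_le {η θ : ℝ} (hη0 : 0 < η) (hη1 : η ≤ 1) (hθ : 0 < θ) :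
    ∀ᶠ Δ : ℕ in atTop, 2 * (Δ : ℝ) * (1 - η) ^ Nat.sqrt Δ ≤ θ := by
  have h1 : Tendsto (fun s : ℕ => 8 * ((s : ℝ) ^ 2 * (1 - η) ^ s)) atTop (𝓝 (8 * 0)) :=
    (tendsto_pow_const_mul_const_pow_of_abs_lt_one 2
      (by rw [abs_lt]; constructor <;> linarith)).const_mul 8
  rw [mul_zero] at h1
  have h2 := (h1.eventually (gt_mem_nhds hθ)).and (eventually_ge_atTop 1)
  refine (tendsto_nat_sqrt_atTop.eventually h2).mono fun Δ hΔ => ?_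
  refine le_trans ?_ hΔ.1.le
  have h3 : (1 : ℝ) ≤ Nat.sqrt Δ := by exact_mod_cast hΔ.2
  have h4 : (Δ : ℝ) ≤ ((Nat.sqrt Δ : ℝ) + 1) * (Nat.sqrt Δ + 1) := by
    exact_mod_cast (Nat.lt_succ_sqrt Δ).le
  have h5 : 2 * (Δ : ℝ) ≤ 8 * (Nat.sqrt Δ : ℝ) ^ 2 := by nlinarith
  calc _ ≤ 8 * (Nat.sqrt Δ : ℝ) ^ 2 * (1 - η) ^ Nat.sqrt Δ :=
        mul_le_mul_of_nonneg_right h5 (pow_nonneg (by linarith) _)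
    _ = _ := mul_assoc _ _ _

theorem eventually_exp_le {a : ℝ} (ha : 0 < a) (T : ℕ) :
    ∀ᶠ Δ : ℕ in atTop, Real.exp (-(a * Δ)) ≤
      1 / (4 * ((Δ + 1 : ℕ) : ℝ) ^ (2 * (2 * Nat.sqrt Δ + T + 2))) := by
  set θ := a / 22 with hθ
  have hθ0 : 0 < θ := by positivity
  have h1 : ∀ᶠ s : ℕ in atTop, ((s + 1 : ℕ) : ℝ) ≤ Real.exp (θ * s) := by
    have h := (Real.isLittleO_log_id_atTop.bound (half_pos hθ0))
    have h' := (tendsto_natCast_atTop_atTop (R := ℝ)).comp (tendsto_add_atTop_nat 1)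
    filter_upwards [h'.eventually h, eventually_ge_atTop 1] with s hs hs1
    have h2 : (1 : ℝ) ≤ s := by exact_mod_cast hs1
    simp only [Function.comp_apply, Real.norm_eq_abs, id] at hs
    have h3 := (le_abs_self _).trans hs
    rw [abs_of_nonneg (by positivity)] at h3
    rw [← Real.log_le_iff_le_exp (by positivity)]
    refine h3.trans ?_
    push_cast
    nlinarith
  have h2 : ∀ᶠ s : ℕ in atTop, (4 : ℝ) ≤ Real.exp (θ * s ^ 2) := by
    have h : Tendsto (fun s : ℕ => Real.exp (θ * (s : ℝ) ^ 2)) atTop atTop :=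
      Real.tendsto_exp_atTop.comp (((tendsto_pow_atTop two_ne_zero).comp
        tendsto_natCast_atTop_atTop).const_mul_atTop hθ0)
    exact h.eventually_ge_atTop 4
  refine (tendsto_nat_sqrt_atTop.eventually (h1.and (h2.and
    (eventually_ge_atTop (2 * T + 4))))).mono fun Δ hΔ => ?_
  obtain ⟨h3, h4, h5⟩ := hΔ
  set s := Nat.sqrt Δ
  have h6 : Δ + 1 ≤ (s + 1) ^ 2 := by
    rw [sq]
    exact Nat.lt_succ_sqrt Δ
  have h7 : ((s : ℝ)) ^ 2 ≤ Δ := by exact_mod_cast Nat.sqrt_le' Δ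
  rw [Real.exp_neg, ← one_div]
  refine one_div_le_one_div_of_le (by positivity) ?_
  calc 4 * ((Δ + 1 : ℕ) : ℝ) ^ (2 * (2 * s + T + 2))
      ≤ Real.exp (θ * s ^ 2) * (Real.exp (θ * s) ^ 2) ^ (5 * s) := by
        gcongr
        · calc ((Δ + 1 : ℕ) : ℝ) ^ (2 * (2 * s + T + 2)) ≤ ((Δ + 1 : ℕ) : ℝ) ^ (5 * s) :=
                pow_le_pow_right₀ (by simp) (by omega)
            _ ≤ _ := by
                gcongr
                calc ((Δ + 1 : ℕ) : ℝ) ≤ ((s + 1 : ℕ) : ℝ) ^ 2 := by exact_mod_cast h6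
                  _ ≤ _ := by gcongr
    _ = Real.exp (11 * θ * s ^ 2) := by
        rw [← pow_mul, ← Real.exp_nat_mul, ← Real.exp_add]
        congr 1
        push_cast
        ring
    _ ≤ Real.exp (a * Δ) := by
        refine Real.exp_le_exp.2 ?_
        have : 0 ≤ (Δ : ℝ) := Nat.cast_nonneg _
        nlinarith

theorem eventually_le_floor {c b : ℝ} (hb : b < c) :
    ∀ᶠ Δ : ℕ in atTop, b * Δ ≤ (⌊c * (Δ : ℝ)⌋₊ : ℝ) := by
  have h := ((tendsto_natCast_atTop_atTop (R := ℝ)).const_mul_atTop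
    (sub_pos.2 hb)).eventually_ge_atTop 1
  filter_upwards [h] with Δ hΔ
  have := Nat.lt_floor_add_one (c * (Δ : ℝ))
  linarith

theorem eventually_admissible {η δ : ℝ} (hη0 : 0 < η) (hη : η ≤ 1 / 10) (hδ0 : 0 < δ)
    (hδ : δ ≤ 1) :
    ∃ g, 6 ≤ g ∧ ∃ h K n₀ γ, ∀ᶠ Δ : ℕ in atTop, ∃ t L, 0 < t ∧
      Admissible g h t K n₀ ⌊δ * (Δ : ℝ)⌋₊ L Δ η γ := by
  obtain ⟨K, hK⟩ := exists_nat_ge (2 / η ^ 2)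
  obtain ⟨n₀, hn₀⟩ := exists_nat_gt (1 / η)
  have hK0 : (0 : ℝ) < K := lt_of_lt_of_le (by positivity) hK
  have hK1 : (1 : ℝ) ≤ K := by exact_mod_cast (Nat.cast_pos.1 hK0)
  have hn₀' : (0 : ℝ) < n₀ := lt_trans (by positivity) hn₀
  have hγ : 0 < η * δ / (8 * K) := by positivity
  obtain ⟨h, hh, htail⟩ := exists_tail_le hη0 (by linarith) hγ
  refine ⟨max (2 * h) (2 * (K * n₀) + 10), by omega, h, K, n₀, η * δ / (8 * K), ?_⟩
  have ha : 0 < η * δ / (4 * K) * η ^ 2 / 4 := by positivity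
  have htend := tendsto_natCast_atTop_atTop (R := ℝ)
  filter_upwards [eventually_exp_le ha (K * n₀),
    eventually_decay_le hη0 (by linarith) (half_pos hη0),
    eventually_le_floor (half_lt_self hδ0),
    eventually_le_floor (c := η * δ / (2 * K)) (b := η * δ / (4 * K))
      (div_lt_div_of_pos_left (by positivity) (by positivity) (by linarith)),
    (htend.const_mul_atTop (by positivity : 0 < η * (δ / 2))).eventually_ge_atTop ((K : ℝ) + 1),
    eventually_gt_atTop 0] with Δ h1 h2 h3 h4 h5 hΔ
  have hΔ' : (0 : ℝ) < Δ := Nat.cast_pos.2 hΔ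
  set d := ⌊δ * (Δ : ℝ)⌋₊
  set t := ⌊η * δ / (2 * K) * (Δ : ℝ)⌋₊
  have hd0 : (0 : ℝ) < d := lt_of_lt_of_le (by positivity) h3
  have ht0 : (0 : ℝ) < t := lt_of_lt_of_le (by positivity) h4
  have ht : (t : ℝ) ≤ η * δ / (2 * K) * Δ := Nat.floor_le (by positivity)
  have htK : (t : ℝ) * K ≤ η * (δ / 2 * Δ) := by
    calc (t : ℝ) * K ≤ η * δ / (2 * K) * Δ * K := by gcongr
      _ = _ := by field_simp
  refine ⟨t, Nat.sqrt Δ, Nat.cast_pos.1 ht0, hη0, hη, Nat.cast_pos.1 hn₀', ?_, hK, ?_, ?_, ?_,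
    le_max_right _ _, hh, le_max_left _ _, htail _, ?_, ?_⟩
  · rw [div_le_iff₀ hn₀']
    exact ((div_lt_iff₀' hη0).1 hn₀).le
  · refine h5.trans ?_
    rw [mul_assoc]
    gcongr
  · exact htK.trans (by gcongr)
  · have h6 : (t : ℝ) ≤ t * K := le_mul_of_one_le_right ht0.le hK1
    have h7 : η * (δ / 2 * Δ) ≤ 1 / 10 * (1 / 2 * Δ) := by gcongr
    have h8 : 2 * (t : ℝ) ≤ Δ := by linarith
    exact_mod_cast h8
  · have h6 : (Δ : ℝ) * (K / d) ≤ 2 * K / δ := by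
      rw [mul_div_assoc', div_le_div_iff₀ hd0 hδ0]
      nlinarith
    calc 2 * (Δ : ℝ) * (η * δ / (8 * K) * (K / d) + (1 - η) ^ Nat.sqrt Δ)
        = 2 * (η * δ / (8 * K)) * (Δ * (K / d)) + 2 * Δ * (1 - η) ^ Nat.sqrt Δ := by ring
      _ ≤ 2 * (η * δ / (8 * K)) * (2 * K / δ) + η / 2 := by gcongr
      _ = η := by
        field_simp
        ring
  · refine le_trans (Real.exp_le_exp.2 ?_) h1
    have : η * δ / (4 * K) * Δ * (η ^ 2 / 4) ≤ t * (η ^ 2 / 4) := by gcongr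
    linarith

end RandomMatching

open Finset RandomMatching ColoringExtension Filter in
open scoped Classical in
/-- The case of small `ε`, with the girth and degree conditions in elementary form. -/
theorem exists_isAcyclicEdgeColoring_of_le {ε : ℝ} (hε0 : 0 < ε) (hε : ε ≤ 1) :
    ∃ g Δ₀ : ℕ, ∀ Δ, Δ₀ ≤ Δ → ∀ (V : Type) [Fintype V] [Nonempty V] (G : SimpleGraph V),
      (∀ v (w : G.Walk v v), w.IsCycle → g ≤ w.length) →
      (∀ v, (univ.filter fun w => G.Adj v w).card ≤ Δ) →
      ∃ c : Sym2 V → ℕ, IsAcyclicEdgeColoring G ⌊(1 + ε) * (Δ : ℝ)⌋₊ c := by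
  have hδ0 : 0 < ε ^ 2 / 1000 := by positivity
  obtain ⟨g, hg6, h, K, n₀, γ, hev⟩ := eventually_admissible (η := ε / 100) (δ := ε ^ 2 / 1000)
    (by positivity) (by linarith) hδ0 (by nlinarith)
  have hev' := hev.and ((eventually_le_floor (c := ε / 4) (b := ε / 5)
    (by linarith)).and (eventually_gt_atTop 0))
  obtain ⟨Δ₀, hΔ₀⟩ := eventually_atTop.1 hev'
  refine ⟨g, Δ₀, fun Δ hΔ V _ _ G hg hdeg => ?_⟩
  obtain ⟨⟨t, L, ht, H⟩, hm, hΔ0⟩ := hΔ₀ Δ hΔ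
  obtain ⟨R, hR, c, n, hc, hcn, hn, hRd⟩ := H.exists_sparse ht (by linarith) hg hdeg
  set d := ⌊ε ^ 2 / 1000 * (Δ : ℝ)⌋₊
  set m := ⌊ε / 4 * (Δ : ℝ)⌋₊
  have hΔ1 : (0 : ℝ) < Δ := Nat.cast_pos.2 hΔ0
  have hm0 : (0 : ℝ) < m := lt_of_lt_of_le (by positivity) hm
  have hm1 : (m : ℝ) ≤ ε / 4 * Δ := Nat.floor_le (by positivity)
  have hd1 : (d : ℝ) ≤ ε ^ 2 / 1000 * Δ := Nat.floor_le (by positivity)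
  have hn1 : (n : ℝ) ≤ (1 + ε / 2) * Δ := by
    have h1 : (1 : ℝ) ≤ (1 + ε / 2) * (1 - 9 * (ε / 100)) := by nlinarith
    have h2 : (n : ℝ) ≤ n * ((1 + ε / 2) * (1 - 9 * (ε / 100))) :=
      le_mul_of_one_le_right (Nat.cast_nonneg _) h1
    have h3 := mul_le_mul_of_nonneg_left hn (by positivity : 0 ≤ 1 + ε / 2)
    linarith
  have hnm : (n : ℝ) + m ≤ 2 * Δ := by nlinarith
  have hcond : 20 * (n + m) * d ≤ m ^ 2 := by
    have h1 : 20 * ((n : ℝ) + m) * d ≤ 20 * (2 * Δ) * (ε ^ 2 / 1000 * Δ) := by gcongr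
    have h2 : (ε / 5 * Δ) ^ 2 ≤ (m : ℝ) ^ 2 := by gcongr
    have h3 : 20 * ((n : ℝ) + m) * d ≤ (m : ℝ) ^ 2 := by linarith
    exact_mod_cast h3
  obtain ⟨c', hc', hcn'⟩ := exists_extension hg6 hc hcn (Nat.cast_pos.1 hm0) hcond R.edgeFinset
    (fun e he h => h.2 (mem_edgeFinset.1 he)) (fun x => by simpa using hRd x)
  rw [coe_edgeFinset, Set.sdiff_union_of_subset (edgeSet_subset_edgeSet.2 hR)] at hc' hcn'
  refine ⟨c', hc'.isAcyclicEdgeColoring (fun e he => (hcn' e he).trans_le ?_) hg⟩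
  refine Nat.le_floor ?_
  push_cast
  nlinarith

/-- For every `ε > 0` there exist `g = g(ε)` and `Δ₀ = Δ₀(ε)` such that every finite
simple graph `G` with maximum degree `Δ ≥ Δ₀` and girth at least `g` admits an acyclic
edge colouring with at most `⌊(1+ε)Δ⌋` colours, i.e. `a'(G) ≤ (1+ε)Δ`. -/
theorem statement0 :
    ∀ ε : ℝ, 0 < ε →
      ∃ g Δ₀ : ℕ,
        ∀ (V : Type) [Fintype V] [DecidableEq V] (G : SimpleGraph V) [DecidableRel G.Adj],
          Δ₀ ≤ G.maxDegree → (g : ℕ∞) ≤ G.girth →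
            ∃ c : Sym2 V → ℕ,
              IsAcyclicEdgeColoring G (⌊(1 + ε) * (G.maxDegree : ℝ)⌋₊) c := by
  intro ε hε
  obtain ⟨g, Δ₀, H⟩ := exists_isAcyclicEdgeColoring_of_le (lt_min hε one_pos) (min_le_right ε 1)
  refine ⟨g, Δ₀ + 1, fun V _ _ G _ hΔ hg => ?_⟩
  have hV : Nonempty V := by
    by_contra hV
    rw [not_nonempty_iff] at hV
    simp at hΔ
  obtain ⟨c, hc⟩ := H G.maxDegree (by omega) V G
    (fun v w hw => le_trans (by exact_mod_cast hg) (girth_le_length hw)) fun v => by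
      refine le_trans (le_of_eq ?_) (G.degree_le_maxDegree v)
      rw [← card_neighborFinset_eq_degree, neighborFinset_eq_filter]
      congr!
  refine ⟨c, fun e he => (hc.1 e he).trans_le (Nat.floor_mono ?_), hc.2⟩
  gcongr
  exact min_le_left ε 1
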